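/- arXiv:2003.08053 — 2 statements merged into one kernel-verified Lean document; each statement's English description precedes it below -/
import Mathlib

section
/- Let Γ be a commutative thick weakly distance-regular digraph and let p, q, h be integers with q ≠ p and h > 2. If Γ_{1,p-1}^2 ∩ Γ_{1,h-1}Γ_{h-1,1} ≠ ∅ and Γ_{1,h-1}^2 ∩ Γ_{1,q-1}Γ_{q-1,1} ≠ ∅, then Γ_{1,p-1}^2 ∩ Γ_{1,q-1}Γ_{q-1,1} ≠ ∅. -/
/-!
Common framework: commutative thick weakly distance-regular digraphs.
-/

variable {V : Type*}

/-- There is a directed walk of length `n` from `x` to `y`. -/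
def HasWalk (adj : V → V → Prop) (x y : V) (n : ℕ) : Prop :=
  ∃ f : ℕ → V, f 0 = x ∧ f n = y ∧ ∀ i < n, adj (f i) (f (i + 1))

/-- Directed distance `∂(x,y)`. -/
noncomputable def ddist (adj : V → V → Prop) (x y : V) : ℕ :=
  sInf {n | HasWalk adj x y n}

/-- Two-way distance `∂̃(x,y) = (∂(x,y), ∂(y,x))`. -/
noncomputable def tdist (adj : V → V → Prop) (x y : V) : ℕ × ℕ :=
  (ddist adj x y, ddist adj y x)

/-- The pair `i` is an attained two-way distance, i.e. `i ∈ ∂̃(Γ)`. -/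
def Attained (adj : V → V → Prop) (i : ℕ × ℕ) : Prop :=
  ∃ x y : V, tdist adj x y = i

/-- Intersection number `p^h_{i,j}`: for attained `h` it is the common cardinality of
`{z | ∂̃(x,z) = i, ∂̃(z,y) = j}` over pairs with `∂̃(x,y) = h` (and `0` otherwise). -/
noncomputable def pnum (adj : V → V → Prop) (h i j : ℕ × ℕ) : ℕ :=
  sSup {n | ∃ x y : V, tdist adj x y = h ∧
    n = Set.ncard {z : V | tdist adj x z = i ∧ tdist adj z y = j}}

/-- Valency `k_i = |Γ_i(x)|`. -/
noncomputable def kval (adj : V → V → Prop) (i : ℕ × ℕ) : ℕ :=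
  pnum adj (0, 0) i i.swap

/-- Adjacency of the subdigraph `Δ_J`: arcs of type `(1, t-1)` for `t ∈ J`. -/
def deltaAdj (adj : V → V → Prop) (J : Set ℕ) (u v : V) : Prop :=
  ∃ t ∈ J, tdist adj u v = (1, t - 1)

/-- A circuit of length `s`. -/
def IsCircuit (adj : V → V → Prop) (s : ℕ) (f : ℕ → V) : Prop :=
  0 < s ∧ f s = f 0 ∧ ∀ i < s, adj (f i) (f (i + 1))

/-- Strongly connected. -/
def IsStrong (adj : V → V → Prop) : Prop :=
  ∀ x y : V, ∃ n, HasWalk adj x y n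

/-- Weakly distance-regular: the intersection numbers are well defined. -/
def IsWDR (adj : V → V → Prop) : Prop :=
  ∀ (i j : ℕ × ℕ) (x y x' y' : V), tdist adj x y = tdist adj x' y' →
    Set.ncard {z : V | tdist adj x z = i ∧ tdist adj z y = j}
      = Set.ncard {z : V | tdist adj x' z = i ∧ tdist adj z y' = j}

/-- Thick: `p^h_{i,i}, p^h_{i,i*} ∈ {0, k_i}`. -/
def IsThick (adj : V → V → Prop) : Prop :=
  ∀ h i : ℕ × ℕ,
    (pnum adj h i i = 0 ∨ pnum adj h i i = kval adj i) ∧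
    (pnum adj h i i.swap = 0 ∨ pnum adj h i i.swap = kval adj i)

/-- A thick weakly distance-regular digraph (as a property of an adjacency relation). -/
def IsWDRThick (adj : V → V → Prop) : Prop :=
  IsStrong adj ∧ IsWDR adj ∧ IsThick adj

/-- A commutative thick weakly distance-regular digraph. -/
structure CTWDR (V : Type*) [Fintype V] where
  adj : V → V → Prop
  loopless : ∀ v, ¬ adj v v
  strong : IsStrong adj
  wdr : IsWDR adj
  comm : ∀ (i j : ℕ × ℕ) (x y : V),
    Set.ncard {z : V | tdist adj x z = i ∧ tdist adj z y = j}
      = Set.ncard {z : V | tdist adj x z = j ∧ tdist adj z y = i}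
  thick : IsThick adj

namespace CTWDR

variable {V : Type*} [Fintype V] (G : CTWDR V)

/-- Product `EF` of two sets of relations (relations identified with two-way distances). -/
def prodS (E F : Set (ℕ × ℕ)) : Set (ℕ × ℕ) :=
  {h | ∃ i ∈ E, ∃ j ∈ F, pnum G.adj h i j ≠ 0}

/-- Powers `Γ_i^l` (with `Γ_i^0 = {Γ_{(0,0)}}` and `Γ_i^1 = {Γ_i}`). -/
def pow (i : ℕ × ℕ) : ℕ → Set (ℕ × ℕ)
  | 0 => {(0, 0)}
  | 1 => {i}
  | n + 2 => G.prodS (pow i (n + 1)) {i}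

/-- The pair `(1, s-1)` is pure: every circuit of length `s` containing an arc of type
`(1, s-1)` consists of arcs of type `(1, s-1)`. -/
def Pure (s : ℕ) : Prop :=
  ∀ f : ℕ → V, IsCircuit G.adj s f →
    (∃ i < s, tdist G.adj (f i) (f (i + 1)) = (1, s - 1)) →
    ∀ i < s, tdist G.adj (f i) (f (i + 1)) = (1, s - 1)

/-- `(1, s-1)` is mixed. -/
def Mixed (s : ℕ) : Prop := ¬ G.Pure s

/-- Configuration `C(q)` exists. -/
def Cexists (q : ℕ) : Prop :=
  pnum G.adj (1, q - 2) (1, q - 1) (1, q - 1) ≠ 0 ∧ G.Pure (q - 1)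

/-- Configuration `D(q)` exists. -/
def Dexists (q : ℕ) : Prop :=
  pnum G.adj (1, q - 1) (1, q - 2) (q - 2, 1) ≠ 0 ∧ G.Pure (q - 1)

/-- A closed set of relations: `Γ_{i*}Γ_j ⊆ F` for all `i, j ∈ F`. -/
def Closed (F : Set (ℕ × ℕ)) : Prop :=
  ∀ i ∈ F, ∀ j ∈ F, G.prodS {i.swap} {j} ⊆ F

/-- The minimal closed set `⟨F⟩` containing `F`. -/
def genClosed (F : Set (ℕ × ℕ)) : Set (ℕ × ℕ) :=
  ⋂₀ {C | F ⊆ C ∧ G.Closed C}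

/-- The block `F_J(x)` of the closed set generated by `{Γ_{1,t-1}}_{t ∈ J}`. -/
def block (J : Set ℕ) (x : V) : Set V :=
  {y | tdist G.adj x y ∈ G.genClosed {i | ∃ t ∈ J, i = (1, t - 1)}}

end CTWDR

set_option linter.unusedSectionVars false
namespace W14

class HG (T : Type*) where
  e : T
  st : T → T
  m : T → T → T → Prop
  D : T → ℕ
  st_st : ∀ a, st (st a) = a
  m_comm : ∀ {i j k}, m i j k → m j i k
  m_assoc : ∀ {i j x k l}, m i j x → m x k l → ∃ f, m j k f ∧ m i f l
  m_e : ∀ {i k}, m e i k ↔ k = i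
  m_rev : ∀ {i j k}, m i j k → m k (st j) i
  m_star : ∀ {i j k}, m i j k → m (st i) (st j) (st k)
  m_ex : ∀ i j, ∃ k, m i j k
  thick1 : ∀ {i k l}, m i i k → m k (st i) l → l = i
  thick2 : ∀ {i k l}, m i (st i) k → m k i l → l = i
  D_inj : ∀ {a b}, D a = D b → D (st a) = D (st b) → a = b
  D_e : D e = 0
  D_zero : ∀ {a}, D a = 0 → a = e
  D_tri : ∀ {i j k}, m i j k → D k ≤ D i + D j
  D_geo : ∀ {k n}, D k = n + 1 → ∃ a b, D a = 1 ∧ D b = n ∧ m a b k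

open HG

section
variable {T : Type*} [HG T]

instance instAdd : Add (Set T) := ⟨fun A B => A ∪ B⟩
instance instZero : Zero (Set T) := ⟨(∅ : Set T)⟩

instance instCS : CommSemiring (Set T) where
  mul A B := {x | ∃ i ∈ A, ∃ j ∈ B, m i j x}
  one := {e}
  nsmul := nsmulRec
  mul_assoc A B C := by
    ext x; constructor
    · rintro ⟨y, ⟨i, hi, j, hj, hy⟩, k, hk, hx⟩
      obtain ⟨f, h1, h2⟩ := m_assoc hy hx
      exact ⟨i, hi, f, ⟨j, hj, k, hk, h1⟩, h2⟩
    · rintro ⟨i, hi, f, ⟨j, hj, k, hk, h1⟩, h2⟩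
      obtain ⟨g, h3, h4⟩ := m_assoc (m_comm h1) (m_comm h2)
      exact ⟨g, ⟨i, hi, j, hj, m_comm h3⟩, k, hk, m_comm h4⟩
  mul_comm A B := by
    ext x; constructor
    · rintro ⟨i, hi, j, hj, h⟩; exact ⟨j, hj, i, hi, m_comm h⟩
    · rintro ⟨i, hi, j, hj, h⟩; exact ⟨j, hj, i, hi, m_comm h⟩
  one_mul A := by
    ext x; constructor
    · rintro ⟨i, rfl, j, hj, h⟩; rw [m_e] at h; subst h; exact hj
    · intro h; exact ⟨e, rfl, x, h, m_e.2 rfl⟩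
  mul_one A := by
    ext x; constructor
    · rintro ⟨i, hi, j, rfl, h⟩; have := m_e.1 (m_comm h); subst this; exact hi
    · intro h; exact ⟨x, h, e, rfl, m_comm (m_e.2 rfl)⟩
  left_distrib A B C := by
    ext x; constructor
    · rintro ⟨i, hi, j, hj | hj, h⟩
      · exact Or.inl ⟨i, hi, j, hj, h⟩
      · exact Or.inr ⟨i, hi, j, hj, h⟩
    · rintro (⟨i, hi, j, hj, h⟩ | ⟨i, hi, j, hj, h⟩)
      · exact ⟨i, hi, j, Or.inl hj, h⟩
      · exact ⟨i, hi, j, Or.inr hj, h⟩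
  right_distrib A B C := by
    ext x; constructor
    · rintro ⟨i, hi | hi, j, hj, h⟩
      · exact Or.inl ⟨i, hi, j, hj, h⟩
      · exact Or.inr ⟨i, hi, j, hj, h⟩
    · rintro (⟨i, hi, j, hj, h⟩ | ⟨i, hi, j, hj, h⟩)
      · exact ⟨i, Or.inl hi, j, hj, h⟩
      · exact ⟨i, Or.inr hi, j, hj, h⟩
  zero_mul A := by
    ext x; constructor
    · rintro ⟨i, hi, _⟩; exact hi.elim
    · intro h; exact h.elim
  mul_zero A := by
    ext x; constructor
    · rintro ⟨i, hi, j, hj, _⟩; exact hj.elim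
    · intro h; exact h.elim
  zero_add A := Set.empty_union A
  add_zero A := Set.union_empty A
  add_assoc A B C := Set.union_assoc A B C
  add_comm A B := Set.union_comm A B

def c (a : T) : Set T := {a}
def o (a : T) : ℕ := D (st a)

lemma mem_mul {A B : Set T} {x : T} : x ∈ A * B ↔ ∃ i ∈ A, ∃ j ∈ B, m i j x := Iff.rfl
lemma mem_c {a x : T} : x ∈ c a ↔ x = a := Iff.rfl
lemma self_c (a : T) : a ∈ c a := rfl
lemma one_eq : (1 : Set T) = c e := rfl
lemma mem_cc {a b x : T} : x ∈ c a * c b ↔ m a b x := by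
  simp [mem_mul, mem_c]

lemma mul_mono {A B A' B' : Set T} (h : A ⊆ A') (h' : B ⊆ B') : A * B ⊆ A' * B' := by
  rintro x ⟨i, hi, j, hj, hx⟩; exact ⟨i, h hi, j, h' hj, hx⟩
lemma mul_monoL {A A' : Set T} (B : Set T) (h : A ⊆ A') : A * B ⊆ A' * B :=
  mul_mono h subset_rfl
lemma c_sub {a : T} {A : Set T} : c a ⊆ A ↔ a ∈ A := by
  simp [c]

/-- pull an element from the first factor -/
lemma mem_split {A B : Set T} {x : T} (h : x ∈ A * B) : ∃ g ∈ A, x ∈ c g * B := by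
  obtain ⟨i, hi, j, hj, hx⟩ := h
  exact ⟨i, hi, i, rfl, j, hj, hx⟩
lemma mem_join {A B : Set T} {x g : T} (hg : g ∈ A) (h : x ∈ c g * B) : x ∈ A * B :=
  mul_monoL B (c_sub.2 hg) h

lemma st_e : st (e : T) = e := by
  have := m_rev (m_e.2 rfl : m (e : T) e e)
  exact ((m_e.1 this)).symm

lemma e_iff {a : T} {A : Set T} : e ∈ c a * A ↔ st a ∈ A := by
  constructor
  · rintro ⟨i, hi, j, hj, h⟩
    rw [mem_c] at hi; subst hi
    have h1 := m_rev (m_comm h)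
    rw [m_e] at h1; rw [← h1]; exact hj
  · intro h
    refine ⟨a, rfl, st a, h, ?_⟩
    have := m_rev (m_e.2 rfl : m (e : T) a a)
    exact this

lemma st_inj {a b : T} (h : st a = st b) : a = b := by rw [← st_st a, h, st_st]

def star (A : Set T) : Set T := {x | st x ∈ A}
lemma mem_star {A : Set T} {x : T} : x ∈ star A ↔ st x ∈ A := Iff.rfl
lemma star_c (a : T) : star (c a) = c (st a) := by
  ext x; simp only [mem_star, mem_c]
  constructor
  · intro h; rw [← h, st_st]
  · intro h; rw [h, st_st]
lemma star_mul (A B : Set T) : star (A * B) = star A * star B := by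
  ext x; constructor
  · rintro ⟨i, hi, j, hj, h⟩
    refine ⟨st i, by simpa [mem_star, st_st] using hi, st j, by simpa [mem_star, st_st] using hj, ?_⟩
    simpa [st_st] using m_star h
  · rintro ⟨i, hi, j, hj, h⟩
    exact ⟨st i, hi, st j, hj, m_star h⟩
lemma star_one : star (1 : Set T) = 1 := by rw [one_eq, star_c, st_e]
lemma star_pow (A : Set T) (n : ℕ) : star (A ^ n) = star A ^ n := by
  induction n with
  | zero => simp [star_one]
  | succ n ih => rw [pow_succ, star_mul, ih, pow_succ]

/-- reversal: x ∈ a A ↔ move a -/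
lemma mem_rev {a x : T} {A : Set T} (h : x ∈ c a * A) : ∃ y ∈ A, y ∈ c x * c (st a) := by
  obtain ⟨i, hi, j, hj, h⟩ := h
  rw [mem_c] at hi; subst hi
  exact ⟨j, hj, mem_cc.2 (m_rev (m_comm h))⟩

lemma rev1 {a b x : T} (h : x ∈ c a * c b) : a ∈ c x * c (st b) := mem_cc.2 (m_rev (mem_cc.1 h))
lemma rev2 {a b x : T} (h : x ∈ c a * c b) : b ∈ c x * c (st a) :=
  mem_cc.2 (m_rev (m_comm (mem_cc.1 h)))

lemma nonemp (a b : T) : ∃ x, x ∈ c a * c b := by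
  obtain ⟨k, hk⟩ := m_ex a b; exact ⟨k, mem_cc.2 hk⟩

/-- if all elements of `c a * c b` equal `x`. -/
lemma eq_c_of {a b x : T} (h : ∀ y ∈ c a * c b, y = x) : c a * c b = c x := by
  obtain ⟨y, hy⟩ := nonemp a b
  ext z; constructor
  · intro hz; exact h z hz
  · intro hz; rw [mem_c] at hz; rw [hz, ← h y hy]; exact hy

def E (a : T) : Set T := c a * c (st a)

lemma e_E (a : T) : e ∈ E a := e_iff.2 (self_c _)

lemma star_E (a : T) : star (E a) = E a := by
  rw [E, star_mul, star_c, star_c, st_st, mul_comm]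

lemma st_mem_E {a x : T} (h : x ∈ E a) : st x ∈ E a := by
  have := star_E a
  rw [← this] at h; exact h

lemma absE {a k : T} (h : k ∈ E a) : c k * c a = c a :=
  eq_c_of (fun _ hy => thick2 (mem_cc.1 h) (mem_cc.1 hy))

lemma absE' {a k : T} (h : k ∈ E a) : c k * c (st a) = c (st a) := by
  have := congrArg star (absE (st_mem_E h))
  rwa [star_mul, star_c, star_c, st_st] at this

lemma sq1 {a k : T} (h : k ∈ c a * c a) : c k * c (st a) = c a :=
  eq_c_of (fun _ hy => thick1 (mem_cc.1 h) (mem_cc.1 hy))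

lemma sq2 {a k : T} (h : k ∈ c a * c a) : c (st k) * c a = c (st a) := by
  have := congrArg star (sq1 h)
  rwa [star_mul, star_c, star_c, st_st, star_c] at this

lemma E_c (a : T) : E a * c a = c a := by
  ext x; constructor
  · intro h
    obtain ⟨g, hg, h⟩ := mem_split h
    rwa [absE hg] at h
  · intro h; exact mem_join (e_E a) (by rw [← one_eq, one_mul]; exact h)

lemma E_c' (a : T) : E a * c (st a) = c (st a) := by
  have := congrArg star (E_c a)
  rwa [star_mul, star_E, star_c] at this

lemma E_E (a : T) : E a * E a = E a := by
  conv_lhs => rw [show E a * E a = (E a * c a) * c (st a) by rw [E]; ring]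
  rw [E_c]; rfl

lemma E_pow (a : T) (n : ℕ) : E a ^ (n + 1) = E a := by
  induction n with
  | zero => simp
  | succ n ih => rw [pow_succ, ih, E_E]

/-- membership `k ∈ E a` from `a ∈ k a`. -/
lemma memE_of {a k : T} (h : a ∈ c k * c a) : k ∈ E a := rev1 h

lemma not_self_E {a : T} (h1 : D a = 1) : a ∉ E a := by
  intro h
  have h2 := absE' h
  have h3 : e ∈ c a * c (st a) := e_E a
  rw [h2, mem_c] at h3
  have := st_e (T := T); rw [h3, st_st] at this
  rw [this, ← h3, D_e] at h1; omega

lemma not_self_sq {a : T} (h1 : D a = 1) : a ∉ c a * c a := by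
  intro h; exact not_self_E h1 (memE_of h)

/-- periodicity -/
lemma pow_E {a : T} {n : ℕ} (h : e ∈ c a ^ (n + 1)) : c a ^ (n + 1) = E a := by
  apply Set.Subset.antisymm
  · have h1 : (1 : Set T) ⊆ c (st a) ^ (n + 1) := by
      rw [one_eq, c_sub, ← star_c, ← star_pow, mem_star, st_e]; exact h
    have := mul_mono (subset_refl (c a ^ (n + 1))) h1
    rw [mul_one, ← mul_pow] at this
    change _ ⊆ E a ^ (n + 1) at this
    rwa [E_pow] at this
  · have h1 : (1 : Set T) ⊆ c a ^ (n + 1) := by rw [one_eq, c_sub]; exact h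
    have := mul_mono (subset_refl (E a)) h1
    rw [mul_one] at this
    refine this.trans ?_
    rw [pow_succ', ← mul_assoc, E_c]

lemma pow_red {a : T} {n j : ℕ} (h : e ∈ c a ^ (n + 1)) : c a ^ (n + 1 + (j + 1)) = c a ^ (j + 1) := by
  rw [pow_add, pow_E h, pow_succ', ← mul_assoc, E_c]

lemma pow_inv {a : T} {n : ℕ} (h : e ∈ c a ^ (n + 2)) : c a ^ (n + 1) = c (st a) := by
  have h1 := pow_E h
  have h2 : c a ^ (n + 1) = c a ^ (n + 1) * E a := by
    rw [pow_succ, mul_assoc, mul_comm (c a) (E a), E_c]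
  rw [h2, E, ← mul_assoc, ← pow_succ, h1, E_c']

lemma cube {a v : T} (h : v ∈ c a * c a) : c a ^ 3 = c v * c a := by
  calc c a ^ 3 = c a * c a * c a := by ring
    _ = (c v * c (st a)) * c a * c a := by rw [sq1 h]
    _ = c v * (E a * c a) := by rw [E]; ring
    _ = _ := by rw [E_c]

lemma sq_eq {a v : T} (h : v ∈ c a * c a) : c a * c a = c v * E a := by
  rw [E, mul_comm (c a) (c (st a)), ← mul_assoc, sq1 h]

lemma E_sub_sq {a v : T} (h : v ∈ c a * c a) : E v ⊆ E a := by
  have h2 : c (st v) ⊆ c (st a) * c (st a) := by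
    rw [c_sub, ← star_c, ← star_mul, mem_star, st_st]; exact h
  have := mul_mono (c_sub.2 h) h2
  have h3 : c a * c a * (c (st a) * c (st a)) = E a * E a := by rw [E]; ring
  rw [h3, E_E] at this; exact this

lemma E_sub {a v : T} (h : v ∈ E a) : E v ⊆ E a := by
  have := mul_mono (c_sub.2 h) (c_sub.2 (st_mem_E h))
  rwa [E_E] at this

lemma pow_sub_E {a v : T} (h : v ∈ E a) (n : ℕ) : c v ^ (n + 1) ⊆ E a := by
  rw [← E_pow a n]
  induction n with
  | zero => simpa using c_sub.2 h
  | succ n ih => rw [pow_succ, pow_succ (E a)]; exact mul_mono ih (c_sub.2 h)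

/-! lengths -/
def Len (A : Set T) (n : ℕ) : Prop := ∀ x ∈ A, D x ≤ n

lemma Len.mul {A B : Set T} {a b : ℕ} (hA : Len A a) (hB : Len B b) : Len (A * B) (a + b) := by
  rintro x ⟨i, hi, j, hj, h⟩
  have := D_tri h; have := hA i hi; have := hB j hj; omega
lemma Len_c {a : T} {n : ℕ} (h : D a ≤ n) : Len (c a) n := by
  intro x hx; rw [mem_c] at hx; rw [hx]; exact h
lemma Len_pow {a : T} (h : D a ≤ 1) (n : ℕ) : Len (c a ^ n) n := by
  induction n with
  | zero => intro x hx; rw [pow_zero] at hx; have : x = e := hx; rw [this, D_e]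
  | succ n ih => rw [pow_succ]; exact ih.mul (Len_c h)
lemma Len.mono {A : Set T} {n k : ℕ} (h : Len A n) (hk : n ≤ k) : Len A k :=
  fun x hx => (h x hx).trans hk

/-- short circuit bound -/
lemma SC {a : T} {A : Set T} {n : ℕ} (h : e ∈ c a * A) (hA : Len A n) : o a ≤ n :=
  hA _ (e_iff.1 h)

lemma opp_lb {a b g : T} (h : g ∈ c a * c b) : o a ≤ o g + D b := by
  have h1 := m_star (m_rev (mem_cc.1 h))
  rw [st_st] at h1
  exact D_tri h1

lemma D_le {a b g : T} (h : g ∈ c a * c b) : D g ≤ D a + D b := D_tri (mem_cc.1 h)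
lemma o_le {a b g : T} (h : g ∈ c a * c b) : o g ≤ o a + o b := D_tri (m_star (mem_cc.1 h))

lemma o_st (a : T) : o (st a) = D a := by simp [o, st_st]
lemma o_e : o (e : T) = 0 := by rw [o, st_e, D_e]
lemma o_zero {a : T} (h : o a = 0) : a = e := by
  have := D_zero h; rw [← st_st a, this, st_e]
lemma D_pos_of_o {a : T} (h : o a ≠ 0) : D a ≠ 0 := by
  intro h1; rw [D_zero h1] at h; exact h o_e
lemma o_pos_of_D {a : T} (h : D a ≠ 0) : o a ≠ 0 := by
  intro h1; rw [o_zero h1] at h; exact h D_e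
lemma inj {a b : T} (h : D a = D b) (h' : o a = o b) : a = b := D_inj h h'

/-! multisets -/
def pr (M : Multiset T) : Set T := (M.map c).prod
def Arcs (M : Multiset T) : Prop := ∀ a ∈ M, D a = 1

lemma pr_cons (a : T) (M : Multiset T) : pr (a ::ₘ M) = c a * pr M := by simp [pr]
lemma pr_zero : pr (0 : Multiset T) = 1 := by simp [pr]
lemma pr_rep (a : T) (n : ℕ) : pr (Multiset.replicate n a) = c a ^ n := by simp [pr]
lemma pr_add (M N : Multiset T) : pr (M + N) = pr M * pr N := by simp [pr]
lemma Len_pr {M : Multiset T} (h : Arcs M) : Len (pr M) M.card := by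
  induction M using Multiset.induction with
  | empty => intro x hx; rw [pr_zero] at hx; have : x = e := hx; rw [this, D_e]; simp
  | cons a M ih =>
    rw [pr_cons, Multiset.card_cons, add_comm]
    exact (Len_c (h a (by simp)).le).mul (ih (fun b hb => h b (by simp [hb])))

lemma geo (n : ℕ) : ∀ x : T, D x = n → ∃ M : Multiset T, Arcs M ∧ M.card = n ∧ x ∈ pr M := by
  induction n with
  | zero => intro x hx; exact ⟨0, by simp [Arcs], rfl, by rw [pr_zero]; exact D_zero hx⟩
  | succ n ih =>
    intro x hx
    obtain ⟨a, b, ha, hb, h⟩ := D_geo hx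
    obtain ⟨M, h1, h2, h3⟩ := ih b hb
    refine ⟨a ::ₘ M, ?_, by simp [h2], ?_⟩
    · intro y hy; rcases Multiset.mem_cons.1 hy with rfl | hy
      · exact ha
      · exact h1 y hy
    · rw [pr_cons]; exact ⟨a, rfl, b, h3, h⟩

lemma circ_ex (g : T) : ∃ M : Multiset T, Arcs M ∧ M.card = o g ∧ e ∈ c g * pr M := by
  obtain ⟨M, h1, h2, h3⟩ := geo (o g) (st g) rfl
  exact ⟨M, h1, h2, e_iff.2 h3⟩

lemma Arcs_rep {a : T} (h : D a = 1) (n : ℕ) : Arcs (Multiset.replicate n a) := by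
  intro b hb; rw [Multiset.eq_of_mem_replicate hb]; exact h
lemma Arcs_cons {a : T} {M : Multiset T} : Arcs (a ::ₘ M) ↔ D a = 1 ∧ Arcs M := by
  simp [Arcs]

def PureA (a : T) : Prop := D a = 1 ∧ ∀ M : Multiset T, Arcs M → M.card = o a →
  e ∈ c a * pr M → M = Multiset.replicate (o a) a

lemma PureA.pow {a : T} (h : PureA a) : e ∈ c a ^ (o a + 1) := by
  obtain ⟨M, h1, h2, h3⟩ := circ_ex a
  rw [h.2 M h1 h2 h3, pr_rep] at h3
  rwa [pow_succ']

/-- Structure statement for an arc `H`. `M` is the rest of circuit. -/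
def Str (H : T) : Prop := ∀ M : Multiset T, Arcs M → M.card = o H → e ∈ c H * pr M →
  M = Multiset.replicate (o H) H ∨
  ∃ R, PureA R ∧ o R + 1 = o H ∧
    ((M = H ::ₘ Multiset.replicate (o R) R ∧ R ∈ c H * c H) ∨
     (M = Multiset.replicate (o H) R ∧ H ∈ E R))

/-- On-circuit element. -/
lemma onC {H S : T} {P : Set T} (h : e ∈ c H * c S * P) (hH : D H = 1) (hS : D S = 1)
    (hn : 2 ≤ o H) (hP : Len P (o H - 1)) :
    ∃ g ∈ c H * c S, e ∈ c g * P ∧ o g + 1 = o H ∧ (D g = 1 ∨ D g = 2) := by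
  obtain ⟨g, hg, h1⟩ := mem_split h
  have a1 := SC h1 hP
  have a2 := opp_lb hg
  have a3 := D_le hg
  have a4 : D g ≠ 0 := D_pos_of_o (by omega)
  exact ⟨g, hg, h1, by omega, by omega⟩

end
end W14
namespace W14
open HG
section
variable {T : Type*} [HG T]

lemma tr {A B : Set T} {x : T} (h : x ∈ A) (hAB : A = B) : x ∈ B := hAB ▸ h

lemma o_pos {a : T} (h : D a = 1) : 1 ≤ o a := by
  have := o_pos_of_D (a := a) (by omega); omega

lemma subl {H S : T} {P : Set T} {k j : ℕ} (hH : D H = 1) (hS : D S = 1) (hn : o H = k + 1)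
    (hj : j + 1 = k) (hne : S ≠ H) (h : e ∈ c H * c H * c S * P) (hP : Len P j) :
    ∃ L ∈ c H * c S, ∃ R ∈ c H * c H, D L = 2 ∧ o L = k ∧ e ∈ c L * c H * P ∧
      D R = 1 ∧ o R = k ∧ e ∈ c R * c S * P := by
  have l1 : Len (c H * P) (o H - 1) := ((Len_c hH.le).mul hP).mono (by omega)
  have l2 : Len (c S * P) (o H - 1) := ((Len_c hS.le).mul hP).mono (by omega)
  obtain ⟨g, hg, g1, g2, g3⟩ := onC (tr h (by ring : _ = c H * c S * (c H * P))) hH hS (by omega) l1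
  obtain ⟨g', hg', g1', g2', g3'⟩ :=
    onC (tr h (by ring : _ = c H * c H * (c S * P))) hH hH (by omega) l2
  have hg2 : D g = 2 := by
    rcases g3 with g3 | g3
    · have := SC (tr g1 (by ring : _ = c H * (c g * P))) ((Len_c g3.le).mul hP)
      omega
    · exact g3
  refine ⟨g, hg, g', hg', hg2, by omega, tr g1 (by ring), ?_, by omega, tr g1' (by ring)⟩
  rcases g3' with g3' | g3'
  · exact g3'
  · exfalso
    have : g' = g := inj (by omega) (by omega)
    subst this
    have := rev2 hg
    rw [sq1 hg'] at this
    exact hne this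

lemma bad {H Y : T} {j : ℕ} (IH : ∀ S : T, D S = 1 → o S < o H → Str S) (hH : D H = 1)
    (hY : D Y = 1) (hn : o H = j + 2) (hYo : o Y = j) (h1 : e ∈ c Y ^ (j + 1))
    (h2 : e ∈ c H * c H * c Y ^ (j + 1)) : False := by
  have hj := o_pos hY
  have hYH : Y ≠ H := by rintro rfl; omega
  obtain ⟨L, hL, R, hR, L1, L2, -, R1, R2, R3⟩ := subl (k := j + 1) (j := j) (P := c Y ^ j) hH hY hn rfl hYH
    (tr h2 (by ring)) (Len_pow hY.le _)
  have hE := pow_E h1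
  have hRE : R ∈ E Y := by
    have := e_iff.1 (tr R3 (by ring : _ = c R * c Y ^ (j + 1)))
    rw [hE] at this
    have := st_mem_E this
    rwa [st_st] at this
  have sqE : c R * c R ⊆ E Y := by
    have := pow_sub_E hRE 1
    rwa [pow_two] at this
  have hRH : R ≠ H := by rintro rfl; omega
  obtain ⟨x, hx⟩ := nonemp R R
  have hxE := sqE hx
  have x1 := D_le hx
  have x2 := opp_lb hx
  have x3 : o x ≤ j + 1 := by
    have := st_mem_E hxE
    rw [← hE] at this
    exact Len_pow hY.le _ _ this
  have x4 : D x ≠ 0 := D_pos_of_o (by omega)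
  have x5 : D x = 1 ∨ D x = 2 := by omega
  have x6 : o x = j ∨ o x = j + 1 := by omega
  rcases x5 with x5 | x5
  · rcases x6 with x6 | x6
    · have : x = Y := inj (by omega) (by omega)
      subst this; exact not_self_E hY hxE
    · have : x = R := inj (by omega) (by omega)
      subst this; exact not_self_sq R1 hx
  · rcases x6 with x6 | x6
    · obtain ⟨W, w1, w2, w3⟩ := circ_ex x
      have w4 := tr (mem_join hx w3) (by rw [pr_cons]; ring : _ = c R * pr (R ::ₘ W))
      have hRR : e ∈ c R ^ (j + 2) := by
        rcases IH R R1 (by omega) (R ::ₘ W) (Arcs_cons.2 ⟨R1, w1⟩) (by simp; omega) w4 with h | ⟨R', r1, r2, h⟩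
        · rw [h, pr_rep] at w4
          rw [show j + 2 = o R + 1 by omega, pow_succ']; exact w4
        · have : R' = Y := inj (by rw [r1.1, hY]) (by omega)
          subst this
          exfalso
          rcases h with ⟨-, h⟩ | ⟨h, -⟩
          · exact not_self_E hY (sqE h)
          · have : R ∈ Multiset.replicate (o R) R' := by rw [← h]; simp
            have := Multiset.eq_of_mem_replicate this
            rw [this] at R2; omega
      have q1 := mem_join hR (tr hRR (by ring : _ = c R * c R ^ (j + 1)))
      obtain ⟨L', -, -, -, M1, M2, M3, -⟩ := subl (k := j + 1) (j := j) (P := c R ^ j) hH R1 hn rfl hRH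
        (tr q1 (by ring)) (Len_pow R1.le _)
      have : L' = L := inj (by omega) (by omega)
      subst this
      have q2 := mem_join hL (tr M3 (mul_assoc _ _ _))
      obtain ⟨-, -, R', -, -, -, -, N1, N2, N3⟩ := subl (k := j + 1) (j := j) (P := c R ^ j) hH hY hn rfl hYH
        (tr q2 (by ring)) (Len_pow R1.le _)
      have : R' = R := inj (by omega) (by omega)
      subst this
      have q3 := e_iff.1 (tr N3 (by ring : _ = c Y * c R' ^ (j + 1)))
      have q4 := st_mem_E (pow_sub_E hRE j q3)
      rw [st_st] at q4
      exact not_self_E hY q4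
    · have : x = L := inj (by omega) (by omega)
      subst this
      have := rev1 hL
      rw [absE' hxE, mem_c] at this
      rw [this, o_st] at hn; omega

lemma pure_of {R : T} {k : ℕ} (hR : D R = 1) (ho : o R = k) (hS : Str R) (h : e ∈ c R ^ (k + 1))
    (hY : ∀ Y, PureA Y → o Y + 1 = k → R ∈ E Y → False) : PureA R := by
  refine ⟨hR, fun M m1 m2 m3 => ?_⟩
  rcases hS M m1 m2 m3 with h1 | ⟨Y, y1, y2, h1⟩
  · exact h1
  · exfalso
    rcases h1 with ⟨-, h1⟩ | ⟨-, h1⟩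
    · have := o_pos y1.1
      obtain ⟨j, rfl⟩ : ∃ j, k = j + 2 := ⟨k - 2, by omega⟩
      have h2 : c R ^ (j + 2 + 1) = c R * (c Y * c R ^ j) := by
        rw [show c R ^ (j + 2 + 1) = c R ^ 3 * c R ^ j by ring, cube h1]; ring
      rw [h2] at h
      have := SC h ((Len_c y1.1.le).mul (Len_pow hR.le j))
      omega
    · exact hY Y y1 (by omega) h1

lemma caseI_pow {H S : T} {k : ℕ} (IH : ∀ S : T, D S = 1 → o S < o H → Str S) (hH : D H = 1)
    (hS : D S = 1) (hn : o H = k + 1) (hk : 1 ≤ k) (hne : S ≠ H)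
    (h : e ∈ c H * c H * c S ^ k) : PureA S ∧ o S = k ∧ S ∈ c H * c H := by
  obtain ⟨j, rfl⟩ : ∃ j, k = j + 1 := ⟨k - 1, by omega⟩
  obtain ⟨L, hL, R, hR, L1, L2, -, R1, R2, R3⟩ := subl (k := j + 1) (j := j) (P := c S ^ j) hH hS hn rfl hne
    (tr h (by ring)) (Len_pow hS.le _)
  have hSR : S = R := by
    by_contra hSR
    have s1 := SC (tr h (by ring : _ = c S * (c H * c H * c S ^ j)))
      (((Len_c hH.le).mul (Len_c hH.le)).mul (Len_pow hS.le j))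
    have s2 : o S ≠ j + 2 := fun h => hne (inj (by omega) (by omega))
    have s3 : o S ≠ j + 1 := fun h => hSR (inj (by omega) (by omega))
    have s4 := o_pos hS
    obtain ⟨M, m1, m2, m3⟩ := circ_ex S
    rcases IH S hS (by omega) M m1 m2 m3 with h1 | ⟨V, v1, v2, h1⟩
    · rw [h1, pr_rep, ← pow_succ'] at m3
      by_cases hs : o S = j
      · rw [hs] at m3
        exact bad IH hH hS (by omega) hs m3 h
      · obtain ⟨i, hi⟩ : ∃ i, j = o S + (i + 1) := ⟨j - o S - 1, by omega⟩
        rw [show j + 1 = o S + 1 + (i + 1) by omega, pow_red m3] at h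
        have := SC (tr h (mul_assoc _ _ _)) ((Len_c hH.le).mul (Len_pow hS.le _))
        omega
    · have := o_pos v1.1
      rcases h1 with ⟨-, h1⟩ | ⟨-, h1⟩
      · obtain ⟨i, rfl⟩ : ∃ i, j = i + 2 := ⟨j - 2, by omega⟩
        rw [show c S ^ (i + 2 + 1) = c S ^ 3 * c S ^ i by ring, cube h1] at h
        have := SC (tr h (by ring : _ = c H * (c H * c V * c S * c S ^ i)))
          ((((Len_c hH.le).mul (Len_c v1.1.le)).mul (Len_c hS.le)).mul (Len_pow hS.le _))
        omega
      · have q := pow_sub_E h1 j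
        rw [← pow_E v1.pow] at q
        have h := mul_mono (subset_refl (c H * c H)) q h
        have := SC (tr h (mul_assoc _ _ _)) ((Len_c hH.le).mul (Len_pow v1.1.le _))
        omega
  subst hSR
  refine ⟨pure_of R1 R2 (IH S hS (by omega)) (tr R3 (by ring)) ?_, R2, hR⟩
  intro Y y1 y2 y3
  have q := pow_sub_E y3 j
  have q2 := y1.pow
  rw [← pow_E q2] at q
  rw [show o Y + 1 = j + 1 by omega] at q q2
  exact bad IH hH y1.1 (by omega) (by omega) q2 (mul_mono (subset_refl (c H * c H)) q h)

lemma exch {H S : T} {k : ℕ} (hH : D H = 1) (hS : D S = 1) (hn : o H = k + 1) (hne : S ≠ H)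
    (N : Multiset T) : ∀ j, Arcs N → H ∉ N → N.card + (j + 1) = k →
    e ∈ c H * c H * pr N * c S ^ (j + 1) → e ∈ c H * c H * c S ^ k := by
  induction N using Multiset.induction with
  | empty => intro j _ _ hk h; simp at hk; rw [pr_zero, mul_one, hk] at h; exact h
  | cons a N ih =>
    intro j hA hN hk h
    rw [Multiset.card_cons] at hk
    have ⟨ha, hA'⟩ := Arcs_cons.1 hA
    simp only [Multiset.mem_cons, not_or] at hN
    rw [pr_cons] at h
    obtain ⟨L, hL, -, -, L1, L2, L3, -⟩ := subl (k := k) (j := N.card + (j + 1))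
      (P := pr N * c S ^ (j + 1)) hH ha hn
      (by omega) (Ne.symm hN.1) (tr h (by ring)) ((Len_pr hA').mul (Len_pow hS.le _))
    obtain ⟨L', hL', -, -, L1', L2', L3', -⟩ := subl (k := k) (j := N.card + (j + 1))
      (P := pr N * c a * c S ^ j) hH hS hn
      (by omega) hne (tr h (by ring)) ((((Len_pr hA').mul (Len_c ha.le)).mul (Len_pow hS.le _)).mono (by omega))
    have : L' = L := inj (by omega) (by omega)
    subst this
    refine ih (j + 1) hA' hN.2 (by omega) (tr (mem_join hL' (tr L3 (mul_assoc _ _ _))) (by ring))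

lemma caseI {H S : T} {k : ℕ} {N : Multiset T} (IH : ∀ S : T, D S = 1 → o S < o H → Str S)
    (hH : D H = 1) (hn : o H = k + 1) (hN : Arcs N) (hc : N.card = k) (hSN : S ∈ N) (hne : S ≠ H)
    (h : e ∈ c H * c H * pr N) :
    ∃ R, PureA R ∧ o R = k ∧ R ∈ c H * c H ∧ N = Multiset.replicate k R := by
  have hHN : H ∉ N := by
    intro hHN
    obtain ⟨N', rfl⟩ := Multiset.exists_cons_of_mem hSN
    have ⟨hS, hN'⟩ := Arcs_cons.1 hN
    rw [Multiset.card_cons] at hc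
    have hHN' : H ∈ N' := by
      rcases Multiset.mem_cons.1 hHN with h | h
      · exact absurd h.symm hne
      · exact h
    rw [pr_cons] at h
    obtain ⟨-, -, R, hR, -, -, -, R1, R2, R3⟩ := subl (k := k) (j := N'.card) (P := pr N') hH hS hn
      hc hne (tr h (by ring)) (Len_pr hN')
    obtain ⟨N'', rfl⟩ := Multiset.exists_cons_of_mem hHN'
    obtain ⟨-, hN''⟩ := Arcs_cons.1 hN'
    rw [pr_cons] at R3
    rw [Multiset.card_cons] at hc
    have := SC (tr R3 (by ring : _ = c H * (c R * c S * pr N'')))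
      (((Len_c R1.le).mul (Len_c hS.le)).mul (Len_pr hN''))
    omega
  have key : ∀ S ∈ N, PureA S ∧ o S = k ∧ S ∈ c H * c H := by
    intro S hSN
    obtain ⟨N', rfl⟩ := Multiset.exists_cons_of_mem hSN
    have ⟨hS, hN'⟩ := Arcs_cons.1 hN
    rw [Multiset.card_cons] at hc
    simp only [Multiset.mem_cons, not_or] at hHN
    rw [pr_cons] at h
    exact caseI_pow IH hH hS hn (by omega) (Ne.symm hHN.1)
      (exch hH hS hn (Ne.symm hHN.1) N' 0 hN' hHN.2 (by omega) (tr h (by ring)))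
  obtain ⟨s1, s2, s3⟩ := key S hSN
  refine ⟨S, s1, s2, s3, ?_⟩
  rw [Multiset.eq_replicate]
  refine ⟨hc, fun b hb => ?_⟩
  obtain ⟨b1, b2, b3⟩ := key b hb
  exact inj (by rw [b1.1, s1.1]) (by omega)

end
end W14
namespace W14
open HG
section
variable {T : Type*} [HG T]

lemma noYsq {R Y : T} {k : ℕ} (hR : D R = 1) (hY : D Y = 1) (ho : o R = k) (hy : o Y + 1 = k)
    (h : e ∈ c R ^ (k + 1)) (h1 : Y ∈ c R * c R) : False := by
  have := o_pos hY
  obtain ⟨j, rfl⟩ : ∃ j, k = j + 2 := ⟨k - 2, by omega⟩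
  have h2 : c R ^ (j + 2 + 1) = c R * (c Y * c R ^ j) := by
    rw [show c R ^ (j + 2 + 1) = c R ^ 3 * c R ^ j by ring, cube h1]; ring
  rw [h2] at h
  have := SC h ((Len_c hY.le).mul (Len_pow hR.le j))
  omega

lemma str_mem {R U : T} {M : Multiset T} (hS : Str R) (h1 : Arcs M) (h2 : M.card = o R)
    (h3 : e ∈ c R * pr M) (hU : U ∈ M) : U = R ∨ o U + 1 = o R := by
  rcases hS M h1 h2 h3 with h | ⟨Y, y1, y2, ⟨h, -⟩ | ⟨h, -⟩⟩
  · rw [h] at hU; exact Or.inl (Multiset.eq_of_mem_replicate hU)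
  · rw [h] at hU
    rcases Multiset.mem_cons.1 hU with h | h
    · exact Or.inl h
    · right; rw [Multiset.eq_of_mem_replicate h]; exact y2
  · rw [h] at hU; right; rw [Multiset.eq_of_mem_replicate hU]; exact y2

lemma not_st {H Y : T} (hY : D Y = 1) (hn : 2 ≤ o H) (h : st H = Y) : False := by
  have : o H = D Y := by rw [← h]; rfl
  omega
lemma not_st' {H Y : T} (hY : D Y = 1) (hn : 2 ≤ o H) (h : H = st Y) : False :=
  not_st hY hn (by rw [h, st_st])

lemma b1 {H U R : T} {k : ℕ} (IH : ∀ S : T, D S = 1 → o S < o H → Str S)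
    (hH : D H = 1) (hn : o H = k + 1) (hU : D U = 1) (hR : D R = 1) (hRo : o R = k)
    (hUH : U ≠ H) (hRU : R ∈ c H * c U) (h : e ∈ c R * c R ^ k) :
    U = R ∧ H ∈ E R ∧ PureA R := by
  have hp : e ∈ c R ^ (k + 1) := tr h (by ring)
  have hk := o_pos hR
  have hc := mem_join hRU h
  have hRH : R ≠ H := by rintro rfl; omega
  by_cases hUR : U = R
  · subst hUR
    refine ⟨rfl, memE_of hRU, pure_of hR hRo (IH _ hR (by omega)) hp ?_⟩
    intro Y y1 y2 y3
    have q := e_iff.1 (tr hc (by ring : _ = c H * c U ^ (k + 1)))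
    have q := pow_sub_E y3 k q
    rw [← pow_E y1.pow] at q
    have : o H ≤ _ := Len_pow y1.1.le _ _ q
    omega
  · exfalso
    obtain ⟨j, rfl⟩ : ∃ j, k = j + 1 := ⟨k - 1, by omega⟩
    have u1 := SC (tr hc (by ring : _ = c U * (c H * c R ^ (j + 1))))
      ((Len_c hH.le).mul (Len_pow hR.le _))
    have u2 := o_pos hU
    have u3 : o U ≠ j + 1 := fun h => hUR (inj (by omega) (by omega))
    have u4 : o U ≠ j + 2 := fun h => hUH (inj (by omega) (by omega))
    obtain ⟨L, hL, L1, L2, L3⟩ := onC (P := c U * c R ^ j) (tr hc (by ring : _ = c H * c R * (c U * c R ^ j))) hH hR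
      (by omega) (((Len_c hU.le).mul (Len_pow hR.le _)).mono (by omega))
    rcases L3 with L3 | L3
    · have : L = R := inj (by omega) (by omega)
      subst this
      have := e_iff.1 (tr L1 (by ring : _ = c U * c L ^ (j + 1)))
      rw [pow_inv hp] at this
      exact hUR (st_inj this)
    obtain ⟨g, hg, g1⟩ := mem_split (tr hc (by ring : _ = (c U * c R) * (c H * c R ^ j)))
    have g2 : D g = 2 := by
      have := D_le hg
      by_contra hlt
      have := SC (tr g1 (by ring : _ = c H * (c g * c R ^ j)))
        ((Len_c (n := 1) (by omega)).mul (Len_pow hR.le _))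
      omega
    have g3 := SC g1 ((Len_c hH.le).mul (Len_pow hR.le _))
    have g4 := opp_lb (tr hg (mul_comm _ _))
    by_cases g5 : o g = j
    · obtain ⟨x, hx, x1, x2, x3⟩ := onC (P := c R ^ j) (tr hp (by ring : _ = c R * c R * c R ^ j)) hR hR
        (by omega) ((Len_pow hR.le _).mono (by omega))
      rcases x3 with x3 | x3
      · exact noYsq hR x3 hRo (by omega) hp hx
      · have : x = g := inj (by omega) (by omega)
        subst this
        have := rev1 hg
        rw [sq1 hx] at this
        exact hUR this
    · have : g = L := inj (by omega) (by omega)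
      subst this
      have q := mem_join hL g1
      obtain ⟨-, -, R', hR', -, -, -, N1, N2, -⟩ := subl (k := j + 1) (j := j) (P := c R ^ j) hH hR hn rfl hRH
        (tr q (by ring)) (Len_pow hR.le _)
      have : R' = R := inj (by omega) (by omega)
      subst this
      have := rev2 hRU
      rw [sq1 hR'] at this
      exact hUH this

lemma b2 {H U R Y : T} {k : ℕ} (IH : ∀ S : T, D S = 1 → o S < o H → Str S)
    (hH : D H = 1) (hn : o H = k + 1) (hU : D U = 1) (hR : D R = 1) (hRo : o R = k)
    (hRU : R ∈ c H * c U) (hY : PureA Y) (hYo : o Y + 1 = k)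
    (hYR : Y ∈ c R * c R)
    (h : e ∈ c R * (c R * c Y ^ o Y)) : False := by
  have hy := o_pos hY.1
  obtain ⟨y, hy⟩ : ∃ y, o Y = y + 1 := ⟨o Y - 1, by omega⟩
  have hp := hY.pow
  rw [hy] at h hp
  obtain rfl : k = y + 2 := by omega
  have hE := pow_E hp
  have hSR := IH R hR (by omega)
  have hc := mem_join hRU h
  have hYH : Y ≠ H := by rintro rfl; omega
  have hRE : c R * E Y = c R := by
    apply Set.Subset.antisymm
    · refine (mul_mono (subset_refl (c R)) (E_sub_sq hYR)).trans ?_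
      rw [mul_comm, E_c]
    · have := mul_mono (subset_refl (c R)) (c_sub.2 (e_E Y))
      rwa [← one_eq, mul_one] at this
  have hRnY : R ∉ E Y := by
    intro hR'
    have := pow_sub_E hR' 1
    rw [pow_two] at this
    exact not_self_E hY.1 (this hYR)
  by_cases hUY : U = Y
  · subst hUY
    have := e_iff.1 (tr hc (by ring : _ = c H * (c R * c U ^ (y + 1 + 1))))
    rw [hE, hRE] at this
    exact not_st hR (by omega) this
  by_cases hUR : U = R
  · subst hUR
    have hHE : H ∈ E U := memE_of hRU
    have hEU : E U = c U * c U * c Y ^ (y + 1) := by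
      calc E U = c U * E Y * c (st U) := by rw [hRE]; rfl
        _ = c Y ^ (y + 1 + 1) * E U := by rw [hE, E, E]; ring
        _ = (c Y * E U) * c Y ^ (y + 1) := by ring
        _ = _ := by rw [← sq_eq hYR]
    have key : ∀ x ∈ c U * c U, x = Y ∨ (D x = 2 ∧ o x = y + 2) := by
      intro x hx
      have hx1 : st x ∈ c U * c U * c Y ^ y := by
        have : x ∈ c Y * E U := by rw [← sq_eq hYR]; exact hx
        have : st x ∈ star (c Y * E U) := by rw [mem_star, st_st]; exact this
        rw [star_mul, star_c, star_E, hEU] at this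
        have := tr this (by rw [E]; ring : _ = c U * (c U * E Y) * c Y ^ y)
        rwa [hRE] at this
      have x1 : o x ≤ _ := (((Len_c hR.le).mul (Len_c hR.le)).mul (Len_pow hY.1.le y)) _ hx1
      have x2 := opp_lb hx
      have x3 := D_le hx
      have x4 : D x ≠ 0 := D_pos_of_o (by omega)
      have x5 : D x = 1 ∨ D x = 2 := by omega
      have x6 : o x = y + 1 ∨ o x = y + 2 := by omega
      rcases x5 with x5 | x5 <;> rcases x6 with x6 | x6
      · exact Or.inl (inj (by rw [hY.1]; omega) (by omega))
      · have : x = U := inj (by omega) (by omega)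
        subst this; exact absurd hx (not_self_sq hR)
      · exfalso
        obtain ⟨W, w1, w2, w3⟩ := circ_ex x
        have w4 := tr (mem_join hx w3) (by rw [pr_cons]; ring : _ = c U * pr (U ::ₘ W))
        rcases hSR (U ::ₘ W) (Arcs_cons.2 ⟨hR, w1⟩) (by simp; omega) w4 with h5 | ⟨R', r1, r2, h5⟩
        · rw [h5, pr_rep, ← pow_succ'] at w4
          exact noYsq hR hY.1 rfl (by omega) w4 hYR
        · have : R' = Y := inj (by rw [r1.1, hY.1]) (by omega)
          subst this
          rcases h5 with ⟨h5, -⟩ | ⟨h5, -⟩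
          · have : W = _ := (Multiset.cons_inj_right U).1 h5
            rw [this, pr_rep, hy, pow_inv hp] at w3
            have := st_inj (mem_c.1 (e_iff.1 w3))
            rw [this, hY.1] at x5
            omega
          · have : U ∈ Multiset.replicate (o U) R' := by rw [← h5]; simp
            have := Multiset.eq_of_mem_replicate this
            exact hUY this
      · exact Or.inr ⟨x5, x6⟩
    have hno : H ∉ E Y := by
      intro hh
      have := st_mem_E hh
      rw [← hE] at this
      have : o H ≤ _ := Len_pow hY.1.le _ _ this
      omega
    obtain ⟨z, hz⟩ := nonemp H Y
    obtain ⟨w, hw⟩ := nonemp (st H) Y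
    have hz1 : z ∈ c U * c U := by
      rw [sq_eq hYR]; exact tr (mem_join hHE hz) (mul_comm _ _)
    have hw1 : w ∈ c U * c U := by
      rw [sq_eq hYR]; exact tr (mem_join (st_mem_E hHE) hw) (mul_comm _ _)
    have hz2 : D z = 2 ∧ o z = y + 2 := by
      rcases key z hz1 with rfl | h
      · exact absurd (memE_of hz) hno
      · exact h
    have hw2 : D w = 2 ∧ o w = y + 2 := by
      rcases key w hw1 with rfl | h
      · have := st_mem_E (memE_of hw)
        rw [st_st] at this
        exact absurd this hno
      · exact h
    have : w = z := inj (by omega) (by omega)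
    subst this
    have q := rev2 hw
    rw [st_st] at q
    have q := mem_join hz q
    obtain ⟨g, hg, q⟩ := mem_split (tr q (by ring : _ = c H * c H * c Y))
    have q := st_mem_E (memE_of q)
    rw [← hE] at q
    have q := mem_join hg (e_iff.2 q)
    have := (caseI_pow IH hH hY.1 hn (by omega) hYH q).2.1
    omega
  have nU1 : o U + 1 ≠ o R := fun hh => hUY (inj (by rw [hU, hY.1]) (by omega))
  have nU : ∀ M : Multiset T, Arcs M → M.card = o R → e ∈ c R * pr M → U ∈ M → False := by
    intro M m1 m2 m3 m4
    rcases str_mem hSR m1 m2 m3 m4 with h | h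
    · exact hUR h
    · exact nU1 h
  obtain ⟨L, hL, L1, L2, L3⟩ := onC (P := c U * c R * c Y ^ y)
    (tr hc (by ring : _ = c H * c Y * (c U * c R * c Y ^ y))) hH hY.1
    (by omega) ((((Len_c hU.le).mul (Len_c hR.le)).mul (Len_pow hY.1.le _)).mono (by omega))
  rcases L3 with L3 | L3
  · have : L = R := inj (by omega) (by omega)
    subst this
    refine nU (U ::ₘ L ::ₘ Multiset.replicate y Y) ?_ (by simp; omega) ?_ (by simp)
    · exact Arcs_cons.2 ⟨hU, Arcs_cons.2 ⟨hR, Arcs_rep hY.1 _⟩⟩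
    · rw [pr_cons, pr_cons, pr_rep]; exact tr L1 (by ring)
  obtain ⟨L', hL', L1', L2', L3'⟩ := onC (P := c U * c Y ^ (y + 1))
    (tr hc (by ring : _ = c H * c R * (c U * c Y ^ (y + 1)))) hH hR
    (by omega) (((Len_c hU.le).mul (Len_pow hY.1.le _)).mono (by omega))
  rcases L3' with L3' | L3'
  · have : L' = R := inj (by omega) (by omega)
    subst this
    refine nU (U ::ₘ Multiset.replicate (y + 1) Y) ?_ (by simp; omega) ?_ (by simp)
    · exact Arcs_cons.2 ⟨hU, Arcs_rep hY.1 _⟩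
    · rw [pr_cons, pr_rep]; exact L1'
  have : L' = L := inj (by omega) (by omega)
  subst this
  have q := mem_join hL L1'
  obtain ⟨g, hg, g1, g2, g3⟩ := onC (P := c Y ^ (y + 1 + 1))
    (tr q (by ring : _ = c H * c U * (c Y ^ (y + 1 + 1)))) hH hU
    (by omega) ((Len_pow hY.1.le _).mono (by omega))
  rw [hE] at g1
  rcases g3 with g3 | g3
  · have : g = R := inj (by omega) (by omega)
    subst this
    have := st_mem_E (e_iff.1 g1)
    rw [st_st] at this
    exact hRnY this
  · have : g = L' := inj (by omega) (by omega)
    subst this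
    have := e_iff.1 (tr (mem_join hL g1) (by ring : _ = c H * (E Y * c Y)))
    rw [E_c] at this
    exact not_st hY.1 (by omega) this

lemma b3 {H U R Y : T} {k : ℕ} (IH : ∀ S : T, D S = 1 → o S < o H → Str S)
    (hH : D H = 1) (hn : o H = k + 1) (hU : D U = 1) (hR : D R = 1) (hRo : o R = k)
    (hUH : U ≠ H) (hRU : R ∈ c H * c U) (hY : PureA Y) (hYo : o Y + 1 = k)
    (hRY : R ∈ E Y) (h : e ∈ c R * c Y ^ k) : False := by
  have hy := o_pos hY.1
  obtain ⟨y, hy⟩ : ∃ y, o Y = y + 1 := ⟨o Y - 1, by omega⟩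
  have hp := hY.pow
  rw [hy] at hp
  obtain rfl : k = y + 2 := by omega
  have hE := pow_E hp
  have hc := mem_join hRU h
  have hYH : Y ≠ H := by rintro rfl; omega
  have hnEo : ∀ x ∈ E Y, o x ≤ y + 2 := by
    intro x hx
    have := st_mem_E hx
    rw [← hE] at this
    exact Len_pow hY.1.le _ _ this
  by_cases hUY : U = Y
  · subst hUY
    rw [hE] at hc
    have := e_iff.1 (tr hc (by ring : _ = c H * (E U * c U)))
    rw [E_c] at this
    exact not_st hU (by omega) this
  by_cases hUR : U = R
  · subst hUR
    rw [hE] at hc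
    have q := mul_mono (c_sub.2 hRY) (subset_refl (E Y)) (e_iff.1 (tr hc (mul_assoc _ _ _)))
    rw [E_E] at q
    have q := st_mem_E q
    rw [st_st] at q
    have := hnEo _ q
    omega
  have u1 := SC (tr hc (by ring : _ = c U * (c H * c Y ^ (y + 2))))
    ((Len_c hH.le).mul (Len_pow hY.1.le _))
  have u2 := o_pos hU
  have u3 : o U ≠ y + 3 := fun h => hUH (inj (by omega) (by omega))
  have u4 : o U ≠ y + 2 := fun h => hUR (inj (by omega) (by omega))
  have u5 : o U ≠ y + 1 := fun h => hUY (inj (by rw [hU, hY.1]) (by omega))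
  obtain ⟨L, hL, L1, L2, L3⟩ := onC (P := c U * c Y ^ (y + 1))
    (tr hc (by ring : _ = c H * c Y * (c U * c Y ^ (y + 1)))) hH hY.1
    (by omega) (((Len_c hU.le).mul (Len_pow hY.1.le _)).mono (by omega))
  have hLE : L ∉ E Y := by
    intro hh
    have := rev1 hL
    rw [absE' hh] at this
    exact not_st' hY.1 (by omega) this
  rcases L3 with L3 | L3
  · have : L = R := inj (by omega) (by omega)
    subst this
    exact hLE hRY
  obtain ⟨g, hg, g1⟩ := mem_split (tr hc (by ring : _ = (c U * c Y) * (c H * c Y ^ (y + 1))))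
  have g2 : D g = 2 := by
    have := D_le hg
    have := hY.1
    by_contra hlt
    have := SC (tr g1 (by ring : _ = c H * (c g * c Y ^ (y + 1))))
      ((Len_c (n := 1) (by omega)).mul (Len_pow hY.1.le _))
    omega
  have g3 := SC g1 ((Len_c hH.le).mul (Len_pow hY.1.le _))
  have g4 := opp_lb (tr hg (mul_comm _ _))
  have g5 : o g = y ∨ o g = y + 1 ∨ o g = y + 2 := by omega
  rcases g5 with g5 | g5 | g5
  · obtain ⟨W, w1, w2, w3⟩ := circ_ex g
    have w4 := tr (mem_join hg w3) (by rw [pr_cons]; ring : _ = c Y * pr (U ::ₘ W))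
    have := hY.2 _ (Arcs_cons.2 ⟨hU, w1⟩) (by simp; omega) w4
    have : U ∈ Multiset.replicate (o Y) Y := by rw [← this]; simp
    exact hUY (Multiset.eq_of_mem_replicate this)
  · obtain ⟨x, hx⟩ := nonemp R R
    have hxE : x ∈ E Y := by
      have := pow_sub_E hRY 1
      rw [pow_two] at this
      exact this hx
    have x1 := hnEo x hxE
    have x2 := opp_lb hx
    have x3 := D_le hx
    have x4 : D x ≠ 0 := D_pos_of_o (by omega)
    have x5 : D x = 1 ∨ D x = 2 := by omega
    have x6 : o x = y + 1 ∨ o x = y + 2 := by omega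
    rcases x5 with x5 | x5 <;> rcases x6 with x6 | x6
    · have : x = Y := inj (by rw [hY.1]; omega) (by omega)
      subst this; exact not_self_E hY.1 hxE
    · have : x = R := inj (by omega) (by omega)
      subst this; exact not_self_sq hR hx
    · have : x = g := inj (by omega) (by omega)
      subst this
      have := rev1 hg
      rw [absE' hxE, mem_c] at this
      have : o Y = D U := by rw [this]; rfl
      omega
    · have : x = L := inj (by omega) (by omega)
      subst this; exact hLE hxE
  · have : g = L := inj (by omega) (by omega)
    subst this
    have q := tr (mem_join hL g1) (by ring : _ = c H * c H * c Y ^ (y + 2))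
    have := (caseI_pow IH hH hY.1 hn (by omega) hYH q).2.1
    omega

lemma caseB {H U R : T} {k : ℕ} {N : Multiset T} (IH : ∀ S : T, D S = 1 → o S < o H → Str S)
    (hH : D H = 1) (hn : o H = k + 1) (hU : D U = 1) (hR : D R = 1) (hRo : o R = k)
    (hUH : U ≠ H) (hRU : R ∈ c H * c U) (hN : Arcs N) (hc : N.card = k) (h : e ∈ c R * pr N) :
    U = R ∧ N = Multiset.replicate k R ∧ H ∈ E R ∧ PureA R := by
  rcases IH R hR (by omega) N hN (by omega) h with h1 | ⟨Y, y1, y2, ⟨h1, h2⟩ | ⟨h1, h2⟩⟩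
  · rw [hRo] at h1
    rw [h1, pr_rep] at h
    obtain ⟨a1, a2, a3⟩ := b1 IH hH hn hU hR hRo hUH hRU h
    exact ⟨a1, h1, a2, a3⟩
  · rw [h1, pr_cons, pr_rep] at h
    exact (b2 IH hH hn hU hR hRo hRU y1 (by omega) h2 h).elim
  · rw [h1, pr_rep, hRo] at h
    exact (b3 IH hH hn hU hR hRo hUH hRU y1 (by omega) h2 h).elim

end
end W14
namespace W14
open HG
section
variable {T : Type*} [HG T]

lemma fin_pow {H S L : T} {k : ℕ} (IH : ∀ S : T, D S = 1 → o S < o H → Str S)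
    (hH : D H = 1) (hn : o H = k + 1) (hk : 1 ≤ k) (hS : D S = 1) (hne : S ≠ H)
    (hL : L ∈ c H * c S) (hL2 : D L = 2) (h : e ∈ c H * c S ^ (k + 1)) : False := by
  have s1 := SC (tr h (by ring : _ = c S * (c H * c S ^ k))) ((Len_c hH.le).mul (Len_pow hS.le _))
  have s2 : o S ≠ k + 1 := fun h => hne (inj (by omega) (by omega))
  obtain ⟨M, m1, m2, m3⟩ := circ_ex S
  rcases IH S hS (by omega) M m1 m2 m3 with h1 | ⟨V, v1, v2, h1⟩
  · rw [h1, pr_rep, ← pow_succ'] at m3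
    by_cases hs : o S = k
    · rw [hs] at m3
      rw [pow_E m3] at h
      have := st_mem_E (e_iff.1 h)
      rw [st_st] at this
      rw [absE this, mem_c] at hL
      rw [hL] at hL2; omega
    · obtain ⟨i, hi⟩ : ∃ i, k = o S + (i + 1) := ⟨k - o S - 1, by omega⟩
      rw [show k + 1 = o S + 1 + (i + 1) by omega, pow_red m3] at h
      have := SC h (Len_pow hS.le _)
      omega
  · have := o_pos v1.1
    rcases h1 with ⟨-, h1⟩ | ⟨-, h1⟩
    · obtain ⟨i, rfl⟩ : ∃ i, k = i + 2 := ⟨k - 2, by omega⟩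
      rw [show c S ^ (i + 2 + 1) = c S ^ 3 * c S ^ i by ring, cube h1] at h
      have := SC h (((Len_c v1.1.le).mul (Len_c hS.le)).mul (Len_pow hS.le _))
      omega
    · have q := pow_sub_E h1 k
      rw [← pow_E v1.pow] at q
      have h := mul_mono (subset_refl (c H)) q h
      have := SC h (Len_pow v1.1.le _)
      omega

lemma exchB {H S L : T} {k : ℕ} (IH : ∀ S : T, D S = 1 → o S < o H → Str S)
    (hH : D H = 1) (hn : o H = k + 1) (hk : 1 ≤ k) (hS : D S = 1)
    (hL : L ∈ c H * c S) (hL2 : D L = 2) (hLo : o L = k) (N : Multiset T) :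
    ∀ j, Arcs N → H ∉ N → N.card + j = k →
    e ∈ c H * pr N * c S ^ (j + 1) → e ∈ c H * c S ^ (k + 1) := by
  induction N using Multiset.induction with
  | empty => intro j _ _ hk h; simp at hk; rw [pr_zero, mul_one, hk] at h; exact h
  | cons a N ih =>
    intro j hA hN hc h
    rw [Multiset.card_cons] at hc
    have ⟨ha, hA'⟩ := Arcs_cons.1 hA
    simp only [Multiset.mem_cons, not_or] at hN
    rw [pr_cons] at h
    obtain ⟨g, hg, g1, g2, g3⟩ := onC (P := pr N * c S ^ (j + 1))
      (tr h (by ring : _ = c H * c a * (pr N * c S ^ (j + 1)))) hH ha (by omega)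
      (((Len_pr hA').mul (Len_pow hS.le _)).mono (by omega))
    rcases g3 with g3 | g3
    · exfalso
      obtain ⟨-, q2, q3, -⟩ := caseB (N := N + Multiset.replicate (j + 1) S) IH hH hn ha g3 (by omega)
        (Ne.symm hN.1) hg
        (by intro b hb
            rcases Multiset.mem_add.1 hb with hb | hb
            · exact hA' b hb
            · exact Arcs_rep hS _ b hb) (by simp; omega) (by rw [pr_add, pr_rep]; exact g1)
      have : S ∈ Multiset.replicate k g := by rw [← q2]; simp
      have := Multiset.eq_of_mem_replicate this
      subst this
      rw [absE q3, mem_c] at hL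
      rw [hL] at hL2; omega
    · have : g = L := inj (by omega) (by omega)
      subst this
      exact ih (j + 1) hA' hN.2 (by omega) (tr (mem_join hL g1) (by ring))

theorem str_all : ∀ (n : ℕ) (H : T), D H = 1 → o H = n → Str H := by
  intro n
  induction n using Nat.strong_induction_on with
  | _ n ih =>
  intro H hH hn M m1 m2 m3
  have IH : ∀ S : T, D S = 1 → o S < o H → Str S := fun S hS h => ih (o S) (by omega) S hS rfl
  have := o_pos hH
  obtain ⟨k, rfl⟩ : ∃ k, n = k + 1 := ⟨n - 1, by omega⟩
  by_cases hM : M = Multiset.replicate (o H) H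
  · exact Or.inl hM
  right
  have : ∃ U ∈ M, U ≠ H := by
    by_contra hcon
    push Not at hcon
    exact hM (Multiset.eq_replicate.2 ⟨m2, hcon⟩)
  obtain ⟨U, hUM, hUH⟩ := this
  obtain ⟨N, rfl⟩ := Multiset.exists_cons_of_mem hUM
  obtain ⟨hU, hN⟩ := Arcs_cons.1 m1
  rw [Multiset.card_cons] at m2
  rw [pr_cons] at m3
  by_cases hk : k = 0
  · subst hk
    exfalso
    have : N = 0 := Multiset.card_eq_zero.1 (by omega)
    rw [this, pr_zero, mul_one] at m3
    have : st H = U := e_iff.1 m3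
    refine hUH (inj (by omega) ?_)
    rw [← this, o_st]; omega
  by_cases hHN : H ∈ N
  · obtain ⟨N', rfl⟩ := Multiset.exists_cons_of_mem hHN
    rw [pr_cons] at m3
    rw [Multiset.card_cons] at m2
    obtain ⟨R, r1, r2, r3, r4⟩ := caseI (N := U ::ₘ N') IH hH hn
      (Arcs_cons.2 ⟨hU, (Arcs_cons.1 hN).2⟩) (by simp; omega) (by simp : U ∈ U ::ₘ N') hUH
      (by rw [pr_cons]; exact tr m3 (by ring))
    exact ⟨R, r1, by omega, Or.inl ⟨by rw [Multiset.cons_swap, r4, r2], r3⟩⟩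
  obtain ⟨g, hg, g1, g2, g3⟩ := onC (P := pr N) (tr m3 (by ring : _ = c H * c U * pr N)) hH hU (by omega)
    ((Len_pr hN).mono (by omega))
  rcases g3 with g3 | g3
  · obtain ⟨q1, q2, q3, q4⟩ := caseB (N := N) IH hH hn hU g3 (by omega) hUH hg hN (by omega) g1
    refine ⟨g, q4, by omega, Or.inr ⟨?_, q3⟩⟩
    rw [q1, q2, hn, Multiset.replicate_succ]
  · exfalso
    exact fin_pow IH hH hn (by omega) hU hUH hg g3
      (exchB IH hH hn (by omega) hU hg g3 (by omega) N 0 hN hHN (by omega) (tr m3 (by ring)))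

end
end W14
namespace W14
open HG
section
variable {T : Type*} [HG T]

lemma absHH {H k z y : T} (hk : k ∈ E H) (hy : y ∈ c H * c H) (hz : z ∈ c k * c y) :
    z ∈ c H * c H := by
  have := mul_mono (subset_refl (c k)) (c_sub.2 hy) hz
  rwa [← mul_assoc, absE hk] at this

lemma single {A H Q x d : T} (hxA : x ∈ c A * c A) (hxH : x ∈ E H) (hd : d ∈ c H * c H)
    (hdQ : d ∈ E Q) (hs : ∀ y ∈ c H * c H, y = d) : ∃ x ∈ c A * c A, x ∈ E Q := by
  refine ⟨x, hxA, E_sub hdQ ?_⟩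
  obtain ⟨z, hz⟩ := nonemp x d
  have := hs z (absHH hxH hd hz)
  subst this
  exact memE_of hz

lemma finP {H : T} (hH : D H = 1) (hn : 2 ≤ o H) (h : e ∈ c H ^ (o H + 1)) :
    ∀ x ∈ c H * c H, D x = 2 ∧ o x + 1 = o H := by
  intro x hx
  obtain ⟨j, hj⟩ : ∃ j, o H = j + 2 := ⟨o H - 2, by omega⟩
  rw [hj] at h
  have h1 : c (st H) = c H ^ (j + 2) := (pow_inv h).symm
  have h2 : st x ∈ c H ^ (j + 1) := by
    have : st x ∈ star (c H * c H) := by rw [mem_star, st_st]; exact hx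
    rw [star_mul, star_c, h1, ← pow_add, show j + 2 + (j + 2) = j + 2 + 1 + (j + 1) by omega,
      pow_red h] at this
    exact this
  have x1 : o x ≤ _ := Len_pow hH.le _ _ h2
  have x2 := opp_lb hx
  have x3 := D_le hx
  have x4 : D x ≠ 0 := D_pos_of_o (by omega)
  refine ⟨?_, by omega⟩
  by_contra hx5
  have := SC (tr (e_iff.2 h2) (by ring : _ = c H * (c x * c H ^ j)))
    ((Len_c (n := 1) (by omega)).mul (Len_pow hH.le _))
  omega

lemma caseC {A H Q R cc d : T} {r : ℕ} (hA : D A = 1) (hA2 : 2 ≤ o A) (hH : D H = 1)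
    (hAH : A ≠ H) (hn : o H = r + 1) (hP : PureA R) (hr : o R = r) (hRH : R ∈ c H * c H)
    (hcirc : e ∈ c H * c H * c R ^ r) (hcA : cc ∈ c A * c A) (hcH : cc ∈ E H)
    (hd : d ∈ c H * c H) (hdQ : d ∈ E Q) : ∃ x ∈ c A * c A, x ∈ E Q := by
  have hR := hP.1
  have hr1 := o_pos hR
  obtain ⟨i, rfl⟩ : ∃ i, r = i + 1 := ⟨r - 1, by omega⟩
  have hp := hP.pow
  rw [hr] at hp
  have hE := pow_E hp
  have hRneH : R ≠ H := by rintro rfl; omega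
  have hER : E R ⊆ E H := E_sub_sq hRH
  have hHE : c H * E R = c H := by
    apply Set.Subset.antisymm
    · refine (mul_mono (subset_refl (c H)) hER).trans ?_
      rw [mul_comm, E_c]
    · have := mul_mono (subset_refl (c H)) (c_sub.2 (e_E R))
      rwa [← one_eq, mul_one] at this
  obtain ⟨L, hL, -, -, L1, L2, -⟩ := subl (k := i + 1) (j := i) (P := c R ^ i) hH hR hn rfl hRneH
    (tr hcirc (by ring)) (Len_pow hR.le _)
  have hEH : E H = c H * c H * c R ^ (i + 1) := by
    calc E H = c H * E R * c (st H) := by rw [hHE]; rfl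
      _ = c R ^ (i + 1 + 1) * E H := by rw [hE, E, E]; ring
      _ = (c R * E H) * c R ^ (i + 1) := by ring
      _ = _ := by rw [← sq_eq hRH]
  have stHH : ∀ x ∈ c H * c H, st x ∈ c H * c H * c R ^ i := by
    intro x hx
    have : x ∈ c R * E H := by rw [← sq_eq hRH]; exact hx
    have : st x ∈ star (c R * E H) := by rw [mem_star, st_st]; exact this
    rw [star_mul, star_c, star_E, hEH] at this
    have := tr this (by rw [E]; ring : _ = c H * (c H * E R) * c R ^ i)
    rwa [hHE] at this
  have key : ∀ x ∈ c H * c H, x = R ∨ (D x = 2 ∧ o x = i + 2) := by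
    intro x hx
    have x1 : o x ≤ _ := (((Len_c hH.le).mul (Len_c hH.le)).mul (Len_pow hR.le i)) _ (stHH x hx)
    have x2 := opp_lb hx
    have x3 := D_le hx
    have x4 : D x ≠ 0 := D_pos_of_o (by omega)
    have x5 : D x = 1 ∨ D x = 2 := by omega
    have x6 : o x = i + 1 ∨ o x = i + 2 := by omega
    rcases x5 with x5 | x5 <;> rcases x6 with x6 | x6
    · exact Or.inl (inj (by omega) (by omega))
    · have : x = H := inj (by omega) (by omega)
      subst this; exact absurd hx (not_self_sq hH)
    · have : x = L := inj (by omega) (by omega)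
      subst this
      have := rev2 hL
      rw [sq1 hx] at this
      exact absurd this hRneH
    · exact Or.inr ⟨x5, x6⟩
  by_cases hc' : ∃ x ∈ c A * c A, x ∈ E R
  · obtain ⟨x, hxA, hxR⟩ := hc'
    refine ⟨x, hxA, E_sub hdQ ?_⟩
    rcases key d hd with rfl | hd2
    · exact hxR
    · obtain ⟨z, hz⟩ := nonemp x d
      rcases key z (absHH (hER hxR) hd hz) with rfl | hz2
      · have := rev2 hz
        rw [mul_comm, absE (st_mem_E hxR), mem_c] at this
        rw [this] at hd2; omega
      · have : z = d := inj (by omega) (by omega)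
        subst this
        exact memE_of hz
  exfalso
  push Not at hc'
  have hccR : cc ∉ E R := hc' cc hcA
  obtain ⟨ee, hee⟩ := nonemp cc R
  have hE1 : ∀ z ∈ c cc * c R, D z = 2 ∧ o z = i + 2 := by
    intro z hz
    rcases key z (absHH hcH hRH hz) with rfl | h
    · exact absurd (memE_of hz) hccR
    · exact h
  have heeH := absHH hcH hRH hee
  obtain ⟨ee1, ee2⟩ := hE1 ee hee
  have hccee : c cc * c R = c ee := eq_c_of (fun z hz =>
    inj (by rw [(hE1 z hz).1, ee1]) (by rw [(hE1 z hz).2, ee2]))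
  have hAR : A ≠ R := by
    intro hAR
    have q1 := sq1 hcA
    have : c H * c R = c (st H) := by
      rw [← hAR, ← q1, hAR, mul_comm, mul_assoc, sq2 hRH, absE' hcH]
    rw [this, mem_c] at hL
    have : D L = o H := by rw [hL]; rfl
    rw [hAR] at hA2; omega
  have hAER : A ∉ E R := by
    intro hh
    have := pow_sub_E hh 1
    rw [pow_two] at this
    exact hc' cc hcA (this hcA)
  have hAR1 : c A * c R = c (st A) * c ee := by
    rw [← sq1 hcA, ← hccee]; ring
  have hstA : st A ≠ A := by
    intro hh
    have : o A = D A := by rw [← hh, o_st, hh]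
    omega
  have keyAR : ∀ x ∈ c A * c R, (D x = 1 ∨ D x = 2) ∧ (x = ee ∨ o x = i + 3) := by
    intro x hx
    have x1 : o x ≤ i + 3 := by
      have := o_le (tr hx hAR1)
      rw [o_st] at this; omega
    have x2 := opp_lb (tr hx (mul_comm _ _))
    have x3 := D_le hx
    have x4 : D x ≠ 0 := by
      intro hh
      rw [D_zero hh] at hx
      exact not_st hR hA2 (e_iff.1 hx)
    have x5 : D x = 1 ∨ D x = 2 := by omega
    refine ⟨x5, ?_⟩
    have x6 : o x ≠ i := by
      intro hh
      obtain ⟨W, w1, w2, w3⟩ := circ_ex x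
      have w4 := tr (mem_join hx w3) (by rw [pr_cons]; ring : _ = c R * pr (A ::ₘ W))
      have := hP.2 _ (Arcs_cons.2 ⟨hA, w1⟩) (by simp; omega) w4
      have : A ∈ Multiset.replicate (o R) R := by rw [← this]; simp
      exact hAR (Multiset.eq_of_mem_replicate this)
    have x7 : o x = i + 1 ∨ o x = i + 2 ∨ o x = i + 3 := by omega
    rcases x7 with x7 | x7 | x7
    · exfalso
      rcases x5 with x5 | x5
      · have : x = R := inj (by omega) (by omega)
        subst this; exact hAER (memE_of hx)
      · have : x = L := inj (by omega) (by omega)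
        subst this
        have := tr (mem_join hL (rev1 hx)) (by rw [E]; ring : _ = c H * E R)
        rw [hHE] at this
        exact hAH this
    · rcases x5 with x5 | x5
      · exfalso
        have : x = H := inj (by omega) (by omega)
        subst this
        have := rev1 hx
        rw [mul_comm, sq2 hRH, mem_c] at this
        have : D A = o x := by rw [this]; rfl
        omega
      · exact Or.inl (inj (by omega) (by omega))
    · exact Or.inr x7
  have keyAH : ∀ x ∈ c A * c H, (D x = 1 ∨ D x = 2) ∧ (x = H ∨ o x = i + 3) := by
    intro x hx
    have x1 : o x ≤ i + 3 := by
      have : st x ∈ star (c A * c H) := by rw [mem_star, st_st]; exact hx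
      rw [star_mul, star_c, star_c, ← sq2 hcA] at this
      have := tr this (by ring : _ = c A * (c (st cc) * c (st H)))
      rw [absE' (st_mem_E hcH)] at this
      have : o x ≤ D A + o H := D_le this
      omega
    have x2 := opp_lb (tr hx (mul_comm _ _))
    have x3 := D_le hx
    have x4 : D x ≠ 0 := D_pos_of_o (by omega)
    have x5 : D x = 1 ∨ D x = 2 := by omega
    refine ⟨x5, ?_⟩
    have x7 : o x = i + 1 ∨ o x = i + 2 ∨ o x = i + 3 := by omega
    rcases x7 with x7 | x7 | x7
    · exfalso
      rcases x5 with x5 | x5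
      · have : x = R := inj (by omega) (by omega)
        subst this
        have := rev1 hx
        rw [sq1 hRH] at this
        exact hAH this
      · have : x = L := inj (by omega) (by omega)
        subst this
        have := tr (mem_join hL (rev1 hx)) (by rw [E]; ring : _ = c R * E H)
        rw [← sq_eq hRH] at this
        rcases key A this with h | h
        · exact hAR h
        · omega
    · rcases x5 with x5 | x5
      · exact Or.inl (inj (by omega) (by omega))
      · exfalso
        have : x = ee := inj (by omega) (by omega)
        subst this
        have := rev1 hx
        rw [sq1 heeH] at this
        exact hAH this
    · exact Or.inr x7
  have disj : ∀ x ∈ c A * c R, x ∈ c A * c H → False := by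
    intro x h1 h2
    have q := tr (mem_join h2 (rev2 h1)) (by rw [E]; ring : _ = E A * c H)
    obtain ⟨k, hk, hk1⟩ := mem_split q
    have := rev1 hk1
    rw [sq1 hRH, mem_c] at this
    subst this
    have q2 := absE' (E_sub hk hcH)
    rw [sq1 hcA] at q2
    have : A ∈ c (st A) := by rw [← q2]; exact self_c A
    exact hstA (mem_c.1 this).symm
  by_cases hAEH : A ∈ E H
  · have q1 : c A * c R = c ee := by
      refine eq_c_of (fun z hz => ?_)
      rcases key z (absHH hAEH hRH hz) with rfl | h
      · exact absurd (memE_of hz) hAER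
      · exact inj (by omega) (by omega)
    have q2 : c (st A) * c R = c ee := by
      refine eq_c_of (fun z hz => ?_)
      rcases key z (absHH (st_mem_E hAEH) hRH hz) with rfl | h
      · have := st_mem_E (memE_of hz)
        rw [st_st] at this
        exact absurd this hAER
      · exact inj (by omega) (by omega)
    have q3 : R ∈ E A * c R := mem_join (e_E A) (by rw [← one_eq, one_mul]; exact self_c R)
    have q4 : E A * c R = c A * c A * c R := by
      rw [mul_assoc (c A) (c A), q1, E, mul_assoc, q2]
    rw [q4] at q3
    obtain ⟨k, hk, hk1⟩ := mem_split q3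
    exact hc' k hk (memE_of hk1)
  have keyAH' : ∀ x ∈ c A * c H, (D x = 1 ∨ D x = 2) ∧ o x = i + 3 := by
    intro x hx
    obtain ⟨h1, rfl | h2⟩ := keyAH x hx
    · exact absurd (memE_of hx) hAEH
    · exact ⟨h1, h2⟩
  have keyAR' : ∀ x ∈ c A * c R, (D x = 1 ∨ D x = 2) ∧ o x = i + 3 := by
    intro x hx
    obtain ⟨h1, rfl | h2⟩ := keyAR x hx
    · have := tr (mem_join hee (rev1 hx)) (by rw [E]; ring : _ = c cc * E R)
      have := mul_mono (c_sub.2 hcH) hER this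
      rw [E_E] at this
      exact absurd this hAEH
    · exact ⟨h1, h2⟩
  obtain ⟨u, hu⟩ := nonemp A H
  obtain ⟨v, hv⟩ := nonemp A R
  obtain ⟨u1, u2⟩ := keyAH' u hu
  obtain ⟨v1, v2⟩ := keyAR' v hv
  have huv : D u ≠ D v := by
    intro hh
    have : u = v := inj hh (by omega)
    subst this
    exact disj u hv hu
  have huS : c A * c H = c u := by
    refine eq_c_of (fun z hz => ?_)
    obtain ⟨z1, z2⟩ := keyAH' z hz
    by_contra hzu
    have : D z ≠ D u := fun h => hzu (inj h (by omega))
    have : z = v := inj (by omega) (by omega)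
    subst this
    exact disj z hv hz
  have hvS : c A * c R = c v := by
    refine eq_c_of (fun z hz => ?_)
    obtain ⟨z1, z2⟩ := keyAR' z hz
    by_contra hzu
    have : D z ≠ D v := fun h => hzu (inj h (by omega))
    have : z = u := inj (by omega) (by omega)
    subst this
    exact disj z hz hu
  have stR : st R ∈ c R ^ (i + 1) := e_iff.1 (tr hp (pow_succ' _ _))
  rcases u1 with u1 | u1
  · have q : R ∈ c u * c u := by
      have : R ∈ c cc * (c H * c H) := by rw [← mul_assoc, absE hcH]; exact hRH
      have := tr (mem_join hcA this) (by ring : _ = (c A * c H) * (c A * c H))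
      rwa [huS] at this
    have q2 : st u ∈ c (st R) * c u := by rw [sq2 q]; exact self_c _
    have := ((Len_pow hR.le (i + 1)).mul (Len_c u1.le)) _ (mem_join stR q2)
    change o u ≤ _ at this
    omega
  · have v1' : D v = 1 := by omega
    have q : st v ∈ c A * c (st ee) := by
      have : st v ∈ star (c (st A) * c ee) := by
        rw [← hAR1, hvS, mem_star, st_st]; exact self_c _
      rwa [star_mul, star_c, star_c, st_st] at this
    have q2 : st v ∈ c A * (c H * c H * c R ^ i) :=
      mul_mono (subset_refl _) (c_sub.2 (stHH ee heeH)) q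
    obtain ⟨g, hg, g1⟩ := mem_split
      (tr (e_iff.2 q2) (by ring : _ = (c v * c H) * (c A * c H * c R ^ i)))
    have g2 := SC g1 (((Len_c hA.le).mul (Len_c hH.le)).mul (Len_pow hR.le i))
    have g3 := opp_lb hg
    have g4 := D_le hg
    have g5 : D g ≠ 0 := D_pos_of_o (by omega)
    have g6 : D g = 1 ∨ D g = 2 := by omega
    rcases g6 with g6 | g6
    · have : g = H := inj (by omega) (by omega)
      subst this
      have hvE := memE_of hg
      have q3 := rev1 hv
      have q4 : st A ∈ star (c v * c (st R)) := by rw [mem_star, st_st]; exact q3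
      rw [star_mul, star_c, star_c, st_st] at q4
      rcases key _ (absHH (st_mem_E hvE) hRH q4) with h | h
      · exact not_st hR hA2 h
      · have := o_st A; omega
    · have : g = ee := inj (by omega) (by omega)
      subst this
      have := rev1 hg
      rw [sq1 heeH, mem_c] at this
      rw [this] at v2; omega

theorem fin {A H Q cc d : T} (hA : D A = 1) (hH : D H = 1) (hn : 2 ≤ o H)
    (hcA : cc ∈ c A * c A) (hcH : cc ∈ E H)
    (hd : d ∈ c H * c H) (hdQ : d ∈ E Q) : ∃ x ∈ c A * c A, x ∈ E Q := by
  by_cases hA2 : 2 ≤ o A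
  swap
  · have := o_pos hA
    have : st A = A := inj (by change o A = _; omega) (by rw [o_st]; omega)
    refine ⟨e, e_iff.2 (by rw [this]; exact self_c A), e_E Q⟩
  by_cases hAH : A = H
  · subst hAH; exact ⟨d, hd, hdQ⟩
  have hStr := str_all (o H) H hH rfl
  by_cases hP : e ∈ c H ^ (o H + 1)
  · have := finP hH hn hP
    refine single hcA hcH hd hdQ (fun y hy => ?_)
    have h1 := this y hy
    have h2 := this d hd
    exact inj (by omega) (by omega)
  by_cases hC : ∃ R, PureA R ∧ o R + 1 = o H ∧ R ∈ c H * c H ∧ e ∈ c H * c H * c R ^ o R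
  · obtain ⟨R, r1, r2, r3, r4⟩ := hC
    exact caseC hA hA2 hH hAH r2.symm r1 rfl r3 r4 hcA hcH hd hdQ
  obtain ⟨M, m1, m2, m3⟩ := circ_ex H
  rcases hStr M m1 m2 m3 with h | ⟨R, r1, r2, ⟨h, h'⟩ | ⟨h, h'⟩⟩
  · rw [h, pr_rep, ← pow_succ'] at m3; exact absurd m3 hP
  · rw [h, pr_cons, pr_rep, ← mul_assoc] at m3
    exact absurd ⟨R, r1, r2, h', m3⟩ hC
  have key : ∀ x ∈ c H * c H, D x = 2 ∧ o x = o H := by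
    intro x hx
    have hxE : x ∈ E R := by
      have := pow_sub_E h' 1
      rw [pow_two] at this
      exact this hx
    have x1 : o x ≤ o R + 1 := by
      have := st_mem_E hxE
      rw [← pow_E r1.pow] at this
      exact Len_pow r1.1.le _ _ this
    have x2 := opp_lb hx
    have x3 := D_le hx
    have x4 : D x ≠ 0 := D_pos_of_o (by omega)
    have x5 : D x = 1 ∨ D x = 2 := by omega
    have x6 : o x = o R ∨ o x = o H := by omega
    rcases x5 with x5 | x5 <;> rcases x6 with x6 | x6
    · have : x = R := inj (by rw [r1.1]; omega) (by omega)
      subst this; exact absurd hxE (not_self_E r1.1)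
    · have : x = H := inj (by omega) (by omega)
      subst this; exact absurd hx (not_self_sq hH)
    · exfalso
      obtain ⟨W, w1, w2, w3⟩ := circ_ex x
      have w4 := tr (mem_join hx w3) (by rw [pr_cons]; ring : _ = c H * pr (H ::ₘ W))
      rcases hStr (H ::ₘ W) (Arcs_cons.2 ⟨hH, w1⟩) (by simp; omega) w4 with
        h | ⟨R', s1, s2, ⟨h, h''⟩ | ⟨h, h''⟩⟩
      · rw [h, pr_rep, ← pow_succ'] at w4; exact hP w4
      · rw [h, pr_cons, pr_rep, ← mul_assoc] at w4
        exact hC ⟨R', s1, s2, h'', w4⟩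
      · have : H ∈ Multiset.replicate (o H) R' := by rw [← h]; simp
        have := Multiset.eq_of_mem_replicate this
        rw [← this] at s2; omega
    · exact ⟨x5, x6⟩
  refine single hcA hcH hd hdQ (fun y hy => ?_)
  have h1 := key y hy
  have h2 := key d hd
  exact inj (by omega) (by omega)

end
end W14
namespace W14
open HG
section
variable {V : Type*} [Fintype V] (G : CTWDR V)

lemma dd_le {adj : V → V → Prop} {x y : V} {n : ℕ} (h : HasWalk adj x y n) : ddist adj x y ≤ n :=
  Nat.sInf_le h
lemma dd_walk (x y : V) : HasWalk G.adj x y (ddist G.adj x y) :=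
  Nat.sInf_mem (s := {n | HasWalk G.adj x y n}) (G.strong x y)
lemma dd_self (adj : V → V → Prop) (x : V) : ddist adj x x = 0 := by
  have : ddist adj x x ≤ 0 := dd_le ⟨fun _ => x, rfl, rfl, by intro i hi; omega⟩
  omega
lemma dd_zero {x y : V} (h : ddist G.adj x y = 0) : x = y := by
  obtain ⟨f, h1, h2, -⟩ := dd_walk G x y
  rw [h] at h2; rw [← h1, h2]
lemma dd_tri (x z y : V) : ddist G.adj x y ≤ ddist G.adj x z + ddist G.adj z y := by
  obtain ⟨f, f1, f2, f3⟩ := dd_walk G x z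
  obtain ⟨g, g1, g2, g3⟩ := dd_walk G z y
  set a := ddist G.adj x z
  set b := ddist G.adj z y
  refine dd_le ⟨fun i => if i < a then f i else g (i - a), ?_, ?_, ?_⟩
  · by_cases h : 0 < a
    · simp [h, f1]
    · have h0 : a = 0 := by omega
      rw [h0] at f2
      simp [h0, g1, ← f2, f1]
  · simp [g2]
  · intro i hi
    by_cases h : i + 1 < a
    · have h' : i < a := by omega
      simp only [h, h', if_true]
      exact f3 i h'
    · by_cases h' : i < a
      · have h2 : i + 1 = a := by omega
        simp only [h', if_true]
        rw [if_neg (by omega), h2, Nat.sub_self, g1, ← f2, ← h2]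
        exact f3 i h'
      · simp only [h, h', if_false]
        rw [show i + 1 - a = (i - a) + 1 by omega]
        exact g3 _ (by omega)
lemma dd_geo {x y : V} {n : ℕ} (h : ddist G.adj x y = n + 1) :
    ∃ z, ddist G.adj x z = 1 ∧ ddist G.adj z y = n := by
  obtain ⟨f, f1, f2, f3⟩ := dd_walk G x y
  rw [h] at f2 f3
  have h1 : ddist G.adj x (f 1) ≤ 1 :=
    dd_le ⟨f, f1, rfl, fun i hi => f3 i (by omega)⟩
  have h2 : ddist G.adj (f 1) y ≤ n :=
    dd_le ⟨fun i => f (i + 1), rfl, f2, fun i hi => f3 (i + 1) (by omega)⟩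
  have := dd_tri G x (f 1) y
  exact ⟨f 1, by omega, by omega⟩

lemma td_swap (adj : V → V → Prop) (x y : V) : tdist adj y x = (tdist adj x y).swap := rfl
lemma td_swap' {adj : V → V → Prop} {x y : V} {i : ℕ × ℕ} :
    tdist adj y x = i.swap ↔ tdist adj x y = i := by
  rw [td_swap]; exact Prod.swap_inj
lemma td_self (adj : V → V → Prop) (x : V) : tdist adj x x = (0, 0) := by simp [tdist, dd_self]

lemma nc_ne {s : Set V} : s.ncard ≠ 0 ↔ s.Nonempty := by
  rw [Ne, Set.ncard_eq_zero (Set.toFinite s), Set.nonempty_iff_ne_empty]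

/-- intersection witness transfer -/
lemma wit {i j : ℕ × ℕ} {x y z x' y' : V} (h : tdist G.adj x y = tdist G.adj x' y')
    (h1 : tdist G.adj x z = i) (h2 : tdist G.adj z y = j) :
    ∃ z', tdist G.adj x' z' = i ∧ tdist G.adj z' y' = j := by
  have := G.wdr i j x y x' y' h
  exact nc_ne.1 (this ▸ nc_ne.2 ⟨z, h1, h2⟩)

lemma wit_comm {i j : ℕ × ℕ} {x y z : V}
    (h1 : tdist G.adj x z = i) (h2 : tdist G.adj z y = j) :
    ∃ z', tdist G.adj x z' = j ∧ tdist G.adj z' y = i := by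
  have := G.comm i j x y
  exact nc_ne.1 (this ▸ nc_ne.2 ⟨z, h1, h2⟩)

lemma pnum_eq (i j : ℕ × ℕ) (x y : V) : pnum G.adj (tdist G.adj x y) i j =
    Set.ncard {z : V | tdist G.adj x z = i ∧ tdist G.adj z y = j} := by
  have : {n | ∃ x' y' : V, tdist G.adj x' y' = tdist G.adj x y ∧
    n = Set.ncard {z : V | tdist G.adj x' z = i ∧ tdist G.adj z y' = j}} =
    {Set.ncard {z : V | tdist G.adj x z = i ∧ tdist G.adj z y = j}} := by
    ext n; constructor
    · rintro ⟨x', y', h, rfl⟩; exact G.wdr i j x' y' x y h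
    · rintro rfl; exact ⟨x, y, rfl, rfl⟩
  rw [pnum, this, csSup_singleton]

lemma pnum_ne (k i j : ℕ × ℕ) : pnum G.adj k i j ≠ 0 ↔
    ∃ x y z : V, tdist G.adj x y = k ∧ tdist G.adj x z = i ∧ tdist G.adj z y = j := by
  constructor
  · intro h
    by_cases hk : ∃ x y : V, tdist G.adj x y = k
    · obtain ⟨x, y, rfl⟩ := hk
      rw [pnum_eq, nc_ne] at h
      obtain ⟨z, h1, h2⟩ := h
      exact ⟨x, y, z, rfl, h1, h2⟩
    · exfalso; apply h
      have : {n | ∃ x y : V, tdist G.adj x y = k ∧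
        n = Set.ncard {z : V | tdist G.adj x z = i ∧ tdist G.adj z y = j}} = ∅ := by
        ext n; simp only [Set.mem_setOf_eq, Set.mem_empty_iff_false, iff_false]
        rintro ⟨x, y, h, -⟩; exact hk ⟨x, y, h⟩
      rw [pnum, this]; simp
  · rintro ⟨x, y, z, rfl, h1, h2⟩
    rw [pnum_eq, nc_ne]; exact ⟨z, h1, h2⟩

lemma kval_eq (i : ℕ × ℕ) (x : V) : kval G.adj i = Set.ncard {z : V | tdist G.adj x z = i} := by
  rw [kval, ← td_self G.adj x, pnum_eq]
  congr 1; ext z; simp only [Set.mem_setOf_eq]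
  constructor
  · exact fun h => h.1
  · exact fun h => ⟨h, td_swap'.2 h⟩

lemma kval_eq' (i : ℕ × ℕ) (x : V) : kval G.adj i = Set.ncard {z : V | tdist G.adj z x = i} := by
  rw [kval, ← td_self G.adj x, pnum_eq, G.comm]
  congr 1; ext z; simp only [Set.mem_setOf_eq]
  constructor
  · exact fun h => h.2
  · exact fun h => ⟨td_swap'.2 h, h⟩

lemma th2 {i : ℕ × ℕ} {x y z w : V} (h1 : tdist G.adj x w = i) (h2 : tdist G.adj w z = i.swap)
    (h3 : tdist G.adj z y = i) : tdist G.adj x y = i := by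
  have h := (G.thick (tdist G.adj x z) i).2
  rw [pnum_eq, kval_eq G i z] at h
  rcases h with h | h
  · exact absurd h (nc_ne.2 ⟨w, h1, h2⟩)
  · have := Set.eq_of_subset_of_ncard_le (t := {w : V | tdist G.adj z w = i})
      (fun w hw => td_swap'.1 hw.2) h.ge (Set.toFinite _)
    have hy : y ∈ {w : V | tdist G.adj z w = i} := h3
    rw [← this] at hy
    exact hy.1

lemma th1 {i : ℕ × ℕ} {x y z w : V} (h1 : tdist G.adj x w = i) (h2 : tdist G.adj w z = i)
    (h3 : tdist G.adj z y = i.swap) : tdist G.adj x y = i := by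
  have h := (G.thick (tdist G.adj x z) i).1
  rw [pnum_eq, kval_eq' G i z] at h
  rcases h with h | h
  · exact absurd h (nc_ne.2 ⟨w, h1, h2⟩)
  · have := Set.eq_of_subset_of_ncard_le (t := {w : V | tdist G.adj w z = i})
      (fun w hw => hw.2) h.ge (Set.toFinite _)
    have hy : y ∈ {w : V | tdist G.adj w z = i} := td_swap'.1 h3
    rw [← this] at hy
    exact hy.1

abbrev TT := {t : ℕ × ℕ // Attained G.adj t}

def mm (i j k : TT G) : Prop :=
  ∃ x y z : V, tdist G.adj x y = k.1 ∧ tdist G.adj x z = i.1 ∧ tdist G.adj z y = j.1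

lemma mm_comm {i j k : TT G} : mm G i j k → mm G j i k := by
  rintro ⟨x, y, z, h1, h2, h3⟩
  obtain ⟨w, w1, w2⟩ := wit_comm G h2 h3
  exact ⟨x, y, w, h1, w1, w2⟩

@[reducible] def hg (v : V) : HG (TT G) where
  e := ⟨(0, 0), v, v, td_self _ _⟩
  st a := ⟨a.1.swap, by obtain ⟨x, y, h⟩ := a.2; exact ⟨y, x, td_swap'.2 h⟩⟩
  m := mm G
  D a := a.1.1
  st_st a := rfl
  m_comm := mm_comm G
  m_assoc := by
    rintro i j a k l ⟨x, y, z, h1, h2, h3⟩ ⟨p, q, r, h4, h5, h6⟩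
    obtain ⟨w, w1, w2⟩ := wit G (h1.trans h5.symm) h2 h3
    exact ⟨⟨tdist G.adj w q, w, q, rfl⟩, ⟨w, q, r, rfl, w2, h6⟩, ⟨p, q, w, h4, w1, rfl⟩⟩
  m_e := by
    intro i k
    constructor
    · rintro ⟨x, y, z, h1, h2, h3⟩
      have : x = z := dd_zero G (congrArg Prod.fst h2)
      subst this
      exact Subtype.ext (h1.symm.trans h3)
    · rintro rfl
      obtain ⟨x, y, h⟩ := k.2
      exact ⟨x, y, x, h, td_self _ _, h⟩
  m_rev := by
    rintro i j k ⟨x, y, z, h1, h2, h3⟩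
    exact ⟨x, z, y, h2, h1, td_swap'.2 h3⟩
  m_star := by
    rintro i j k ⟨x, y, z, h1, h2, h3⟩
    exact mm_comm G ⟨y, x, z, td_swap'.2 h1, td_swap'.2 h3, td_swap'.2 h2⟩
  m_ex := by
    intro i j
    obtain ⟨x, z, h⟩ := i.2
    obtain ⟨u, w, h'⟩ := j.2
    obtain ⟨y, y1, -⟩ := wit G (x := u) (y := u) (z := w) (x' := z) (y' := z)
      (by rw [td_self, td_self]) h' rfl
    exact ⟨⟨tdist G.adj x y, x, y, rfl⟩, x, y, z, rfl, h, y1⟩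
  thick1 := by
    rintro i k l ⟨x, y, z, h1, h2, h3⟩ ⟨p, q, r, h4, h5, h6⟩
    obtain ⟨w, w1, w2⟩ := wit G (h1.trans h5.symm) h2 h3
    exact Subtype.ext (h4.symm.trans (th1 G w1 w2 h6))
  thick2 := by
    rintro i k l ⟨x, y, z, h1, h2, h3⟩ ⟨p, q, r, h4, h5, h6⟩
    obtain ⟨w, w1, w2⟩ := wit G (h1.trans h5.symm) h2 h3
    exact Subtype.ext (h4.symm.trans (th2 G w1 w2 h6))
  D_inj := by
    intro a b h1 h2
    exact Subtype.ext (Prod.ext h1 h2)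
  D_e := rfl
  D_zero := by
    intro a h
    obtain ⟨x, y, hxy⟩ := a.2
    have : x = y := dd_zero G (by have := congrArg Prod.fst hxy; exact this.trans h)
    subst this
    exact Subtype.ext (hxy.symm.trans (td_self _ _))
  D_tri := by
    rintro i j k ⟨x, y, z, h1, h2, h3⟩
    rw [← h1, ← h2, ← h3]
    exact dd_tri G x z y
  D_geo := by
    intro k n h
    obtain ⟨x, y, hxy⟩ := k.2
    rw [← hxy] at h
    obtain ⟨z, z1, z2⟩ := dd_geo G h
    exact ⟨⟨tdist G.adj x z, x, z, rfl⟩, ⟨tdist G.adj z y, z, y, rfl⟩, z1, z2,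
      x, y, z, hxy, rfl, rfl⟩

end
end W14


/-- Lemma 4.8: if `Γ_{1,p-1}^2 ∩ Γ_{1,h-1}Γ_{h-1,1} ≠ ∅` and
`Γ_{1,h-1}^2 ∩ Γ_{1,q-1}Γ_{q-1,1} ≠ ∅` with `q ≠ p` and `h > 2`, then
`Γ_{1,p-1}^2 ∩ Γ_{1,q-1}Γ_{q-1,1} ≠ ∅`. -/
theorem stmt14 {V : Type*} [Fintype V] (G : CTWDR V) (p q h : ℕ) (hpq : q ≠ p) (hh : 2 < h)
    (hp : Attained G.adj (1, p - 1)) (hq : Attained G.adj (1, q - 1))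
    (hhatt : Attained G.adj (1, h - 1))
    (h1 : (G.pow (1, p - 1) 2 ∩ G.prodS {(1, h - 1)} {(h - 1, 1)}).Nonempty)
    (h2 : (G.pow (1, h - 1) 2 ∩ G.prodS {(1, q - 1)} {(q - 1, 1)}).Nonempty) :
    (G.pow (1, p - 1) 2 ∩ G.prodS {(1, q - 1)} {(q - 1, 1)}).Nonempty := by
  have hp' := hp
  obtain ⟨v, -, -⟩ := hp
  letI : W14.HG (W14.TT G) := W14.hg G v
  obtain ⟨s, ⟨i, hi, j, hj, hs1⟩, i', hi', j', hj', hs2⟩ := h1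
  obtain ⟨t, ⟨k, hk, l, hl, ht1⟩, k', hk', l', hl', ht2⟩ := h2
  have hi : i = (1, p - 1) := hi
  have hk : k = (1, h - 1) := hk
  simp only [Set.mem_singleton_iff] at hj hi' hj' hl hk' hl'
  subst hi hj hi' hj' hk hl hk' hl'
  rw [W14.pnum_ne] at hs1 hs2 ht1 ht2
  have as : Attained G.adj s := by
    obtain ⟨x, y, z, h, -⟩ := hs1; exact ⟨x, y, h⟩
  have at' : Attained G.adj t := by
    obtain ⟨x, y, z, h, -⟩ := ht1; exact ⟨x, y, h⟩
  obtain ⟨x, hx1, hx2⟩ := W14.fin (T := W14.TT G) (A := ⟨(1, p - 1), hp'⟩) (H := ⟨(1, h - 1), hhatt⟩)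
    (Q := ⟨(1, q - 1), hq⟩) (cc := ⟨s, as⟩) (d := ⟨t, at'⟩) rfl rfl
    (show 2 ≤ h - 1 by omega) (W14.mem_cc.2 hs1) (W14.mem_cc.2 hs2) (W14.mem_cc.2 ht1)
    (W14.mem_cc.2 ht2)
  have y1 : W14.mm G _ _ _ := W14.mem_cc.1 hx1
  have y2 : W14.mm G _ _ _ := W14.mem_cc.1 hx2
  exact ⟨x.1, ⟨_, rfl, _, rfl, (W14.pnum_ne G _ _ _).2 y1⟩,
    ⟨_, rfl, _, rfl, (W14.pnum_ne G _ _ _).2 y2⟩⟩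
end

section
/- Let Γ be a commutative thick weakly distance-regular digraph with s < h, both in T = {t : (1,t-1) ∈ ∂̃(Γ)}, and suppose Γ_{1,h-1}^2 ∩ Γ_{1,s-1}Γ_{s-1,1} ≠ ∅. Then s = h-1 and (1,h-2) is pure. Moreover, if additionally Γ_{1,h-1} ∉ Γ_{1,s-1}Γ_{s-1,1}, then h+1 ∉ T. -/
/-!
Common framework: commutative thick weakly distance-regular digraphs.
-/

variable {V : Type*}

namespace CTWDR
section Cplx
variable {V : Type*} [Fintype V]

theorem dd_set (G : CTWDR V) (x y : V) : HasWalk G.adj x y (ddist G.adj x y) :=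
  Nat.sInf_mem (s := {n | HasWalk G.adj x y n}) (G.strong x y)

theorem dd_le (G : CTWDR V) {x y : V} {n : ℕ} (h : HasWalk G.adj x y n) : ddist G.adj x y ≤ n :=
  Nat.sInf_le h

theorem dd_zero (G : CTWDR V) {x y : V} (h : ddist G.adj x y = 0) : x = y := by
  obtain ⟨f, h0, h1, _⟩ := dd_set G x y
  rw [h] at h1
  rw [← h0, h1]

theorem dd_self (G : CTWDR V) (x : V) : ddist G.adj x x = 0 := by
  have : HasWalk G.adj x x 0 := ⟨fun _ => x, rfl, rfl, by simp⟩
  simpa using dd_le G this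

theorem dd_one (G : CTWDR V) {x y : V} : ddist G.adj x y = 1 ↔ G.adj x y := by
  constructor
  · intro h
    obtain ⟨f, h0, h1, h2⟩ := dd_set G x y
    rw [h] at h1 h2
    have := h2 0 (by simp)
    simpa [h0, h1] using this
  · intro h
    have h1 : HasWalk G.adj x y 1 := ⟨fun n => if n = 0 then x else y, by simp, by simp, by
      intro i hi
      have : i = 0 := by omega
      subst this; simpa using h⟩
    have h2 := dd_le G h1
    have h3 : ddist G.adj x y ≠ 0 := by
      intro h4
      have := dd_zero G h4
      subst this
      exact G.loopless _ h
    omega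

theorem td_swap (G : CTWDR V) (x y : V) : tdist G.adj y x = (tdist G.adj x y).swap := rfl

/-- invariant relations -/
@[ext] structure Cx (G : CTWDR V) where
  R : V → V → Prop
  inv : ∀ {x y x' y' : V}, tdist G.adj x y = tdist G.adj x' y' → R x y → R x' y'

variable {G : CTWDR V}

theorem exists_of_wdr {i j : ℕ × ℕ} {x y x' y' z : V} (h : tdist G.adj x y = tdist G.adj x' y')
    (h1 : tdist G.adj x z = i) (h2 : tdist G.adj z y = j) :
    ∃ z', tdist G.adj x' z' = i ∧ tdist G.adj z' y' = j := by
  have := G.wdr i j x y x' y' h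
  have h3 : Set.ncard {z : V | tdist G.adj x z = i ∧ tdist G.adj z y = j} ≠ 0 :=
    Set.ncard_ne_zero_of_mem (a := z) ⟨h1, h2⟩ (Set.toFinite _)
  rw [this] at h3
  obtain ⟨z', hz⟩ := Set.nonempty_of_ncard_ne_zero h3
  exact ⟨z', hz⟩

theorem exists_of_comm {i j : ℕ × ℕ} {x y z : V}
    (h1 : tdist G.adj x z = i) (h2 : tdist G.adj z y = j) :
    ∃ z', tdist G.adj x z' = j ∧ tdist G.adj z' y = i := by
  have := G.comm i j x y
  have h3 : Set.ncard {z : V | tdist G.adj x z = i ∧ tdist G.adj z y = j} ≠ 0 :=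
    Set.ncard_ne_zero_of_mem (a := z) ⟨h1, h2⟩ (Set.toFinite _)
  rw [this] at h3
  obtain ⟨z', hz⟩ := Set.nonempty_of_ncard_ne_zero h3
  exact ⟨z', hz⟩

theorem td_diag {x x' : V} : tdist G.adj x x = tdist G.adj x' x' := by
  simp [tdist, dd_self]

namespace Cx

instance : Mul (Cx G) := ⟨fun P Q => ⟨fun x y => ∃ z, P.R x z ∧ Q.R z y, by
  rintro x y x' y' h ⟨z, h1, h2⟩
  obtain ⟨z', h3, h4⟩ := exists_of_wdr h (rfl : tdist G.adj x z = _) (rfl : tdist G.adj z y = _)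
  exact ⟨z', P.inv h3.symm h1, Q.inv h4.symm h2⟩⟩⟩

instance : One (Cx G) := ⟨⟨fun x y => x = y, by
  rintro x y x' y' h rfl
  have h1 : ddist G.adj x' y' = 0 := by
    have := congrArg Prod.fst h
    simp only [tdist, dd_self] at this
    exact this.symm
  exact dd_zero G h1⟩⟩

instance : Add (Cx G) := ⟨fun P Q => ⟨fun x y => P.R x y ∨ Q.R x y, by
  rintro x y x' y' h (h1 | h1)
  · exact Or.inl (P.inv h h1)
  · exact Or.inr (Q.inv h h1)⟩⟩

instance : Zero (Cx G) := ⟨⟨fun _ _ => False, fun _ h => h⟩⟩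

theorem mul_R {P Q : Cx G} {x y : V} : (P * Q).R x y ↔ ∃ z, P.R x z ∧ Q.R z y := Iff.rfl
theorem one_R {x y : V} : (1 : Cx G).R x y ↔ x = y := Iff.rfl
theorem add_R {P Q : Cx G} {x y : V} : (P + Q).R x y ↔ P.R x y ∨ Q.R x y := Iff.rfl
theorem zero_R {x y : V} : (0 : Cx G).R x y ↔ False := Iff.rfl

theorem cx_mul_comm (P Q : Cx G) : P * Q = Q * P := by
  have key : ∀ (P Q : Cx G) x y, (P * Q).R x y → (Q * P).R x y := by
    rintro P Q x y ⟨z, h1, h2⟩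
    obtain ⟨z', h3, h4⟩ := exists_of_comm (rfl : tdist G.adj x z = _) (rfl : tdist G.adj z y = _)
    exact ⟨z', Q.inv h3.symm h2, P.inv h4.symm h1⟩
  ext x y
  exact ⟨key P Q x y, key Q P x y⟩

theorem cx_mul_assoc (P Q S : Cx G) : P * Q * S = P * (Q * S) := by
  ext x y
  simp only [mul_R]
  constructor
  · rintro ⟨z, ⟨w, h1, h2⟩, h3⟩; exact ⟨w, h1, z, h2, h3⟩
  · rintro ⟨w, h1, z, h2, h3⟩; exact ⟨z, ⟨w, h1, h2⟩, h3⟩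

theorem cx_one_mul (P : Cx G) : 1 * P = P := by
  ext x y
  simp [mul_R, one_R]

theorem cx_add_comm (P Q : Cx G) : P + Q = Q + P := by
  ext x y; simp [add_R, or_comm]

theorem cx_zero_add (P : Cx G) : 0 + P = P := by
  ext x y; simp [add_R, zero_R]

theorem cx_mul_add (P Q S : Cx G) : P * (Q + S) = P * Q + P * S := by
  ext x y
  simp only [mul_R, add_R, and_or_left, exists_or]

theorem cx_zero_mul (P : Cx G) : 0 * P = 0 := by
  ext x y; simp [mul_R, zero_R]

instance : CommSemiring (Cx G) where
  add_assoc P Q S := by ext x y; simp [add_R, or_assoc]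
  zero_add := cx_zero_add
  add_zero P := by rw [cx_add_comm, cx_zero_add]
  add_comm := cx_add_comm
  nsmul := nsmulRec
  mul_assoc := cx_mul_assoc
  one_mul := cx_one_mul
  mul_one P := by rw [cx_mul_comm, cx_one_mul]
  mul_comm := cx_mul_comm
  left_distrib := cx_mul_add
  right_distrib P Q S := by rw [cx_mul_comm, cx_mul_add, cx_mul_comm S P, cx_mul_comm S Q]
  zero_mul := cx_zero_mul
  mul_zero P := by rw [cx_mul_comm, cx_zero_mul]

instance : PartialOrder (Cx G) where
  le P Q := ∀ x y, P.R x y → Q.R x y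
  le_refl P x y h := h
  le_trans P Q S h1 h2 x y h := h2 x y (h1 x y h)
  le_antisymm P Q h1 h2 := by ext x y; exact ⟨h1 x y, h2 x y⟩

instance : IsOrderedMonoid (Cx G) where
  mul_le_mul_left P Q h S := by
    rintro x y ⟨z, h1, h2⟩
    exact ⟨z, h _ _ h1, h2⟩
  mul_le_mul_right P Q h S := by
    rintro x y ⟨z, h1, h2⟩
    exact ⟨z, h1, h _ _ h2⟩

/-- converse -/
def st (P : Cx G) : Cx G := ⟨fun x y => P.R y x, by
  intro x y x' y' h h1
  refine P.inv ?_ h1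
  rw [td_swap G x y, h, ← td_swap]⟩

theorem st_R {P : Cx G} {x y : V} : (st P).R x y ↔ P.R y x := Iff.rfl
theorem st_st (P : Cx G) : st (st P) = P := rfl
theorem st_mono {P Q : Cx G} (h : P ≤ Q) : st P ≤ st Q := fun x y h1 => h y x h1
theorem st_mul (P Q : Cx G) : st (P * Q) = st P * st Q := by
  rw [mul_comm]
  ext x y
  simp only [mul_R, st_R]
  exact ⟨fun ⟨z, h1, h2⟩ => ⟨z, h2, h1⟩, fun ⟨z, h1, h2⟩ => ⟨z, h2, h1⟩⟩
theorem st_one : st (1 : Cx G) = 1 := by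
  ext x y; simp [st_R, one_R, eq_comm]
theorem st_pow (P : Cx G) (n : ℕ) : st (P ^ n) = st P ^ n := by
  induction n with
  | zero => simp [st_one]
  | succ n ih => rw [pow_succ, pow_succ, st_mul, ih]
theorem one_le_st {P : Cx G} (h : 1 ≤ P) : 1 ≤ st P := by
  rw [← st_one]; exact st_mono h

theorem one_le_of {P : Cx G} {x : V} (h : P.R x x) : 1 ≤ P := by
  rintro y z rfl
  exact P.inv td_diag h

variable (G) in
/-- basic relation -/
def rel (i : ℕ × ℕ) : Cx G := ⟨fun x y => tdist G.adj x y = i, fun h h1 => h ▸ h1⟩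

theorem rel_R {i : ℕ × ℕ} {x y : V} : (rel G i).R x y ↔ tdist G.adj x y = i := Iff.rfl

theorem rel_le {P : Cx G} {x y : V} (h : P.R x y) : rel G (tdist G.adj x y) ≤ P := by
  intro x' y' h'
  exact P.inv h'.symm h

theorem at1 [Nonempty V] {i : ℕ × ℕ} {Q : Cx G} (h : 1 ≤ rel G i * Q) : st (rel G i) ≤ Q := by
  obtain ⟨x⟩ := ‹Nonempty V›
  obtain ⟨y, h1, h2⟩ := h x x rfl
  intro x' y' h'
  refine Q.inv ?_ h2
  rw [st_R, rel_R] at h'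
  rw [rel_R] at h1
  rw [td_swap G x y, td_swap G y' x', h', h1]

theorem at2 [Nonempty V] {i : ℕ × ℕ} {Q : Cx G} (h : 1 ≤ st (rel G i) * Q) : rel G i ≤ Q := by
  obtain ⟨x⟩ := ‹Nonempty V›
  obtain ⟨y, h1, h2⟩ := h x x rfl
  intro x' y' h'
  refine Q.inv ?_ h2
  rw [rel_R] at h'
  rw [st_R, rel_R] at h1
  rw [h', h1]

theorem rel_eq [Nonempty V] {i j : ℕ × ℕ} (h : 1 ≤ rel G i * st (rel G j)) : i = j := by
  obtain ⟨x⟩ := ‹Nonempty V›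
  obtain ⟨y, h1, h2⟩ := h x x rfl
  rw [st_R, rel_R] at h2
  rw [rel_R] at h1
  rw [← h1, ← h2]

theorem pnum_eq {h i j : ℕ × ℕ} {x y : V} (hxy : tdist G.adj x y = h) :
    pnum G.adj h i j = Set.ncard {z : V | tdist G.adj x z = i ∧ tdist G.adj z y = j} := by
  unfold pnum
  have : {n | ∃ x y : V, tdist G.adj x y = h ∧
    n = Set.ncard {z : V | tdist G.adj x z = i ∧ tdist G.adj z y = j}} =
    {Set.ncard {z : V | tdist G.adj x z = i ∧ tdist G.adj z y = j}} := by
    ext n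
    simp only [Set.mem_setOf_eq, Set.mem_singleton_iff]
    constructor
    · rintro ⟨x', y', h1, h2⟩
      rw [h2]
      exact G.wdr i j _ _ _ _ (h1.trans hxy.symm)
    · intro h'
      exact ⟨x, y, hxy, h'⟩
  rw [this, csSup_singleton]

theorem pnum_ne {h i j : ℕ × ℕ} (hp : pnum G.adj h i j ≠ 0) :
    ∃ x y z : V, tdist G.adj x y = h ∧ tdist G.adj x z = i ∧ tdist G.adj z y = j := by
  by_cases hh : ∃ x y : V, tdist G.adj x y = h
  · obtain ⟨x, y, hxy⟩ := hh
    rw [pnum_eq hxy] at hp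
    obtain ⟨z, hz⟩ := Set.nonempty_of_ncard_ne_zero hp
    exact ⟨x, y, z, hxy, hz⟩
  · exfalso; apply hp
    unfold pnum
    have : {n | ∃ x y : V, tdist G.adj x y = h ∧
      n = Set.ncard {z : V | tdist G.adj x z = i ∧ tdist G.adj z y = j}} = ∅ := by
      ext n
      simp only [Set.mem_setOf_eq, Set.mem_empty_iff_false, iff_false]
      rintro ⟨x, y, h1, _⟩
      exact hh ⟨x, y, h1⟩
    rw [this]; simp

theorem thick_le (i : ℕ × ℕ) : rel G i * st (rel G i) * rel G i ≤ rel G i := by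
  rintro x y ⟨w, ⟨z, h1, h2⟩, h3⟩
  rw [rel_R] at *
  rw [st_R, rel_R] at h2
  have hz : tdist G.adj z w = i.swap := by rw [td_swap G w z, h2]
  have h4 := (G.thick (tdist G.adj x w) i).2
  rw [kval, pnum_eq (rfl : tdist G.adj x w = _),
    pnum_eq (by simp [tdist, dd_self] : tdist G.adj w w = (0, 0))] at h4
  have h5 : Set.ncard {z : V | tdist G.adj x z = i ∧ tdist G.adj z w = i.swap} ≠ 0 :=
    Set.ncard_ne_zero_of_mem (a := z) ⟨h1, hz⟩ (Set.toFinite _)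
  have h6 := h4.resolve_left h5
  have h7 : {z : V | tdist G.adj x z = i ∧ tdist G.adj z w = i.swap} =
      {z : V | tdist G.adj w z = i ∧ tdist G.adj z w = i.swap} := by
    apply Set.eq_of_subset_of_ncard_le _ h6.symm.le (Set.toFinite _)
    rintro u ⟨_, hu⟩
    refine ⟨?_, hu⟩
    rw [td_swap G u w, hu, Prod.swap_swap]
  have h8 : y ∈ {z : V | tdist G.adj w z = i ∧ tdist G.adj z w = i.swap} :=
    ⟨h3, by rw [td_swap G w y, h3]⟩
  rw [← h7] at h8
  exact h8.1

theorem thick_eq (i : ℕ × ℕ) : rel G i * st (rel G i) * rel G i = rel G i := by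
  apply le_antisymm (thick_le i)
  intro x y h
  exact ⟨x, ⟨y, h, h⟩, h⟩

variable (G) in
/-- arcs -/
def A : Cx G := ⟨fun x y => ddist G.adj x y = 1, fun h h1 => by
  have := congrArg Prod.fst h
  simp only [tdist] at this
  omega⟩

theorem A_R {x y : V} : (A G).R x y ↔ ddist G.adj x y = 1 := Iff.rfl

theorem A_pow {n : ℕ} {x y : V} : (A G ^ n).R x y ↔ HasWalk G.adj x y n := by
  induction n generalizing y with
  | zero =>
    simp only [pow_zero, one_R]
    constructor
    · rintro rfl; exact ⟨fun _ => x, rfl, rfl, by simp⟩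
    · rintro ⟨f, h0, h1, _⟩; rw [← h0, h1]
  | succ n ih =>
    rw [pow_succ, mul_R]
    constructor
    · rintro ⟨z, h1, h2⟩
      obtain ⟨f, h3, h4, h5⟩ := ih.1 h1
      rw [A_R, dd_one] at h2
      refine ⟨fun k => if k ≤ n then f k else y, by simp [h3], by simp, ?_⟩
      intro i hi
      by_cases hin : i = n
      · subst hin; simp [h4, h2]
      · have h6 : i + 1 ≤ n := by omega
        have h7 : i ≤ n := by omega
        simp only [h6, h7, if_true]
        exact h5 i (by omega)
    · rintro ⟨f, h0, h1, h2⟩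
      refine ⟨f n, ih.2 ⟨f, h0, rfl, fun i hi => h2 i (by omega)⟩, ?_⟩
      rw [A_R, dd_one, ← h1]
      exact h2 n (by omega)

theorem dd_le_of {n : ℕ} {x y : V} (h : (A G ^ n).R x y) : ddist G.adj x y ≤ n :=
  dd_le G (A_pow.1 h)

theorem A_dd (x y : V) : (A G ^ (ddist G.adj x y)).R x y := A_pow.2 (dd_set G x y)

variable (G) in
/-- arcs of type `(1,t-1)` -/
def K (t : ℕ) : Cx G := rel G (1, t - 1)

theorem K_R {t : ℕ} {x y : V} : (K G t).R x y ↔ tdist G.adj x y = (1, t - 1) := Iff.rfl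

theorem A_type {x y : V} (h : (A G).R x y) : ∃ t, 2 ≤ t ∧ (K G t).R x y := by
  refine ⟨ddist G.adj y x + 1, ?_, ?_⟩
  · have : ddist G.adj y x ≠ 0 := by
      intro h1
      have := dd_zero G h1
      subst this
      rw [A_R, dd_self] at h
      omega
    omega
  · rw [K_R, tdist, A_R.1 h]; simp

theorem K_le_A (t : ℕ) : K G t ≤ A G := by
  intro x y h
  have := congrArg Prod.fst (K_R.1 h)
  exact this

theorem stK_le (t : ℕ) : st (K G t) ≤ A G ^ (t - 1) := by
  intro x y h
  rw [st_R, K_R] at h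
  have := congrArg Prod.snd h
  simp only [tdist] at this
  rw [← this]
  exact A_dd x y

theorem LEN [Nonempty V] {t k : ℕ} {Q : Cx G} (h : 1 ≤ K G t * Q) (hQ : Q ≤ A G ^ k) : t - 1 ≤ k := by
  obtain ⟨x⟩ := ‹Nonempty V›
  obtain ⟨y, h1, h2⟩ := h x x rfl
  have h3 := dd_le_of (hQ _ _ h2)
  have := congrArg Prod.snd (K_R.1 h1)
  simp only [tdist] at this
  omega

/-- Extraction of a typed pair. -/
theorem EX [Nonempty V] {P Q : Cx G} (h : 1 ≤ P * Q) : ∃ i : ℕ × ℕ, rel G i ≤ P ∧ st (rel G i) ≤ Q ∧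
    1 ≤ rel G i * st (rel G i) ∧ (∀ k, P ≤ A G ^ k → i.1 ≤ k) ∧ (∀ k, Q ≤ A G ^ k → i.2 ≤ k) ∧
    rel G i ≤ A G ^ i.1 ∧ st (rel G i) ≤ A G ^ i.2 ∧ (i.1 = 0 → 1 ≤ P) := by
  obtain ⟨x⟩ := ‹Nonempty V›
  obtain ⟨y, h1, h2⟩ := h x x rfl
  refine ⟨tdist G.adj x y, rel_le h1, ?_, ?_, ?_, ?_, ?_, ?_, ?_⟩
  · exact st_mono (rel_le (P := st Q) h2)
  · exact one_le_of (x := x) ⟨y, rfl, rfl⟩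
  · intro k hk
    exact dd_le_of (hk _ _ h1)
  · intro k hk
    exact dd_le_of (hk _ _ h2)
  · exact rel_le (A_dd x y)
  · exact st_mono (rel_le (P := st _) (A_dd y x))
  · intro h0
    have := dd_zero G h0
    subst this
    exact one_le_of h1


end Cx
end Cplx
end CTWDR

namespace CTWDR
section Arcs
set_option linter.unusedSectionVars false
variable {V : Type*} [Fintype V] {G : CTWDR V}
open Cx

/-- the relation `Γ_{a,b}` -/
def Rr (G : CTWDR V) (a b : ℕ) : Cx G := rel G (a, b)

/-- a type of arcs -/
@[ext] structure Arc (G : CTWDR V) where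
  t : ℕ
  two : 2 ≤ t
  att : 1 ≤ rel G (1, t - 1) * rel G (t - 1, 1)

/-- arcs of given type -/
def Arc.k (d : Arc G) : Cx G := rel G (1, d.t - 1)
/-- converse arcs -/
def Arc.s (d : Arc G) : Cx G := rel G (d.t - 1, 1)

class Len (P : Cx G) (n : outParam ℕ) : Prop where
  le : P ≤ A G ^ n

theorem st_rel (a b : ℕ) : st (rel G (a, b)) = rel G (b, a) := by
  ext x y
  rw [st_R, rel_R, rel_R, td_swap G x y]
  constructor
  · intro h; rw [← Prod.swap_swap (tdist G.adj x y), h]; rfl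
  · intro h; rw [h]; rfl

theorem st_Rr (a b : ℕ) : st (Rr G a b) = Rr G b a := st_rel a b
theorem st_k (d : Arc G) : st d.k = d.s := st_rel _ _
theorem st_s (d : Arc G) : st d.s = d.k := st_rel _ _

theorem rel_le_A (a b : ℕ) : rel G (a, b) ≤ A G ^ a := by
  intro x y h
  have := congrArg Prod.fst h
  simp only [tdist] at this
  rw [← this]
  exact A_dd x y

instance (a b : ℕ) : Len (Rr G a b) a := ⟨rel_le_A a b⟩
instance (d : Arc G) : Len d.k 1 := ⟨rel_le_A _ _⟩
instance (d : Arc G) : Len d.s (d.t - 1) := ⟨rel_le_A _ _⟩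
instance : Len (A G) 1 := ⟨by simp⟩
instance {P Q : Cx G} {k l : ℕ} [hP : Len P k] [hQ : Len Q l] : Len (P * Q) (k + l) :=
  ⟨by rw [pow_add]; exact mul_le_mul' hP.le hQ.le⟩
instance {P : Cx G} {k n : ℕ} [hP : Len P k] : Len (P ^ n) (k * n) :=
  ⟨by rw [pow_mul]; exact pow_le_pow_left' hP.le n⟩
instance : Len (1 : Cx G) 0 := ⟨by simp⟩

theorem rep {Y Z P Q : Cx G} (h : 1 ≤ Y) (hPQ : P ≤ Q) (X : Cx G)
    (e1 : Y = P * X := by ring) (e2 : Z = Q * X := by ring) : 1 ≤ Z := by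
  rw [e2]; rw [e1] at h
  exact h.trans (mul_le_mul' hPQ le_rfl)

/-- transitivity with substitution -/
theorem lep {B Y Z P Q : Cx G} (h : B ≤ Y) (hPQ : P ≤ Q) (X : Cx G)
    (e1 : Y = P * X := by ring) (e2 : Z = Q * X := by ring) : B ≤ Z := by
  rw [e2]; rw [e1] at h
  exact h.trans (mul_le_mul' hPQ le_rfl)

theorem lep0 {B Y P Q : Cx G} (h : B ≤ Y) (hPQ : P ≤ Q) (X : Cx G)
    (e1 : Y = P * X := by ring) : B ≤ Q * X := by
  rw [e1] at h
  exact h.trans (mul_le_mul' hPQ le_rfl)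

theorem rng {B Y Z : Cx G} (h : B ≤ Y) (e1 : Y = Z := by ring) : B ≤ Z := e1 ▸ h

theorem flp {P Q Q' : Cx G} (h : P ≤ Q) {P' : Cx G}
    (e1 : st P = P' := by simp only [st_mul, st_pow, st_k, st_s, st_Rr, st_one])
    (e2 : st Q = Q' := by simp only [st_mul, st_pow, st_k, st_s, st_Rr, st_one] <;> ring) : P' ≤ Q' := by
  rw [← e1, ← e2]; exact st_mono h

variable [Nonempty V]
namespace Arc
variable (d e r : Arc G)

theorem one : 1 ≤ d.k * d.s := d.att
theorem th : d.k * d.s * d.k ≤ d.k := by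
  have := thick_le (G := G) (1, d.t - 1)
  rwa [st_rel] at this
theorem th' : d.s * d.k * d.s ≤ d.s := flp d.th

variable {d e r}

theorem a1 {Y : Cx G} (h : 1 ≤ Y) (d : Arc G) (Q : Cx G) (e1 : Y = d.k * Q := by ring) : d.s ≤ Q := by
  rw [e1] at h
  have := at1 h
  rwa [st_rel] at this
theorem a2 {Y : Cx G} (h : 1 ≤ Y) (d : Arc G) (Q : Cx G) (e1 : Y = d.s * Q := by ring) : d.k ≤ Q := by
  rw [e1] at h
  have h2 : 1 ≤ st (rel G (1, d.t - 1)) * Q := by rw [st_rel]; exact h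
  exact at2 h2

theorem eqt (h : d.t = e.t) : d = e := by
  cases d; cases e; simp_all

theorem eqs {Y : Cx G} (h : 1 ≤ Y) (d e : Arc G) (e1 : Y = d.k * e.s := by ring) : d = e := by
  rw [e1] at h
  have h2 : 1 ≤ rel G (1, d.t - 1) * st (rel G (1, e.t - 1)) := by rw [st_rel]; exact h
  have h3 := rel_eq h2
  have := d.two
  have := e.two
  simp only [Prod.mk.injEq, true_and] at h3
  exact eqt (by omega)

theorem len {Y : Cx G} (h : 1 ≤ Y) (d : Arc G) (Q : Cx G) {k : ℕ} [hQ : Len Q k]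
    (e1 : Y = d.k * Q := by ring) :
    d.t ≤ k + 1 := by
  rw [e1] at h
  have := LEN (t := d.t) (k := k) (Q := Q) h hQ.le
  omega

/-- pure -/
def P (d : Arc G) : Prop := ∀ r : Arc G, 1 ≤ d.k * r.k * A G ^ (d.t - 2) → r = d

theorem leA {Y Z : Cx G} {k : ℕ} [hP : Len Z k] (h : 1 ≤ Y) (X : Cx G)
   (e1 : Y = Z * X := by ring) : 1 ≤ A G ^ k * X := by
  subst e1; exact rep h hP.le X

theorem pu {Y : Cx G} (hd : d.P) (h : 1 ≤ Y) (r : Arc G) (Q : Cx G) {k : ℕ} [hQ : Len Q k]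
    (hk : k + 2 ≤ d.t) (e1 : Y = d.k * r.k * Q := by ring) : r = d := by
  subst e1
  have h1 := len h d (r.k * Q)
  have h2 : k = d.t - 2 := by omega
  subst h2
  exact hd r (rep h hQ.le (d.k * r.k))

theorem exA {x y : V} (h : (A G).R x y) : ∃ r : Arc G, r.k.R x y := by
  obtain ⟨t, h2, h3⟩ := A_type h
  rw [K_R] at h3
  refine ⟨⟨t, h2, ?_⟩, h3⟩
  refine one_le_of (x := x) ⟨y, h3, ?_⟩
  rw [rel_R, td_swap G x y, h3]; rfl


end Arc

theorem peel {Y : Cx G} (h : 1 ≤ Y) (X : Cx G) (n : ℕ) (e1 : Y = X * A G ^ (n + 1) := by ring) :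
    ∃ r : Arc G, 1 ≤ X * r.k * A G ^ n := by
  obtain ⟨x⟩ := ‹Nonempty V›
  rw [e1, pow_succ', ← mul_assoc] at h
  obtain ⟨z, ⟨w, h1, h2⟩, h3⟩ := h x x rfl
  obtain ⟨r, hr⟩ := Arc.exA h2
  exact ⟨r, one_le_of (x := x) ⟨z, ⟨w, h1, hr⟩, h3⟩⟩

/-- extraction -/
theorem EXT {Y P Q : Cx G} {k l : ℕ} (h : 1 ≤ Y) [hP : Len P k] [hQ : Len Q l]
    (e1 : Y = P * Q := by ring) :
    ∃ a b, a ≤ k ∧ b ≤ l ∧ 1 ≤ Rr G a b * Rr G b a ∧ Rr G a b ≤ P ∧ Rr G b a ≤ Q ∧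
      (a = 0 → 1 ≤ P) ∧ (a = 1 → ∃ e : Arc G, e.t = b + 1 ∧ e.k = Rr G a b ∧ e.s = Rr G b a) := by
  rw [e1] at h
  obtain ⟨⟨a, b⟩, h1, h2, h3, h4, h5, h6, h7, h8⟩ := EX h
  rw [st_rel] at *
  refine ⟨a, b, h4 _ hP.le, h5 _ hQ.le, h3, h1, h2, h8, ?_⟩
  rintro rfl
  have hb : b ≠ 0 := by
    rintro rfl
    obtain ⟨x⟩ := ‹Nonempty V›
    obtain ⟨y, h9, h10⟩ := h3 x x rfl
    have e1 := congrArg Prod.fst (rel_R.1 h9)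
    have e2 := congrArg Prod.fst (rel_R.1 h10)
    simp only [tdist] at e1 e2
    have := dd_zero G e2
    subst this
    rw [dd_self] at e1
    omega
  exact ⟨⟨b + 1, by omega, h3⟩, rfl, rfl, rfl⟩

theorem meet {a b : ℕ} {Z P Q : Cx G} (o : 1 ≤ Rr G a b * Rr G b a) (h1 : Rr G a b ≤ P)
    (h2 : Rr G a b ≤ Q)
    (e : P * st Q = Z := by simp only [st_mul, st_pow, st_k, st_s, st_Rr, st_one] <;> ring) : 1 ≤ Z := by
  rw [← e]
  refine o.trans (mul_le_mul' h1 ?_)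
  rw [← st_Rr]; exact st_mono h2

theorem meetK {Z P Q : Cx G} (d : Arc G) (h1 : d.k ≤ P)
    (h2 : d.k ≤ Q)
    (e : P * st Q = Z := by simp only [st_mul, st_pow, st_k, st_s, st_Rr, st_one] <;> ring) : 1 ≤ Z :=
  meet d.att h1 h2 e

/-- the two alternatives of the classification -/
def Alt (x y : Arc G) (Q : Cx G) (b : ℕ) : Prop :=
    ((∃ e : Arc G, e.t = b + 1 ∧ e.k ≤ x.k * y.k ∧ e.s ≤ Q) ∨
      (1 ≤ Rr G 2 b * Rr G b 2 ∧ Rr G 2 b ≤ x.k * y.k ∧ Rr G b 2 ≤ Q))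

theorem meet' {a b : ℕ} {Z P Q : Cx G} (o : 1 ≤ Rr G a b * Rr G b a) (h1 : Rr G a b ≤ P)
    (h2 : Rr G b a ≤ Q) (e : P * Q = Z := by ring) : 1 ≤ Z := by
  rw [← e]
  exact o.trans (mul_le_mul' h1 h2)

/-- the workhorse -/
theorem EX2 {Y Q : Cx G} {l : ℕ} (x y : Arc G) (h : 1 ≤ Y) [hQ : Len Q l]
    (hxy : 3 ≤ x.t ∨ 3 ≤ y.t) (e1 : Y = x.k * y.k * Q := by ring) :
    ∃ b, b ≤ l ∧ x.t ≤ b + 2 ∧ y.t ≤ b + 2 ∧ 1 ≤ x.k * y.k * A G ^ b ∧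
    Alt x y Q b := by
  obtain ⟨a, b, h1, h2, h3, h4, h5, h6, h7⟩ := EXT (P := x.k * y.k) (Q := Q) h e1
  have h8 : 1 ≤ x.k * y.k * Rr G b a := rep h3 h4 (Rr G b a)
  have h9 := Arc.len h8 x (y.k * Rr G b a)
  have h10 := Arc.len h8 y (x.k * Rr G b a)
  have h13 : Rr G b a ≤ A G ^ b := rel_le_A _ _
  refine ⟨b, h2, by omega, by omega, rep h8 h13 (x.k * y.k), ?_⟩
  have : a = 0 ∨ a = 1 ∨ a = 2 := by omega
  rcases this with rfl | rfl | rfl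
  · exfalso
    have := h6 rfl
    have h11 := Arc.len this x y.k
    have h12 := Arc.len this y x.k
    omega
  · obtain ⟨e, he1, he2, he3⟩ := h7 rfl
    exact Or.inl ⟨e, he1, he2 ▸ h4, he3 ▸ h5⟩
  · exact Or.inr ⟨h3, h4, h5⟩

namespace Arc
variable {d e r : Arc G}

theorem Fpow (m : ℕ) : d.k ^ (m + 1) * d.s ^ (m + 1) ≤ d.k * d.s := by
  induction m with
  | zero => simp
  | succ m ih =>
    exact lep (lep0 (le_refl _) ih (d.k * d.s)) d.th d.s

/-- `e² = F_e r` -/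
theorem sq (h : r.k ≤ e.k * e.k) : e.k * e.k ≤ e.k * e.s * r.k := by
  have h1 : r.s ≤ e.s * e.s := flp h
  have h2 : e.k * e.k ≤ e.k * e.k * (r.k * r.s) := le_mul_of_one_le_right' r.one
  have h3 : e.k * e.k ≤ e.k * e.k * (r.k * (e.s * e.s)) := lep h2 h1 (e.k * e.k * r.k)
  exact lep h3 e.th (e.s * r.k)

theorem sqF (h : r.k ≤ e.k * e.k) : r.k * r.s ≤ e.k * e.s := by
  have h1 : r.s ≤ e.s * e.s := flp h
  exact lep (mul_le_mul' h h1) e.th e.s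

/-- `r ≤ F_e → F_r ≤ F_e` -/
theorem inF (h : r.k ≤ e.k * e.s) : r.k * r.s ≤ e.k * e.s := by
  have h1 : r.s ≤ e.s * e.k := flp h
  exact lep (mul_le_mul' h h1) e.th e.s

theorem two' (h : d = e) : d.t = e.t := by rw [h]

/-- `f ≤ f a → a ≤ F_f` -/
theorem abs (h : e.k ≤ e.k * r.k) : r.k ≤ e.k * e.s := by
  have h1 : 1 ≤ e.s * (e.k * r.k) := rep e.one h e.s
  exact flp (a1 h1 r (e.k * e.s))

theorem not1 (h : 1 ≤ e.k) : False := by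
  have h1 := len h e 1
  have := e.two
  omega

theorem notF (h : e.k ≤ e.k * e.s) : False := by
  have h1 : 1 ≤ e.k * e.s * e.s := rep e.one h e.s
  have h2 : e.k * e.s * e.s ≤ e.s := lep (le_refl _) e.th' 1
  exact not1 (e := e) (flp (h1.trans h2))

theorem nosq (h : e.k ≤ e.k * e.k) : False := notF (abs h)

theorem not2 {Y : Cx G} (h : 1 ≤ Y) (d e : Arc G) (hd : 3 ≤ d.t) (e1 : Y = d.k * e.k := by ring) : False := by
  subst e1
  have := len h d e.k
  omega

theorem ppow (hd : d.P) : 1 ≤ d.k ^ d.t := by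
  have h0 : ∀ j, j + 1 ≤ d.t → 1 ≤ d.k ^ (j + 1) * A G ^ (d.t - (j + 1)) := by
    intro j
    induction j with
    | zero =>
      intro _
      have h1 : (d.s) ≤ A G ^ (d.t - 1) := rel_le_A _ _
      exact rep d.one h1 d.k
    | succ j ih =>
      intro h2
      have h3 := ih (by omega)
      have h4 : d.t - (j + 1) = (d.t - (j + 1 + 1)) + 1 := by omega
      rw [h4] at h3
      obtain ⟨r, hr⟩ := peel h3 (d.k ^ (j + 1)) _ rfl
      have := pu hd hr r (d.k ^ j * A G ^ (d.t - (j + 1 + 1))) (by omega)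
      subst this
      exact rng hr
  have h1 := h0 (d.t - 1) (by have := d.two; omega)
  have h2 : d.t - 1 + 1 = d.t := by have := d.two; omega
  rw [h2] at h1
  simpa using h1

theorem pS {n : ℕ} (hd : d.P) (hn : d.t = n + 1) : d.s ≤ d.k ^ n := by
  have h := ppow hd
  rw [hn] at h
  exact a1 h d _

theorem pS' {n : ℕ} (hd : d.P) (hn : d.t = n + 1) : d.k ^ n ≤ d.s := by
  have h := pS hd hn
  have h1 : d.k ≤ d.s ^ n := flp h
  have hn' : ∃ m, n = m + 1 := ⟨n - 1, by have := d.two; omega⟩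
  obtain ⟨m, rfl⟩ := hn'
  have h2 : d.k ^ (m + 1) ≤ d.k ^ (m + 1) * (d.k * d.s) := le_mul_of_one_le_right' d.one
  have h3 : d.k ^ (m + 1) ≤ d.k ^ (m + 1) * (d.s ^ (m + 1) * d.s) := lep h2 h1 (d.k ^ (m + 1) * d.s)
  exact lep (lep0 h3 (Fpow m) d.s) d.th' 1

theorem pF {n : ℕ} (hd : d.P) (hn : d.t = n + 1) : d.k ^ (n + 1) ≤ d.k * d.s :=
  lep (le_refl _) (pS' hd hn) d.k

end Arc
end Arcs
end CTWDR

namespace CTWDR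
section Part1
set_option linter.unusedSectionVars false
variable {V : Type*} [Fintype V] {G : CTWDR V} [Nonempty V]
open Cx

theorem part1 (c e : Arc G) (hlt : c.t < e.t) (h : 1 ≤ e.k * e.k * (c.k * c.s)) :
    e.t = c.t + 1 := by
  have hc := c.two
  have l1 := Arc.len h e (e.k * (c.k * c.s))
  by_contra hne
  have ht : e.t = c.t + 2 := by omega
  obtain ⟨b, b1, b2, b3, -, hl⟩ := EX2 e e h (Q := c.k * c.s) (by omega)
  have hb : b = c.t := by omega
  subst hb
  obtain ⟨b', b1', b2', b3', -, hec⟩ := EX2 e c h (Q := c.s * e.k) (by omega)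
  have hb : b' = c.t := by omega
  subst hb
  rcases hec with ⟨f, f1, f2, f3⟩ | ⟨o, hE, hE'⟩
  · have h1 : 1 ≤ f.k * (c.s * e.k) := rep f.one f3 f.k
    have := Arc.len h1 e (f.k * c.s)
    omega
  rcases hl with ⟨p, p1, p2, p3⟩ | ⟨_, hl, hl'⟩
  swap
  · have h1 : 1 ≤ e.k * c.k * (c.k * c.s) := meet' o hE hl'
    have h2 : 1 ≤ e.k * c.k := rep h1 c.th e.k
    exact Arc.not2 h2 e c (by omega)
  have hp : p.k ≤ c.k * c.s := flp p3
  have h1 : 1 ≤ p.k * p.k * (p.s * p.s) := rng (one_le_mul p.one p.one)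
  have h2 : 1 ≤ p.k * p.k * (c.k * c.s * p.s) := rep h1 p3 (p.k * p.k * p.s)
  have h3 : 1 ≤ p.k * p.k * (c.k * c.s * (c.k * c.s)) := rep h2 p3 (p.k * p.k * (c.k * c.s))
  have h4 : 1 ≤ p.k * p.k * (c.k * c.s) := rep h3 c.th (p.k * p.k * c.s)
  obtain ⟨b, b1, b2, b3, h5, hl⟩ := EX2 p p h4 (Q := c.k * c.s) (by omega)
  have hb : b = c.t ∨ b = c.t - 1 := by omega
  rcases hb with rfl | rfl
  · rcases hl with ⟨f, f1, f2, f3⟩ | ⟨o', hP, hP'⟩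
    · have : f = p := Arc.eqt (by omega)
      subst this
      exact Arc.nosq f2
    · have h1 : 1 ≤ e.k * c.k * (c.k * c.s) := meet' o hE hP'
      have h2 : 1 ≤ e.k * c.k := rep h1 c.th e.k
      exact Arc.not2 h2 e c (by omega)
  have h6 : 1 ≤ p.k * e.k * (e.k * A G ^ (c.t - 1)) := rep h5 p2 (p.k * A G ^ (c.t - 1))
  obtain ⟨b, b1, b2, b3, -, hl⟩ := EX2 p e h6 (Q := e.k * A G ^ (c.t - 1)) (by omega)
  have hb : b = c.t := by omega
  subst hb
  rcases hl with ⟨f, f1, f2, f3⟩ | ⟨o', hP, hP'⟩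
  · have : f = p := Arc.eqt (by omega)
    subst this
    have h7 := (Arc.abs f2).trans (Arc.inF hp)
    have h8 : e.s ≤ c.k * c.s := flp h7
    have h9 : 1 ≤ e.k * (c.k * c.s) := rep e.one h8 e.k
    have := Arc.len h9 e (c.k * c.s)
    omega
  · have h7 : 1 ≤ p.k * e.k * e.s * c.s := meet o hP hE
    have h8 : 1 ≤ c.k * c.s * e.k * e.s * c.s := rep h7 hp (e.k * e.s * c.s)
    have h9 : 1 ≤ c.s * (e.k * e.s) := rep h8 c.th' (e.k * e.s)
    have h10 := Arc.a2 h9 c (e.k * e.s)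
    have h11 : 1 ≤ e.k * c.k * Rr G c.t 2 := rep o hE (Rr G c.t 2)
    have h12 : 1 ≤ e.k * (e.k * e.s) * Rr G c.t 2 := rep h11 h10 (e.k * Rr G c.t 2)
    have h13 : 1 ≤ e.k * Rr G c.t 2 := rep h12 e.th (Rr G c.t 2)
    have := Arc.len h13 e (Rr G c.t 2)
    omega

end Part1
end CTWDR

namespace CTWDR
section LemM
set_option linter.unusedSectionVars false
variable {V : Type*} [Fintype V] {G : CTWDR V} [Nonempty V]
open Cx

theorem swp {Y : Cx G} (h : 1 ≤ Y) (d c b : Arc G)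
    (e1 : Y = d.k * c.k * d.s * b.s := by ring) : d.k * c.k ≤ d.k * b.k := by
  have h1 : c.s ≤ d.k * d.s * b.s := Arc.a1 h c _ (by rw [e1]; ring)
  have h2 : c.k ≤ d.k * d.s * b.k := flp h1
  exact lep (mul_le_mul' (le_refl d.k) h2) d.th b.k

theorem dpow {d c b : Arc G} (h : d.k * c.k ≤ d.k * b.k) (j : ℕ) :
    d.k * c.k ^ j ≤ d.k * b.k ^ j := by
  induction j with
  | zero => simp
  | succ j ih => exact lep (lep0 (le_refl (d.k * c.k ^ (j + 1))) ih c.k) h (b.k ^ j)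

theorem powF {a u : Arc G} (h : a.k ≤ u.k * u.s) (j : ℕ) : a.k ^ (j + 1) ≤ u.k * u.s := by
  induction j with
  | zero => simpa using h
  | succ j ih => exact lep (lep0 (lep0 (le_refl (a.k ^ (j + 1 + 1))) ih a.k) h (u.k * u.s)) u.th u.s

theorem Rne {a : Arc G} {b : ℕ} (h : 1 ≤ a.k * Rr G b 2) : False := by
  rw [← st_Rr] at h
  have := rel_eq h
  simp at this

/-- conclusion of the structure lemma -/
def Con (d : Arc G) : Prop :=
  ∃ u : Arc G, d.t = u.t + 1 ∧ u.P ∧ (u.k ≤ d.k * d.k ∨ d.k ≤ u.k * u.s)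

theorem caseI_2 {d r : Arc G} {m : ℕ} (hm : d.t = m + 3) (h : 1 ≤ d.k * d.k * (r.k * A G ^ m)) :
    1 ≤ Rr G 2 (m + 1) * Rr G (m + 1) 2 ∧ Rr G 2 (m + 1) ≤ d.k * r.k := by
  obtain ⟨b, b1, b2, b3, -, hl⟩ := EX2 d r h (Q := d.k * A G ^ m) (by omega)
  have hb : b = m + 1 := by omega
  subst hb
  rcases hl with ⟨f, f1, f2, f3⟩ | ⟨o, hE, hE'⟩
  · have h1 : 1 ≤ f.k * (d.k * A G ^ m) := rep f.one f3 f.k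
    have := Arc.len h1 d (f.k * A G ^ m)
    omega
  · exact ⟨o, hE⟩

theorem caseI {d r : Arc G} {m : ℕ} (hm : d.t = m + 3) (h : 1 ≤ d.k * d.k * (r.k * A G ^ m))
    (hr : r ≠ d) (IH : ∀ x : Arc G, x.t < d.t → x.P ∨ Con x) : Con d := by
  have hb : ∃ b : Arc G, b.t = m + 2 ∧ b.k ≤ d.k * d.k := by
    obtain ⟨o, hE⟩ := caseI_2 hm h
    obtain ⟨b, b1, b2, b3, -, hl⟩ := EX2 d d h (Q := r.k * A G ^ m) (by omega)
    have hb : b = m + 1 := by omega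
    subst hb
    rcases hl with ⟨f, f1, f2, f3⟩ | ⟨o', hP, hP'⟩
    · exact ⟨f, f1, f2⟩
    · have h1 : 1 ≤ d.k * d.k * d.s * r.s := meet o hP hE
      have h2 : 1 ≤ d.k * r.s := rep h1 d.th r.s
      exact absurd (Arc.eqs h2 d r).symm hr
  obtain ⟨b, b1, b2⟩ := hb
  rcases IH b (by omega) with hbP | ⟨c, c1, c2, c3 | c3⟩
  · exact ⟨b, by omega, hbP, Or.inl b2⟩
  · exfalso
    have hc2 := c.two
    obtain ⟨m', rfl⟩ : ∃ m', m = m' + 1 := ⟨m - 1, by omega⟩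
    have h1 : c.s ≤ c.k ^ (m' + 1) := Arc.pS c2 (by omega)
    have h2 : 1 ≤ b.k * b.k * c.k ^ (m' + 1) := rep (lep0 c.one h1 c.k) c3 (c.k ^ (m' + 1))
    have h3 : 1 ≤ d.k * d.k * b.k * c.k ^ (m' + 1) := rep h2 b2 (b.k * c.k ^ (m' + 1))
    have hcA : c.k ^ (m' + 1) ≤ A G ^ (m' + 1) :=
      (inferInstance : Len (c.k ^ (m' + 1)) _).le.trans (by simp)
    have hcA' : b.k * c.k ^ m' ≤ A G ^ (m' + 1) :=
      (inferInstance : Len (b.k * c.k ^ m') _).le.trans (rng (le_refl _) (by ring))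
    obtain ⟨o, hb⟩ := caseI_2 hm (r := b) (rep h3 hcA (d.k * d.k * b.k))
    obtain ⟨-, hc⟩ := caseI_2 hm (r := c) (rep h3 hcA' (d.k * d.k * c.k))
    have h4 : 1 ≤ d.k * c.k * d.s * b.s := meet o hc hb
    have h5 := dpow (swp h4 d c b) (m' + 1)
    have h6 : 1 ≤ d.k * d.k * b.k * b.k ^ (m' + 1) := rep h3 h5 (d.k * b.k)
    have h7 : 1 ≤ d.k * d.k * b.k ^ m' * (b.k * b.s * c.k) :=
      rep h6 (Arc.sq c3) (d.k * d.k * b.k ^ m')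
    have h8 : 1 ≤ d.k * d.k * b.k ^ m' * (d.k * d.s * c.k) :=
      rep h7 (Arc.sqF b2) (d.k * d.k * b.k ^ m' * c.k)
    have h9 : 1 ≤ d.k * d.k * b.k ^ m' * c.k := rep h8 d.th (d.k * b.k ^ m' * c.k)
    have := Arc.len h9 d (d.k * b.k ^ m' * c.k)
    omega
  · exfalso
    have h1 : 1 ≤ d.k * d.k * (c.k * c.s) := meetK b b2 c3
    have := part1 c d (by omega) h1
    omega

theorem caseIIa {d a : Arc G} {m : ℕ} (hm : d.t = m + 3) (h : 1 ≤ d.k * a.k * A G ^ (m + 1))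
    (ha : a ≠ d) (IH : ∀ x : Arc G, x.t < d.t → x.P ∨ Con x)
    (nI : ∀ r : Arc G, 1 ≤ d.k * d.k * (r.k * A G ^ m) → r = d)
    (nb : ∀ r b : Arc G, r ≠ d → b.t = m + 2 → b.k ≤ d.k * r.k → False) : Con d := by
  have hR : ∀ r : Arc G, r ≠ d → 1 ≤ d.k * r.k * A G ^ (m + 1) →
      1 ≤ Rr G 2 (m + 1) * Rr G (m + 1) 2 ∧ Rr G 2 (m + 1) ≤ d.k * r.k := by
    intro r hr h
    obtain ⟨b, b1, b2, b3, -, hl⟩ := EX2 d r h (Q := A G ^ (m + 1)) (by omega)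
    have hb : b = m + 1 := by omega
    subst hb
    rcases hl with ⟨f, f1, f2, f3⟩ | ⟨o, hE, hE'⟩
    · exact (nb r f hr f1 f2).elim
    · exact ⟨o, hE⟩
  obtain ⟨o, hA⟩ := hR a ha h
  have key : ∀ j, j ≤ m + 1 → 1 ≤ d.k * a.k ^ (j + 1) * A G ^ (m + 1 - j) := by
    intro j
    induction j with
    | zero => intro _; simpa using h
    | succ j ih =>
      intro hj
      have h1 := ih (by omega)
      have h2 : m + 1 - j = (m + 1 - (j + 1)) + 1 := by omega
      rw [h2] at h1
      obtain ⟨r, hr⟩ := peel h1 (d.k * a.k ^ (j + 1)) _ rfl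
      have hQ : a.k ^ j * A G ^ (m + 1 - (j + 1)) ≤ A G ^ m := by
        refine (inferInstance : Len (a.k ^ j * A G ^ (m + 1 - (j + 1))) _).le.trans ?_
        have : 1 * j + 1 * (m + 1 - (j + 1)) = m := by omega
        rw [this]
      have h3 : 1 ≤ d.k * r.k * (a.k * A G ^ m) := rep hr hQ (d.k * r.k * a.k)
      have hrd : r ≠ d := by
        rintro rfl
        exact ha (nI a h3)
      have hQ' : a.k * A G ^ m ≤ A G ^ (m + 1) :=
        (inferInstance : Len (a.k * A G ^ m) _).le.trans (rng (le_refl _) (by ring))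
      obtain ⟨-, hR'⟩ := hR r hrd (rep h3 hQ' (d.k * r.k))
      have h4 : 1 ≤ d.k * r.k * d.s * a.s := meet o hR' hA
      exact rep hr (swp h4 d r a) (a.k ^ (j + 1) * A G ^ (m + 1 - (j + 1)))
  have h1 := key (m + 1) le_rfl
  have h2 : 1 ≤ d.k * a.k ^ (m + 2) := by simpa using h1
  have l1 := Arc.len h a (d.k * A G ^ (m + 1))
  have hat : a.t ≠ d.t := fun h => ha (Arc.eqt h)
  have ha2 := a.two
  rcases IH a (by omega) with haP | ⟨u, u1, u2, u3 | u3⟩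
  · obtain ⟨y, hy⟩ : ∃ y, a.t = y + 1 := ⟨a.t - 1, by omega⟩
    have h3 := Arc.pF haP hy
    by_cases hlt : a.t = m + 2
    · have : y = m + 1 := by omega
      subst this
      have h4 : 1 ≤ d.k * (a.k * a.s) := rep h2 h3 d.k
      exact ⟨a, by omega, haP, Or.inr (flp (Arc.a1 h4 d (a.k * a.s)))⟩
    · exfalso
      obtain ⟨x, rfl⟩ : ∃ x, m = y + x := ⟨m - y, by omega⟩
      have h4 : 1 ≤ d.k * a.k ^ (x + 1) * (a.k * a.s) := rep h2 h3 (d.k * a.k ^ (x + 1))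
      have h5 : 1 ≤ d.k * a.k ^ (x + 1) := rep h4 a.th (d.k * a.k ^ x)
      have := Arc.len h5 d (a.k ^ (x + 1))
      omega
  · exfalso
    have hu2 := u.two
    obtain ⟨m', rfl⟩ : ∃ m', m = m' + 1 := ⟨m - 1, by omega⟩
    have h4 : 1 ≤ d.k * a.k ^ (m' + 1) * (a.k * a.s * u.k) :=
      rep h2 (Arc.sq u3) (d.k * a.k ^ (m' + 1))
    have h5 : 1 ≤ d.k * a.k ^ (m' + 1) * u.k := rep h4 a.th (d.k * a.k ^ m' * u.k)
    have := Arc.len h5 d (a.k ^ (m' + 1) * u.k)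
    omega
  · exfalso
    have h4 : 1 ≤ d.k * (u.k * u.s) := rep h2 (powF u3 (m + 1)) d.k
    have := Arc.len h4 d (u.k * u.s)
    have hu2 := u.two
    omega

theorem IIb_pure {d a b : Arc G} {m : ℕ} (hm : d.t = m + 3) (hb : b.t = m + 2)
    (ha : a ≠ d) (hba : b.k ≤ d.k * a.k) (hbP : b.P)
    (nI : ∀ r : Arc G, 1 ≤ d.k * d.k * (r.k * A G ^ m) → r = d) : Con d := by
  have hab : a = b → Con d := by
    rintro rfl
    exact ⟨a, by omega, hbP, Or.inr (Arc.abs (rng hba))⟩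
  have h1 : 1 ≤ d.k * a.k * b.s := rep b.one hba b.s
  have h2 : 1 ≤ d.k * a.k * b.k ^ (m + 1) := rep h1 (Arc.pS hbP (by omega : b.t = m + 1 + 1)) (d.k * a.k)
  have l1 := Arc.len h2 a (d.k * b.k ^ (m + 1))
  have hat : a.t ≠ d.t := fun h => ha (Arc.eqt h)
  have ha2 := a.two
  by_cases hm0 : m = 0
  · exact hab (Arc.eqt (by omega))
  obtain ⟨x, b1, b2, b3, -, hl⟩ := EX2 d b h2 (Q := a.k * b.k ^ m) (by omega)
  have hx : x = m + 1 := by omega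
  subst hx
  rcases hl with ⟨f, f1, f2, f3⟩ | ⟨o, hE, hE'⟩
  · have : f = b := Arc.eqt (by omega)
    subst this
    exact ⟨f, by omega, hbP, Or.inr (Arc.abs (rng f2))⟩
  obtain ⟨x, b1, b2, b3, hx1, hl⟩ := EX2 b a h2 (Q := d.k * b.k ^ m) (by omega)
  have hx : x = m ∨ x = m + 1 := by omega
  rcases hx with rfl | rfl
  · exact hab (Arc.pu hbP hx1 a (A G ^ x) (by omega))
  exfalso
  rcases hl with ⟨f, f1, f2, f3⟩ | ⟨o', hP, hP'⟩
  · have : f = b := Arc.eqt (by omega)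
    subst this
    have h3 := Arc.abs f2
    have h4 : 1 ≤ d.k * (f.k * f.s) * f.s := rep h1 h3 (d.k * f.s)
    have h5 : 1 ≤ d.k * f.s := rep h4 f.th' d.k
    have := Arc.eqs h5 d f
    subst this
    omega
  · have h3 : 1 ≤ d.k * b.k * b.s * a.s := meet o hE hP
    have h4 : a.k ≤ d.k * b.k * b.s := Arc.a2 h3 a _
    have h5 : 1 ≤ d.k * (d.k * b.k * b.s) * b.k ^ (m + 1) := rep h2 h4 (d.k * b.k ^ (m + 1))
    have h6 : 1 ≤ d.k * d.k * (b.k * b.k ^ m) := rep h5 b.th (d.k * d.k * b.k ^ m)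
    have hA : b.k ^ m ≤ A G ^ m := (inferInstance : Len (b.k ^ m) _).le.trans (by simp)
    have := nI b (rep h6 hA (d.k * d.k * b.k))
    subst this
    omega

end LemM
end CTWDR

namespace CTWDR
section LemM2
set_option linter.unusedSectionVars false
variable {V : Type*} [Fintype V] {G : CTWDR V} [Nonempty V]
open Cx

/-- case II.b, `C(t-1)`, sub-case `b ≤ d b` -/
theorem IIb_C1 {d b c : Arc G} {m : ℕ} (hm : d.t = m + 4) (hb : b.t = m + 3) (hct : c.t = m + 2)
    (hbd : b.k ≤ d.k * b.k) (hcP : c.P) (hc : c.k ≤ b.k * b.k)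
    (ndc : ¬ b.k ≤ d.k * c.k) : False := by
  have hcF : c.k * c.s ≤ b.k * b.s := Arc.sqF hc
  have hd : d.k ≤ b.k * b.s := Arc.abs (rng hbd)
  have hcs : c.s ≤ c.k ^ (m + 1) := Arc.pS hcP (by omega)
  have h0 : 1 ≤ b.k * b.k * c.k ^ (m + 1) := rep (lep0 c.one hcs c.k) hc (c.k ^ (m + 1))
  have h1 : 1 ≤ d.k * b.k * b.k * c.k ^ (m + 1) := rep h0 hbd (b.k * c.k ^ (m + 1))
  obtain ⟨x, b1, b2, b3, -, hl⟩ := EX2 d c h1 (Q := b.k * b.k * c.k ^ m) (by omega)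
  have hx : x = m + 2 := by omega
  subst hx
  rcases hl with ⟨f, f1, f2, f3⟩ | ⟨o, hE, hE'⟩
  · have : f = b := Arc.eqt (by omega)
    subst this
    exact ndc f2
  have hds : d.s ≤ b.k * b.s := flp hd
  have hP : d.s * c.k ≤ b.k * b.k :=
    lep (lep0 (lep0 (le_refl (d.s * c.k)) hds c.k) hc (b.k * b.s)) b.th b.k
  have hQ : d.k * c.s ≤ b.k * b.k * c.k ^ m := by
    have q1 : d.k * c.s ≤ b.k * b.s * c.k ^ (m + 1) := mul_le_mul' hd hcs
    have q2 : d.k * c.s ≤ b.k * b.s * (b.k * b.k) * c.k ^ m := lep q1 hc (b.k * b.s * c.k ^ m)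
    exact lep q2 b.th (b.k * c.k ^ m)
  have i1 : Len (d.s * c.k) 2 := ⟨hP.trans ((inferInstance : Len (b.k * b.k) _).le)⟩
  have i2 : Len (d.k * c.s) (m + 2) :=
    ⟨hQ.trans ((inferInstance : Len (b.k * b.k * c.k ^ m) _).le.trans (rng (le_refl _)))⟩
  have h2 : 1 ≤ d.s * c.k * (d.k * c.s) := rng (one_le_mul d.one c.one)
  obtain ⟨a, x, x1, x2, o', hR, hR', x3, x4⟩ := EXT (hP := i1) (hQ := i2) h2 rfl
  have h3 : 1 ≤ b.k * b.k * Rr G x a := rep o' (hR.trans hP) (Rr G x a)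
  have l1 := Arc.len h3 b (b.k * Rr G x a)
  have ha : a = 0 ∨ a = 1 ∨ a = 2 := by omega
  have hx : x = m + 1 ∨ x = m + 2 := by omega
  rcases ha with rfl | rfl | rfl
  · have := Arc.eqs (x3 rfl) c d
    subst this
    omega
  · obtain ⟨f, f1, f2, f3⟩ := x4 rfl
    rw [← f2] at hR
    rcases hx with rfl | rfl
    · have : f = c := Arc.eqt (by omega)
      subst this
      have h4 : 1 ≤ f.s * (d.s * f.k) := rep f.one hR f.s
      have h5 : d.k ≤ f.k * f.s := Arc.a2 h4 d (f.k * f.s)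
      have h6 : d.s ≤ f.k * f.s := flp h5
      have h7 : 1 ≤ d.k * (f.k * f.s) := rep d.one h6 d.k
      have := Arc.len h7 d (f.k * f.s)
      omega
    · have : f = b := Arc.eqt (by omega)
      subst this
      exact Arc.nosq (hR.trans hP)
  · rcases hx with rfl | rfl
    · obtain ⟨x, b1, b2, b3, -, hl⟩ := EX2 b c h0 (Q := b.k * c.k ^ m) (by omega)
      have hx : x = m + 1 := by omega
      subst hx
      rcases hl with ⟨f, f1, f2, f3⟩ | ⟨o2, hE2, hE2'⟩
      · have : f = c := Arc.eqt (by omega)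
        subst this
        have h4 : b.k ≤ f.k * f.s := Arc.abs (rng f2)
        have h5 := powF h4 1
        exact Arc.notF (hc.trans (rng h5 rfl |> fun h => by rw [← pow_two]; exact h))
      · have h4 : 1 ≤ b.k * c.k * d.k * c.s := meet o' hE2 hR
        have h5 : 1 ≤ b.k * (b.k * b.s) * d.k := rep h4 hcF (b.k * d.k)
        have h6 : 1 ≤ b.k * d.k := rep h5 b.th d.k
        exact Arc.not2 h6 b d (by omega)
    · have h4 : 1 ≤ d.k * d.k * (c.k * c.s) := meet o hE hR
      have := part1 c d (by omega) h4
      omega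

theorem IIb_C {d a b c : Arc G} {m : ℕ} (hm : d.t = m + 4) (hb : b.t = m + 3) (hct : c.t = m + 2)
    (ha : a ≠ d) (hba : b.k ≤ d.k * a.k) (hcP : c.P) (hc : c.k ≤ b.k * b.k) : False := by
  have hcF : c.k * c.s ≤ b.k * b.s := Arc.sqF hc
  have hcs : c.s ≤ c.k ^ (m + 1) := Arc.pS hcP (by omega)
  have h0 : 1 ≤ b.k * b.k * c.k ^ (m + 1) := rep (lep0 c.one hcs c.k) hc (c.k ^ (m + 1))
  have hX : ∀ a : Arc G, b.k ≤ d.k * a.k → 1 ≤ d.k * a.k * b.k * c.k ^ (m + 1) := by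
    intro a hba
    exact rep h0 hba (b.k * c.k ^ (m + 1))
  have ndc : ¬ b.k ≤ d.k * c.k := by
    intro h
    have h1 : 1 ≤ d.k * b.k * (c.k * c.s) :=
      rep (hX c h) (Arc.pF hcP (by omega : c.t = m + 1 + 1)) (d.k * b.k)
    have h2 : 1 ≤ d.k * b.k * (b.k * b.s) := rep h1 hcF (d.k * b.k)
    have h3 : 1 ≤ d.k * b.k := rep h2 b.th d.k
    exact Arc.not2 h3 d b (by omega)
  have ndb : ¬ b.k ≤ d.k * b.k := fun h => IIb_C1 hm hb hct h hcP hc ndc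
  have hac : a ≠ c := by rintro rfl; exact ndc hba
  have hab : a ≠ b := by rintro rfl; exact ndb hba
  have h1 := hX a hba
  have l1 := Arc.len h1 a (d.k * b.k * c.k ^ (m + 1))
  have e1 : a.t ≠ d.t := fun h => ha (Arc.eqt h)
  have e2 : a.t ≠ c.t := fun h => hac (Arc.eqt h)
  have e3 : a.t ≠ b.t := fun h => hab (Arc.eqt h)
  have ha2 := a.two
  have hm0 : m ≠ 0 := by omega
  obtain ⟨x, b1, b2, b3, -, hl⟩ := EX2 d b h1 (Q := a.k * c.k ^ (m + 1)) (by omega)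
  have hx : x = m + 2 := by omega
  subst hx
  rcases hl with ⟨f, f1, f2, f3⟩ | ⟨o, hE, hE'⟩
  · have : f = b := Arc.eqt (by omega)
    subst this
    exact ndb f2
  obtain ⟨x, b1, b2, b3, -, hl⟩ := EX2 d c h1 (Q := a.k * b.k * c.k ^ m) (by omega)
  have hx : x = m + 2 := by omega
  subst hx
  rcases hl with ⟨f, f1, f2, f3⟩ | ⟨o', hP, hP'⟩
  · have : f = b := Arc.eqt (by omega)
    subst this
    exact ndc f2
  have h4 : 1 ≤ d.k * c.k * d.s * b.s := meet o hP hE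
  have h5 := dpow (swp h4 d c b) (m + 1)
  obtain ⟨m', rfl⟩ : ∃ m', m = m' + 1 := ⟨m - 1, by omega⟩
  have h6 : 1 ≤ d.k * a.k * b.k * b.k ^ (m' + 1 + 1) := rep h1 h5 (a.k * b.k)
  have h7 : 1 ≤ d.k * a.k * b.k ^ (m' + 1) * (b.k * b.s * c.k) :=
    rep h6 (Arc.sq hc) (d.k * a.k * b.k ^ (m' + 1))
  have h8 : 1 ≤ d.k * a.k * b.k ^ (m' + 1) * c.k := rep h7 b.th (d.k * a.k * b.k ^ m' * c.k)
  have := Arc.len h8 d (a.k * b.k ^ (m' + 1) * c.k)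
  omega

end LemM2
end CTWDR

namespace CTWDR
section LemM3
set_option linter.unusedSectionVars false
variable {V : Type*} [Fintype V] {G : CTWDR V} [Nonempty V]
open Cx


/-- building a mixed circuit -/
theorem twoTypes {c a : Arc G} {m : ℕ} (hct : c.t = m + 1) (hm : 2 ≤ m) (hcP : c.P) (hac : a ≠ c)
    (haF : ¬ a.k ≤ c.k * c.s) (h : 1 ≤ c.k * a.k * A G ^ m) :
    ∃ i j, i + j = m ∧ 1 ≤ c.k ^ (i + 1) * a.k ^ (j + 1) := by
  obtain ⟨m, rfl⟩ : ∃ m', m = m' + 1 := ⟨m - 1, by omega⟩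
  obtain ⟨x, b1, b2, b3, hx1, hl⟩ := EX2 c a h (Q := A G ^ (m + 1)) (by omega)
  have hx : x = m ∨ x = m + 1 := by omega
  rcases hx with rfl | rfl
  · exact absurd (Arc.pu hcP hx1 a (A G ^ x) (by omega)) hac
  rcases hl with ⟨f, f1, f2, f3⟩ | ⟨o, hE, hE'⟩
  · have : f = c := Arc.eqt (by omega)
    subst this
    exact absurd (Arc.abs f2) haF
  have key : ∀ l, l ≤ m + 1 → ∃ i j, i + j = l ∧ 1 ≤ c.k ^ (i + 1) * a.k ^ (j + 1) * A G ^ (m + 1 - l) := by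
    intro l
    induction l with
    | zero => intro _; exact ⟨0, 0, rfl, by simpa using h⟩
    | succ l ih =>
      intro hl
      obtain ⟨i, j, hij, h1⟩ := ih (by omega)
      have h2 : m + 1 - l = (m + 1 - (l + 1)) + 1 := by omega
      rw [h2] at h1
      obtain ⟨r, hr⟩ := peel h1 (c.k ^ (i + 1) * a.k ^ (j + 1)) _ rfl
      by_cases hrc : r = c
      · subst hrc
        exact ⟨i + 1, j, by omega, rng hr⟩
      have hQ : c.k ^ i * a.k ^ j * A G ^ (m + 1 - (l + 1)) ≤ A G ^ m := by
        refine (inferInstance : Len (c.k ^ i * a.k ^ j * A G ^ (m + 1 - (l + 1))) _).le.trans ?_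
        have : 1 * i + 1 * j + 1 * (m + 1 - (l + 1)) = m := by omega
        rw [this]
      have h3 : 1 ≤ c.k * r.k * (a.k * A G ^ m) := rep hr hQ (c.k * r.k * a.k)
      obtain ⟨x, b1, b2, b3, hx2, hl⟩ := EX2 c r h3 (Q := a.k * A G ^ m) (by omega)
      have hx : x = m ∨ x = m + 1 := by omega
      rcases hx with hx | rfl
      · exact absurd (Arc.pu hcP hx2 r (A G ^ x) (by omega)) hrc
      rcases hl with ⟨f, f1, f2, f3⟩ | ⟨o', hP, hP'⟩
      · exfalso
        have : f = c := Arc.eqt (by omega)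
        subst this
        have h4 := Arc.abs f2
        have h5 : 1 ≤ f.k ^ (i + 1) * a.k ^ (j + 1) * (f.k * f.s) * A G ^ (m + 1 - (l + 1)) :=
          rep hr h4 (f.k ^ (i + 1) * a.k ^ (j + 1) * A G ^ (m + 1 - (l + 1)))
        have h6 : 1 ≤ f.k ^ (i + 1) * a.k ^ (j + 1) * A G ^ (m + 1 - (l + 1)) :=
          rep h5 f.th (f.k ^ i * a.k ^ (j + 1) * A G ^ (m + 1 - (l + 1)))
        exact hac (Arc.pu hcP h6 a (f.k ^ i * a.k ^ j * A G ^ (m + 1 - (l + 1))) (by omega))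
      · have h4 : 1 ≤ c.k * r.k * c.s * a.s := meet o hP hE
        exact ⟨i, j + 1, by omega, rep hr (swp h4 c r a) (c.k ^ i * a.k ^ (j + 1) * A G ^ (m + 1 - (l + 1)))⟩
  obtain ⟨i, j, hij, h1⟩ := key (m + 1) le_rfl
  exact ⟨i, j, hij, by simpa using h1⟩

/-- long mixed circuits -/
theorem longij {c a : Arc G} {i j : ℕ} (hct : c.t = i + j + 5) (hcP : c.P) (hac : a ≠ c)
    (haF : ¬ a.k ≤ c.k * c.s) (hca : ¬ c.k ≤ a.k * a.k)
    (h : 1 ≤ c.k ^ (i + 3) * a.k ^ (j + 3)) : False := by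
  -- the square of c
  have h0 := Arc.ppow hcP
  rw [hct] at h0
  obtain ⟨x, b1, b2, b3, -, hl⟩ := EX2 c c h0 (Q := c.k ^ (i + j + 3)) (by omega)
  have hx : x = i + j + 3 := by omega
  subst hx
  rcases hl with ⟨p, p1, p2, p3⟩ | ⟨o, hE, hE'⟩
  · have h1 : 1 ≤ c.k ^ (i + 1) * a.k ^ (j + 3) * (c.k * c.s * p.k) :=
      rep h (Arc.sq p2) (c.k ^ (i + 1) * a.k ^ (j + 3))
    have h2 : 1 ≤ c.k ^ (i + 1) * a.k ^ (j + 3) * p.k :=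
      rep h1 c.th (c.k ^ i * a.k ^ (j + 3) * p.k)
    exact hac (Arc.pu hcP h2 a (c.k ^ i * a.k ^ (j + 2) * p.k) (by omega))
  obtain ⟨y, x, y1, x1, oy, hy, hy', y0, ya⟩ :=
    EXT (P := c.k * c.k * a.k) (Q := c.k ^ (i + 1) * a.k ^ (j + 2)) h
  obtain ⟨z, w, z1, w1, oz, hz, hz', z0, za⟩ :=
    EXT (P := c.k * a.k * a.k) (Q := c.k ^ (i + 2) * a.k ^ (j + 1)) h
  have hyc : 1 ≤ c.k * c.k * a.k * Rr G x y := rep oy hy (Rr G x y)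
  have hzc : 1 ≤ c.k * a.k * a.k * Rr G w z := rep oz hz (Rr G w z)
  have hxe : x = i + j + 3 := by
    by_contra hne
    exact hac (Arc.pu hcP hyc a (c.k * Rr G x y) (by omega))
  have hwe : w = i + j + 3 := by
    by_contra hne
    exact hac (Arc.pu hcP hzc a (a.k * Rr G w z) (by omega))
  subst hxe
  have hy2 : y ≠ 2 := by
    rintro rfl
    have h1 : 1 ≤ c.k * c.k * a.k * c.s * c.s := meet o hy hE
    have h2 : 1 ≤ c.k * a.k * c.s := rep h1 c.th (a.k * c.s)
    exact haF (flp (Arc.a1 h2 a (c.k * c.s)))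
  have hz2 : z ≠ 2 := by
    rintro rfl
    rw [hwe] at hz
    have h1 : 1 ≤ c.k * a.k * a.k * c.s * c.s := meet o hz hE
    have h2 : 1 ≤ a.k * a.k * c.s := rep h1 c.th' (a.k * a.k)
    exact hca (Arc.a2 h2 c _)
  have hy0 : y ≠ 0 := by
    intro h1
    have := Arc.len (y0 h1) c (c.k * a.k)
    omega
  have hz0 : z ≠ 0 := by
    intro h1
    have := Arc.len (z0 h1) c (a.k * a.k)
    omega
  have hy1 : y ≠ 1 := by
    intro h1
    obtain ⟨f, f1, f2, f3⟩ := ya h1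
    rw [← f3] at hy'
    have h2 : 1 ≤ f.k * (c.k ^ (i + 1) * a.k ^ (j + 2)) := rep f.one hy' f.k
    have := Arc.len h2 c (f.k * c.k ^ i * a.k ^ (j + 2))
    omega
  have hz1 : z ≠ 1 := by
    intro h1
    obtain ⟨f, f1, f2, f3⟩ := za h1
    rw [← f3] at hz'
    have h2 : 1 ≤ f.k * (c.k ^ (i + 2) * a.k ^ (j + 1)) := rep f.one hz' f.k
    have := Arc.len h2 c (f.k * c.k ^ (i + 1) * a.k ^ (j + 1))
    omega
  have hyz : y = 3 := by omega
  have hz3 : z = 3 := by omega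
  subst hyz; subst hz3; subst hwe
  have h1 : 1 ≤ c.k * c.k * a.k * (c.s * a.s * a.s) := meet oy hy hz
  have h2 : 1 ≤ c.k * a.k * a.s * a.s := rep h1 c.th (a.k * a.s * a.s)
  have h3 : 1 ≤ c.k * a.s := rep h2 a.th' c.k
  exact hac (Arc.eqs h3 c a).symm

theorem IIb_D {d a b c : Arc G} {m : ℕ} (hm : d.t = m + 3) (hb : b.t = m + 2) (hct : c.t = m + 1)
    (ha : a ≠ d) (hba : b.k ≤ d.k * a.k) (hcP : c.P) (hc : b.k ≤ c.k * c.s)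
    (IH : ∀ x : Arc G, x.t < d.t → x.P ∨ Con x) : False := by
  have hbs : b.s ≤ c.k * c.s := flp hc
  have hdF : ¬ d.k ≤ c.k * c.s := by
    intro h
    have h1 : d.s ≤ c.k * c.s := flp h
    have h2 : 1 ≤ d.k * (c.k * c.s) := rep d.one h1 d.k
    have := Arc.len h2 d (c.k * c.s)
    omega
  have ndc : ¬ b.k ≤ d.k * c.k := by
    intro h
    have h1 : 1 ≤ d.k * c.k * b.s := rep b.one h b.s
    have h2 : 1 ≤ d.k * c.k * (c.k * c.s) := rep h1 hbs (d.k * c.k)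
    have h3 : 1 ≤ d.k * c.k := rep h2 c.th d.k
    exact Arc.not2 h3 d c (by omega)
  have ndb : ¬ b.k ≤ d.k * b.k := by
    intro h
    exact hdF ((Arc.abs (rng h)).trans (Arc.inF hc))
  have hac : a ≠ c := by rintro rfl; exact ndc hba
  have hab : a ≠ b := by rintro rfl; exact ndb hba
  have h1 : 1 ≤ d.k * a.k * b.s := rep b.one hba b.s
  have h2 : 1 ≤ d.k * a.k * (c.k * c.s) := rep h1 hbs (d.k * a.k)
  have hcs : c.s ≤ c.k ^ m := Arc.pS hcP (by omega)
  have h3 : 1 ≤ d.k * a.k * (c.k * c.k ^ m) := rep h2 hcs (d.k * a.k * c.k)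
  have l1 := Arc.len h3 a (d.k * (c.k * c.k ^ m))
  have e1 : a.t ≠ d.t := fun h => ha (Arc.eqt h)
  have e2 : a.t ≠ c.t := fun h => hac (Arc.eqt h)
  have e3 : a.t ≠ b.t := fun h => hab (Arc.eqt h)
  have ha2 := a.two
  have hc2 := c.two
  have ham : a.t ≤ m := by omega
  obtain ⟨x, b1, b2, b3, -, hl⟩ := EX2 d c h3 (Q := a.k * c.k ^ m) (by omega)
  have hx : x = m + 1 := by omega
  subst hx
  rcases hl with ⟨f, f1, f2, f3⟩ | ⟨o, hE, hE'⟩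
  · have : f = b := Arc.eqt (by omega)
    subst this
    exact ndc f2
  have hds : d.s ≤ a.k * (c.k * c.s) := Arc.a1 h2 d _
  have hda : d.k ≤ a.s * (c.k * c.s) := flp hds
  have has : a.s ≤ d.k * (c.k * c.s) := Arc.a1 h2 a _
  have haF : ¬ a.k ≤ c.k * c.s := by
    intro h
    have q1 : a.s ≤ c.k * c.s := flp h
    have q2 : d.k ≤ c.k * c.s * (c.k * c.s) := lep hda q1 (c.k * c.s)
    exact hdF (lep q2 c.th c.s)
  have hca : ¬ c.k ≤ a.k * a.k := by
    intro h
    have q1 : Rr G 2 (m + 1) ≤ a.s * (c.k * c.s) * c.k := lep hE hda c.k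
    have q2 : Rr G 2 (m + 1) ≤ a.s * c.k := lep q1 c.th a.s
    have q3 : Rr G 2 (m + 1) ≤ a.s * (a.k * a.k) := lep q2 h a.s
    have q4 : Rr G 2 (m + 1) ≤ a.k := lep q3 a.th 1
    exact Rne (rep o q4 (Rr G (m + 1) 2))
  have hX3 : 1 ≤ c.k * a.k * A G ^ m := by
    obtain ⟨x, b1, b2, b3, hx1, hl⟩ := EX2 c a h3 (Q := d.k * c.k ^ m) (by omega)
    have hx : x = m - 1 ∨ x = m ∨ x = m + 1 := by omega
    rcases hx with rfl | rfl | rfl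
    · exact absurd (Arc.pu hcP hx1 a (A G ^ (m - 1)) (by omega)) hac
    · exact hx1
    exfalso
    rcases hl with ⟨f, f1, f2, f3⟩ | ⟨o', hP, hP'⟩
    · have : f = b := Arc.eqt (by omega)
      subst this
      have q1 : 1 ≤ c.k * a.k * f.s := rep f.one f2 f.s
      have q2 : 1 ≤ c.k * a.k * (c.k * c.s) := rep q1 hbs (c.k * a.k)
      have q3 : 1 ≤ c.k * a.k := rep q2 c.th a.k
      exact Arc.not2 q3 c a (by omega)
    · have q1 : 1 ≤ d.k * c.k * a.s * c.s := meet o hE hP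
      have q2 : 1 ≤ d.k * c.k * (d.k * (c.k * c.s)) * c.s := rep q1 has (d.k * c.k * c.s)
      have q3 : 1 ≤ d.k * d.k * (c.k * c.s) := rep q2 c.th (d.k * d.k * c.s)
      have := part1 c d (by omega) q3
      omega
  obtain ⟨i, j, hij, h4⟩ := twoTypes hct (by omega) hcP hac haF hX3
  by_cases hj0 : j = 0
  · subst hj0
    have : i = m := by omega
    subst this
    have q1 : 1 ≤ c.k * c.s * a.k := rep h4 (Arc.pF hcP hct) a.k
    exact haF (flp (Arc.a1 q1 a (c.k * c.s)))
  by_cases hj1 : j = 1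
  · subst hj1
    have : i + 1 = m := by omega
    subst this
    have q1 : 1 ≤ c.s * (a.k * a.k) := rep h4 (Arc.pS' hcP hct) (a.k * a.k)
    exact hca (Arc.a2 q1 c _)
  obtain ⟨j, rfl⟩ : ∃ j', j = j' + 2 := ⟨j - 2, by omega⟩
  by_cases hi : 2 ≤ i
  · obtain ⟨i, rfl⟩ : ∃ i', i = i' + 2 := ⟨i - 2, by omega⟩
    exact longij (i := i) (j := j) (by omega) hcP hac haF hca h4
  rcases IH a (by omega) with haP | ⟨u, u1, u2, u3 | u3⟩
  · obtain ⟨y, hy⟩ : ∃ y, a.t = y + 1 := ⟨a.t - 1, by omega⟩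
    have h5 := Arc.pF haP hy
    by_cases hjy : j + 3 = a.t
    · have : y = j + 2 := by omega
      subst this
      have q1 : 1 ≤ c.k ^ (i + 1) * (a.k * a.s) := rep h4 h5 (c.k ^ (i + 1))
      have : i = 1 := by omega
      subst this
      have q2 : 1 ≤ c.k ^ 2 * a.k * (d.k * (c.k * c.s)) := rep q1 has (c.k ^ 2 * a.k)
      have q3 : 1 ≤ c.k ^ 2 * a.k * d.k := rep q2 c.th (c.k * a.k * d.k)
      have := Arc.len q3 d (c.k ^ 2 * a.k)
      omega
    · obtain ⟨x, rfl⟩ : ∃ x, j = y + x - 1 := ⟨j + 1 - y, by omega⟩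
      have hjx : y + x - 1 + 2 + 1 = y + x + 2 := by omega
      rw [hjx] at h4
      have q1 : 1 ≤ c.k ^ (i + 1) * (a.k * a.s) * a.k ^ (x + 1) := rep h4 h5 (c.k ^ (i + 1) * a.k ^ (x + 1))
      have q2 : 1 ≤ c.k ^ (i + 1) * a.k ^ (x + 1) := rep q1 a.th (c.k ^ (i + 1) * a.k ^ x)
      have := Arc.len q2 c (c.k ^ i * a.k ^ (x + 1))
      omega
  · have q1 : 1 ≤ c.k ^ (i + 1) * a.k ^ (j + 1) * (a.k * a.s * u.k) :=
      rep h4 (Arc.sq u3) (c.k ^ (i + 1) * a.k ^ (j + 1))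
    have q2 : 1 ≤ c.k ^ (i + 1) * a.k ^ (j + 1) * u.k :=
      rep q1 a.th (c.k ^ (i + 1) * a.k ^ j * u.k)
    exact hac (Arc.pu hcP q2 a (c.k ^ i * a.k ^ j * u.k) (by omega))
  · have q1 : 1 ≤ c.k ^ (i + 1) * (u.k * u.s) := rep h4 (powF u3 (j + 2)) (c.k ^ (i + 1))
    have hu2 := u.two
    have := Arc.pu hcP q1 u (c.k ^ i * u.s) (by omega)
    subst this
    omega

theorem lemM : ∀ (n : ℕ) (d : Arc G), d.t = n → d.P ∨ Con d := by
  intro n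
  induction n using Nat.strong_induction_on with
  | _ n ih =>
  intro d hdn
  subst hdn
  have IH : ∀ x : Arc G, x.t < d.t → x.P ∨ Con x := fun x hx => ih x.t hx x rfl
  by_cases hP : d.P
  · exact Or.inl hP
  right
  unfold Arc.P at hP
  push Not at hP
  obtain ⟨a, h, ha⟩ := hP
  have hat : a.t ≠ d.t := fun h => ha (Arc.eqt h)
  have l1 := Arc.len h a (d.k * A G ^ (d.t - 2))
  have ha2 := a.two
  have hd2 := d.two
  obtain ⟨m, hm⟩ : ∃ m, d.t = m + 3 := ⟨d.t - 3, by omega⟩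
  have hm2 : d.t - 2 = m + 1 := by omega
  rw [hm2] at h
  by_cases nI : ∀ r : Arc G, 1 ≤ d.k * d.k * (r.k * A G ^ m) → r = d
  swap
  · push Not at nI
    obtain ⟨r, hr, hrd⟩ := nI
    exact caseI hm hr hrd IH
  by_cases nb : ∀ r b : Arc G, r ≠ d → b.t = m + 2 → b.k ≤ d.k * r.k → False
  · exact caseIIa hm h ha IH nI nb
  push Not at nb
  obtain ⟨r, b, hr, hb, hbr, -⟩ := nb
  rcases IH b (by omega) with hbP | ⟨c, c1, c2, c3 | c3⟩
  · exact IIb_pure hm hb hr hbr hbP nI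
  · exfalso
    have hc2 := c.two
    obtain ⟨m, rfl⟩ : ∃ m', m = m' + 1 := ⟨m - 1, by omega⟩
    exact IIb_C hm hb (by omega) hr hbr c2 c3
  · exfalso
    exact IIb_D hm hb (by omega) hr hbr c2 c3 IH

end LemM3
end CTWDR

namespace CTWDR
section Part2
set_option linter.unusedSectionVars false
variable {V : Type*} [Fintype V] {G : CTWDR V} [Nonempty V]
open Cx

theorem notcF {c e : Arc G} (ht : 3 ≤ e.t) (h : 1 ≤ e.k * e.k * (c.k * c.s))
    (hc : c.k ≤ e.k * e.s) : False := by
  have h1 : 1 ≤ e.k * e.k * (e.k * e.s * c.s) := rep h hc (e.k * e.k * c.s)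
  have h2 : 1 ≤ e.k * e.k * c.s := rep h1 e.th (e.k * c.s)
  have h3 : c.k ≤ e.k * e.k := Arc.a2 h2 c _
  have h4 : 1 ≤ e.k * e.k * (e.k * e.s) := meetK c h3 hc
  have h5 : 1 ≤ e.k * e.k := rep h4 e.th e.k
  exact Arc.not2 h5 e e ht

theorem part2 (c e : Arc G) (ht : e.t = c.t + 1) (h : 1 ≤ e.k * e.k * (c.k * c.s)) : c.P := by
  by_contra hcP
  have hc2 := c.two
  have hce : c ≠ e := by rintro rfl; omega
  have heP : e.P := by
    rcases lemM _ e rfl with h1 | ⟨u, u1, u2, _⟩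
    · exact h1
    · have : u = c := Arc.eqt (by omega)
      exact absurd (this ▸ u2) hcP
  have ncF := notcF (by omega) h
  rcases lemM _ c rfl with h1 | ⟨f, u1, hfP, hf | hf⟩
  · exact hcP h1
  swap
  · have h1 : 1 ≤ e.k * e.k * (f.k * f.s) := rep h (Arc.inF hf) (e.k * e.k)
    have := part1 f e (by omega) h1
    omega
  have hf2 := f.two
  obtain ⟨n, hn⟩ : ∃ n, f.t = n + 2 := ⟨f.t - 2, by omega⟩
  have hfS := Arc.pS hfP (n := n + 1) hn
  have hfe : f ≠ e := by rintro rfl; omega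
  have hec : 1 ≤ Rr G 2 (n + 3) * Rr G (n + 3) 2 ∧ Rr G 2 (n + 3) ≤ e.k * c.k := by
    obtain ⟨b, b1, b2, b3, hb4, hl⟩ := EX2 e c h (Q := c.s * e.k) (by omega)
    have hb : b = n + 2 ∨ b = n + 3 := by omega
    rcases hb with rfl | rfl
    · exact absurd (Arc.pu heP hb4 c (A G ^ (n + 2)) (by omega)) hce
    rcases hl with ⟨p, p1, p2, p3⟩ | ⟨o, hE, hE'⟩
    · have : p = e := Arc.eqt (by omega)
      subst this
      exact absurd (Arc.abs p2) ncF
    · exact ⟨o, hE⟩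
  have h1 : 1 ≤ e.k * e.k * (c.k * c.s) * (f.k * f.s) := one_le_mul h f.one
  have h2 : 1 ≤ e.k * e.k * (c.k * c.s) * f.k * f.k ^ (n + 1) :=
    rep h1 hfS (e.k * e.k * (c.k * c.s) * f.k)
  have h3 : 1 ≤ e.k * e.k * (c.k * c.s) * (c.k * c.k) * f.k ^ (n + 1) :=
    rep h2 hf (e.k * e.k * (c.k * c.s) * f.k ^ (n + 1))
  have h4 : 1 ≤ e.k * e.k * c.k * c.k * f.k ^ (n + 1) :=
    rep h3 c.th (e.k * e.k * c.k * f.k ^ (n + 1))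
  have hef : 1 ≤ Rr G 2 (n + 3) * Rr G (n + 3) 2 ∧ Rr G 2 (n + 3) ≤ e.k * f.k := by
    obtain ⟨b, b1, b2, b3, hb4, hl⟩ := EX2 e f h4 (Q := e.k * c.k * c.k * f.k ^ n) (by omega)
    have hb : b = n + 2 ∨ b = n + 3 := by omega
    rcases hb with rfl | rfl
    · exact absurd (Arc.pu heP hb4 f (A G ^ (n + 2)) (by omega)) hfe
    rcases hl with ⟨p, p1, p2, p3⟩ | ⟨o, hE, hE'⟩
    · have : p = e := Arc.eqt (by omega)
      subst this
      exfalso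
      have h5 := powF (Arc.abs p2) n
      have h6 : 1 ≤ p.k * p.k * c.k * c.k * (p.k * p.s) := rep h4 h5 (p.k * p.k * c.k * c.k)
      have h7 : 1 ≤ p.k * p.k * c.k * c.k := rep h6 p.th (p.k * c.k * c.k)
      exact hce (Arc.pu heP h7 c (p.k * c.k) (by omega))
    · exact ⟨o, hE⟩
  have h5 : 1 ≤ e.k * f.k * e.s * c.s := meet hec.1 hef.2 hec.2
  have h6 : 1 ≤ e.k * e.k * (c.k * c.s) * c.k * f.k ^ (n + 1) :=
    rep h2 (swp h5 e f c) (e.k * (c.k * c.s) * f.k ^ (n + 1))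
  have h7 : 1 ≤ e.k * e.k * c.k * f.k ^ (n + 1) := rep h6 c.th (e.k * e.k * f.k ^ (n + 1))
  exact hce (Arc.pu heP h7 c (e.k * f.k ^ (n + 1)) (by omega))

end Part2
end CTWDR

namespace CTWDR
section Part3
set_option linter.unusedSectionVars false
variable {V : Type*} [Fintype V] {G : CTWDR V} [Nonempty V]
open Cx

theorem lenR {Y : Cx G} {a b k : ℕ} (h : 1 ≤ Y) (Q : Cx G) [hQ : Len Q k]
    (e1 : Y = Rr G a b * Q := by ring) : b ≤ k := by
  subst e1
  obtain ⟨x⟩ := ‹Nonempty V›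
  obtain ⟨y, h1, h2⟩ := h x x rfl
  have h3 := dd_le_of (hQ.le _ _ h2)
  have := congrArg Prod.snd (rel_R.1 h1)
  simp only [tdist] at this
  omega

theorem pureSq {D : Arc G} {n : ℕ} (hD : D.t = n + 2) (hDP : D.P) (hn : 1 ≤ n) :
    1 ≤ Rr G 2 n * Rr G n 2 ∧ Rr G 2 n ≤ D.k * D.k := by
  have h0 := Arc.ppow hDP
  rw [hD] at h0
  obtain ⟨b, b1, b2, b3, -, hl⟩ := EX2 D D h0 (Q := D.k ^ n) (by omega)
  have hb : b = n := by omega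
  subst hb
  rcases hl with ⟨p, p1, p2, p3⟩ | ⟨o, hE, hE'⟩
  · exfalso
    have h1 : 1 ≤ p.k * D.k ^ b := rep p.one p3 p.k
    obtain ⟨m, rfl⟩ : ∃ m, b = m + 1 := ⟨b - 1, by omega⟩
    have := Arc.len h1 D (p.k * D.k ^ m)
    omega
  · exact ⟨o, hE⟩

theorem part3D {c e D : Arc G} {n : ℕ} (hc : c.t = n + 3) (he : e.t = n + 4) (hD : D.t = n + 5)
    (hcP : c.P) (h : 1 ≤ e.k * e.k * (c.k * c.s)) (o : 1 ≤ Rr G 2 (n + 3) * Rr G (n + 3) 2)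
    (hX : Rr G 2 (n + 3) ≤ c.k * e.k) (hDe : D.k ≤ e.k * e.s) : False := by
  have ncF := notcF (by omega) h
  have hce : c ≠ e := by rintro rfl; omega
  have hcD : c ≠ D := by rintro rfl; omega
  have hDs : D.s ≤ e.k * e.s := flp hDe
  have h1 : 1 ≤ D.k * D.k * (D.s * D.s) := rng (one_le_mul D.one D.one)
  have h2 : 1 ≤ D.k * D.k * (e.k * e.s * D.s) := rep h1 hDs (D.k * D.k * D.s)
  have h3 : 1 ≤ D.k * D.k * (e.k * e.s * (e.k * e.s)) := rep h2 hDs (D.k * D.k * (e.k * e.s))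
  have h4 : 1 ≤ D.k * D.k * (e.k * e.s) := rep h3 e.th (D.k * D.k * e.s)
  have hDD : 1 ≤ Rr G 2 (n + 4) * Rr G (n + 4) 2 ∧ Rr G 2 (n + 4) ≤ D.k * D.k := by
    obtain ⟨b, b1, b2, b3, -, hl⟩ := EX2 D D h4 (Q := e.k * e.s) (by omega)
    have hb : b = n + 3 ∨ b = n + 4 := by omega
    rcases hb with rfl | rfl
    · exfalso
      rcases hl with ⟨p, p1, p2, p3⟩ | ⟨o', hE, hE'⟩
      · have : p = e := Arc.eqt (by omega)
        subst this
        have p4 : p.k ≤ p.k * p.s := flp p3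
        exact Arc.notF p4
      · have h5 : 1 ≤ c.k * e.k * (e.k * e.s) := meet' o hX hE'
        have h6 : 1 ≤ c.k * e.k := rep h5 e.th c.k
        exact Arc.not2 h6 c e (by omega)
    · rcases hl with ⟨p, p1, p2, p3⟩ | ⟨o', hE, hE'⟩
      · have : p = D := Arc.eqt (by omega)
        subst this
        exact (Arc.nosq p2).elim
      · exact ⟨o', hE⟩
  have hcc : c.k ≤ e.k * e.k * c.k := Arc.a2 h c _
  have h5 : 1 ≤ D.k * c.k * (D.s * c.s) := rng (one_le_mul D.one c.one)
  have h6 : 1 ≤ D.k * c.k * (e.k * e.s * c.s) := rep h5 hDs (D.k * c.k * c.s)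
  have h7 : 1 ≤ D.k * c.k * (e.k * e.s * c.k ^ (n + 2)) :=
    rep h6 (Arc.pS hcP (n := n + 2) hc) (D.k * c.k * (e.k * e.s))
  have h8 : 1 ≤ D.k * c.k * (e.k * e.s * (e.k * e.k * c.k) * c.k ^ (n + 1)) :=
    rep h7 hcc (D.k * c.k * (e.k * e.s) * c.k ^ (n + 1))
  have h9 : 1 ≤ D.k * c.k * (e.k * e.k * c.k ^ (n + 2)) :=
    rep h8 e.th (D.k * c.k * (e.k * c.k ^ (n + 2)))
  obtain ⟨b, b1, b2, b3, -, hl⟩ := EX2 D c h9 (Q := e.k * e.k * c.k ^ (n + 2)) (by omega)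
  have hb : b = n + 3 ∨ b = n + 4 := by omega
  rcases hb with rfl | rfl
  · rcases hl with ⟨p, p1, p2, p3⟩ | ⟨o', hE, hE'⟩
    · have : p = e := Arc.eqt (by omega)
      subst this
      have q1 : 1 ≤ D.k * c.k * p.s := rep p.one p2 p.s
      have q2 : 1 ≤ p.k * p.s * c.k * p.s := rep q1 hDe (c.k * p.s)
      have q3 : 1 ≤ c.k * p.s := rep q2 p.th' c.k
      exact hce (Arc.eqs q3 c p)
    · have q1 : 1 ≤ D.k * c.k * c.s * e.s := meet o hE hX
      have q2 : e.k ≤ c.k * c.s * D.k := Arc.a2 q1 e _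
      have q3 : 1 ≤ (c.k * c.s * D.k) * e.k * (c.k * c.s) := rep h q2 (e.k * (c.k * c.s))
      have q4 : 1 ≤ (c.k * c.s * D.k) * (c.k * c.s * D.k) * (c.k * c.s) :=
        rep q3 q2 ((c.k * c.s * D.k) * (c.k * c.s))
      have q5 : 1 ≤ D.k * D.k * (c.k * c.s) * (c.k * c.s) :=
        rep q4 c.th (c.s * c.k * c.s * D.k * D.k)
      have q6 : 1 ≤ D.k * D.k * (c.k * c.s) := rep q5 c.th (D.k * D.k * c.s)
      have := part1 c D (by omega) q6
      omega
  · rcases hl with ⟨p, p1, p2, p3⟩ | ⟨o', hE, hE'⟩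
    · have : p = D := Arc.eqt (by omega)
      subst this
      exact ncF ((Arc.abs p2).trans (Arc.inF hDe))
    · have q1 : 1 ≤ D.k * c.k * D.s * D.s := meet o' hE hDD.2
      have q2 : 1 ≤ c.k * D.s := rep q1 D.th' c.k
      exact hcD (Arc.eqs q2 c D)

theorem part3 (c e D : Arc G) (ht : e.t = c.t + 1) (hDt : D.t = e.t + 1)
    (h : 1 ≤ e.k * e.k * (c.k * c.s)) (hne : ¬ e.k ≤ c.k * c.s) : False := by
  have hcP := part2 c e ht h
  have hc2 := c.two
  have ncF := notcF (by omega) h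
  obtain ⟨n, hc⟩ : ∃ n, c.t = n + 2 := ⟨c.t - 2, by omega⟩
  have hl : ∃ b, (b = n + 1 ∨ b = n + 2) ∧ 1 ≤ Rr G 2 b * Rr G b 2 ∧
      Rr G 2 b ≤ e.k * e.k ∧ Rr G b 2 ≤ c.k * c.s := by
    obtain ⟨b, b1, b2, b3, -, hl⟩ := EX2 e e h (Q := c.k * c.s) (by omega)
    have hb : b = n + 1 ∨ b = n + 2 := by omega
    refine ⟨b, hb, ?_⟩
    rcases hl with ⟨p, p1, p2, p3⟩ | hl
    · exfalso
      have p4 : p.k ≤ c.k * c.s := flp p3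
      have : p = c ∨ p = e := hb.imp (fun h => Arc.eqt (by omega)) (fun h => Arc.eqt (by omega))
      rcases this with rfl | rfl
      · exact Arc.notF p4
      · exact hne p4
    · exact hl
  have hD : D.P ∨ (e.P ∧ (e.k ≤ D.k * D.k ∨ D.k ≤ e.k * e.s)) := by
    rcases lemM _ D rfl with h1 | ⟨u, u1, u2, u3⟩
    · exact Or.inl h1
    · have : u = e := Arc.eqt (by omega)
      subst this
      exact Or.inr ⟨u2, u3⟩
  obtain ⟨b, rfl | rfl, o, hb, hb'⟩ := hl
  swap
  · rcases hD with hDP | ⟨heP, -⟩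
    · have h1 := pureSq (n := n + 2) (by omega) hDP (by omega)
      have h2 : 1 ≤ D.k * D.k * (c.k * c.s) := meet' o h1.2 hb'
      have := part1 c D (by omega) h2
      omega
    · have h0 := Arc.ppow heP
      have he : e.t = n + 3 := by omega
      rw [he] at h0
      have h1 : 1 ≤ e.k * e.k * Rr G (n + 2) 2 := rep o hb (Rr G (n + 2) 2)
      have h2 : e.s ≤ e.k * Rr G (n + 2) 2 := Arc.a1 h1 e _
      have h3 : e.k ≤ e.s * Rr G 2 (n + 2) := flp h2
      have h4 : 1 ≤ e.s * Rr G 2 (n + 2) * e.k ^ (n + 2) := rep h0 h3 (e.k ^ (n + 2))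
      have h5 : 1 ≤ Rr G 2 (n + 2) * e.k ^ (n + 1) := rep h4 e.th (Rr G 2 (n + 2) * e.k ^ n)
      have := lenR h5 (a := 2) (b := n + 2) (e.k ^ (n + 1))
      omega
  have hn : n ≠ 0 := by
    rintro rfl
    have : Rr G 1 2 = e.k := by
      unfold Arc.k Rr
      rw [show e.t - 1 = 2 by omega]
    exact hne (this ▸ hb')
  obtain ⟨n, rfl⟩ : ∃ m, n = m + 1 := ⟨n - 1, by omega⟩
  have hX : 1 ≤ Rr G 2 (n + 3) * Rr G (n + 3) 2 ∧ Rr G 2 (n + 3) ≤ c.k * e.k := by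
    obtain ⟨b, b1, b2, b3, -, hl⟩ := EX2 c e h (Q := c.s * e.k) (by omega)
    have hb : b = n + 2 ∨ b = n + 3 := by omega
    rcases hb with rfl | rfl
    · exfalso
      rcases hl with ⟨p, p1, p2, p3⟩ | ⟨o', hE, hE'⟩
      · have : p = c := Arc.eqt (by omega)
        subst this
        exact hne (Arc.abs p2)
      · have h5 : 1 ≤ c.k * e.k * (c.k * c.s) := meet' o hE hb'
        have h6 : 1 ≤ c.k * e.k := rep h5 c.th e.k
        exact Arc.not2 h6 c e (by omega)
    · rcases hl with ⟨p, p1, p2, p3⟩ | ⟨o', hE, hE'⟩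
      · have : p = e := Arc.eqt (by omega)
        subst this
        exact (ncF (Arc.abs (rng p2))).elim
      · exact ⟨o', hE⟩
  rcases hD with hDP | ⟨heP, hC | hDD⟩
  · have h1 := pureSq (n := n + 3) (by omega) hDP (by omega)
    have h2 : 1 ≤ c.s * e.s * D.k * D.k := by
      have : 1 ≤ D.k * D.k * c.s * e.s := meet hX.1 h1.2 hX.2
      exact rng this
    have h3 : e.k ≤ c.s * D.k * D.k := Arc.a2 h2 e _
    have h4 : 1 ≤ e.k * e.k * (c.k * c.s) * (c.k * c.s) := one_le_mul h c.one
    have h5 : 1 ≤ e.k * (c.s * D.k * D.k) * (c.k * c.s) * (c.k * c.s) :=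
      rep h4 h3 (e.k * (c.k * c.s) * (c.k * c.s))
    have h6 : 1 ≤ (c.s * D.k * D.k) * (c.s * D.k * D.k) * (c.k * c.s) * (c.k * c.s) :=
      rep h5 h3 ((c.s * D.k * D.k) * (c.k * c.s) * (c.k * c.s))
    have h7 : 1 ≤ D.k ^ 4 * c.s * (c.s * c.k * c.s) := rep h6 c.th' (D.k ^ 4 * (c.s * c.k * c.s))
    have h8 : 1 ≤ D.k ^ 4 * c.s * c.s := rep h7 c.th' (D.k ^ 4 * c.s)
    have h9 : 1 ≤ D.s ^ 4 * c.k * c.k := flp h8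
    have h0 := Arc.ppow hDP
    have hDn : D.t = n + 5 := by omega
    rw [hDn] at h0
    have h10 : 1 ≤ D.s ^ 4 * c.k * c.k * D.k ^ (n + 5) := one_le_mul h9 h0
    have h11 : 1 ≤ (D.k * D.s) * c.k * c.k * D.k ^ (n + 1) :=
      rep h10 (Arc.Fpow (d := D) 3) (c.k * c.k * D.k ^ (n + 1))
    have h12 : 1 ≤ c.k * c.k * D.k ^ (n + 1) := rep h11 D.th (c.k * c.k * D.k ^ n)
    have := Arc.len h12 D (c.k * c.k * D.k ^ n)
    omega
  · have he : e.t = n + 4 := by omega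
    have h1 : 1 ≤ e.k * e.k ^ (n + 3) := rep e.one (Arc.pS heP he) e.k
    have h2 : 1 ≤ D.k * D.k * e.k ^ (n + 3) := rep h1 hC (e.k ^ (n + 3))
    obtain ⟨b, b1, b2, b3, -, hl⟩ := EX2 D e h2 (Q := D.k * e.k ^ (n + 2)) (by omega)
    have hbn : b = n + 3 := by omega
    subst hbn
    rcases hl with ⟨p, p1, p2, p3⟩ | ⟨o', hE, hE'⟩
    · have : p = e := Arc.eqt (by omega)
      subst this
      exact Arc.notF ((Arc.abs (rng p2)).trans (Arc.sqF hC))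
    have h3 : 1 ≤ e.k * D.k * e.s * c.s := by
      have : 1 ≤ D.k * e.k * c.s * e.s := meet o' hE hX.2
      exact rng this
    have h4 := swp h3 e D c
    have h5 : 1 ≤ D.k * c.k * e.k ^ (n + 3) := rep h2 h4 (D.k * e.k ^ (n + 2))
    have h6 : 1 ≤ c.k * c.k * e.k ^ (n + 3) := rep h5 h4 (c.k * e.k ^ (n + 2))
    have h7 : e.s ≤ e.k * (c.k * c.s) := Arc.a1 h e _
    have h8 : e.k ≤ e.s * (c.k * c.s) := flp h7
    have h9 : 1 ≤ c.k * c.k * (e.s * (c.k * c.s)) * e.k ^ (n + 2) :=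
      rep h6 h8 (c.k * c.k * e.k ^ (n + 2))
    have h10 : 1 ≤ c.k * c.k * e.s * e.k ^ (n + 2) := rep h9 c.th (c.k * e.s * e.k ^ (n + 2))
    have h11 : 1 ≤ c.k * c.k * e.k ^ (n + 1) := rep h10 e.th (c.k * c.k * e.k ^ n)
    have := Arc.len h11 e (c.k * c.k * e.k ^ n)
    omega
  · exact part3D hc (by omega) (by omega) hcP h hX.1 hX.2 hDD

end Part3
end CTWDR

namespace CTWDR
section Fin
set_option linter.unusedSectionVars false
variable {V : Type*} [Fintype V] {G : CTWDR V} [Nonempty V]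
open Cx

theorem seg {f : ℕ → V} {t : ℕ} (hf : ∀ i < t, G.adj (f i) (f (i + 1))) (a n : ℕ)
    (h : a + n ≤ t) : (A G ^ n).R (f a) (f (a + n)) :=
  A_pow.2 ⟨fun j => f (a + j), rfl, rfl, fun i hi => hf (a + i) (by omega)⟩

theorem circ2 {f : ℕ → V} {t : ℕ} (h0 : f t = f 0) (hf : ∀ i < t, G.adj (f i) (f (i + 1)))
    {P Q : Cx G} {i j : ℕ} (hij : i < j) (hj : j < t) (hP : P.R (f i) (f (i + 1)))
    (hQ : Q.R (f j) (f (j + 1))) : 1 ≤ P * Q * A G ^ (t - 2) := by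
  have s1 := seg (G := G) hf (i + 1) (j - (i + 1)) (by omega)
  have s2 := seg (G := G) hf (j + 1) (t - (j + 1)) (by omega)
  have s3 := seg (G := G) hf 0 i (by omega)
  rw [show i + 1 + (j - (i + 1)) = j by omega] at s1
  rw [show j + 1 + (t - (j + 1)) = t by omega, h0] at s2
  rw [Nat.zero_add] at s3
  have : 1 ≤ P * (A G ^ (j - (i + 1)) * (Q * (A G ^ (t - (j + 1)) * A G ^ i))) :=
    one_le_of (x := f i) ⟨_, hP, _, s1, _, hQ, _, s2, s3⟩
  have e : t - 2 = (j - (i + 1)) + (t - (j + 1)) + i := by omega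
  rw [e]
  exact rng this

theorem pure_of {c : Arc G} (hc : c.P) : G.Pure c.t := by
  rintro f ⟨ht, h0, hf⟩ ⟨i, hi, hci⟩ j hj
  have hcR : c.k.R (f i) (f (i + 1)) := hci
  obtain ⟨r, hr⟩ := Arc.exA (G := G) (A_R.2 ((dd_one G).2 (hf j hj)))
  have hrc : i ≠ j → r = c := by
    intro hij
    rcases lt_or_gt_of_ne hij with h | h
    · exact hc r (circ2 h0 hf h hj hcR hr)
    · exact hc r (rng (circ2 h0 hf h hi hr hcR))
  by_cases hij : i = j
  · subst hij; exact hci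
  · have := hrc hij
    subst this
    exact hr

theorem arc_of {t : ℕ} (h : Attained G.adj (1, t - 1)) : ∃ d : Arc G, d.t = t := by
  obtain ⟨x, y, hxy⟩ := h
  have h1 : ddist G.adj x y = 1 := congrArg Prod.fst hxy
  have h2 : ddist G.adj y x = t - 1 := congrArg Prod.snd hxy
  have h3 : 2 ≤ t := by
    by_contra h4
    have h5 : ddist G.adj y x = 0 := by omega
    have := dd_zero G h5
    subst this
    omega
  refine ⟨⟨t, h3, one_le_of (x := x) ⟨y, hxy, ?_⟩⟩, rfl⟩
  rw [rel_R, td_swap G x y, hxy]; rfl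

end Fin
end CTWDR

/-- Lemma 6.2: if `s < h`, both in `T`, and
`Γ_{1,h-1}^2 ∩ Γ_{1,s-1}Γ_{s-1,1} ≠ ∅`, then `s = h-1` and `(1,h-2)` is pure;
moreover if `Γ_{1,h-1} ∉ Γ_{1,s-1}Γ_{s-1,1}` then `h+1 ∉ T`. -/
theorem stmt16 {V : Type*} [Fintype V] (G : CTWDR V) (s h : ℕ) (hsh : s < h)
    (hs : Attained G.adj (1, s - 1)) (hh : Attained G.adj (1, h - 1))
    (hcap : (G.pow (1, h - 1) 2 ∩ G.prodS {(1, s - 1)} {(s - 1, 1)}).Nonempty) :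
    s = h - 1 ∧ G.Pure (h - 1) ∧
    ((1, h - 1) ∉ G.prodS {(1, s - 1)} {(s - 1, 1)} → ¬ Attained G.adj (1, h)) := by
  have hV : Nonempty V := ⟨hs.choose⟩
  obtain ⟨c, rfl⟩ := CTWDR.arc_of hs
  obtain ⟨e, rfl⟩ := CTWDR.arc_of hh
  have hc2 := c.two
  have H : 1 ≤ e.k * e.k * (c.k * c.s) := by
    obtain ⟨g, ⟨i, hi, j, hj, hp⟩, ⟨i', hi', j', hj', hp'⟩⟩ := hcap
    rw [CTWDR.pow, Set.mem_singleton_iff] at hi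
    rw [Set.mem_singleton_iff] at hj hi' hj'
    subst hi hj hi' hj'
    obtain ⟨x, y, z, h1, h2, h3⟩ := CTWDR.Cx.pnum_ne hp
    obtain ⟨x', y', z', h4, h5, h6⟩ := CTWDR.Cx.pnum_ne hp'
    have h7 : (c.k * c.s).R y x := by
      have h8 : (CTWDR.Cx.st (c.k * c.s)).R x y :=
        (CTWDR.Cx.st (c.k * c.s)).inv (h4.trans h1.symm) (by
          rw [CTWDR.Cx.st_mul, CTWDR.st_k, CTWDR.st_s, mul_comm]
          exact ⟨z', h5, h6⟩)
      exact h8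
    exact CTWDR.Cx.one_le_of (x := x) ⟨y, ⟨z, h2, h3⟩, h7⟩
  have p1 := CTWDR.part1 c e hsh H
  have p2 := CTWDR.part2 c e p1 H
  have p3 : e.t - 1 = c.t := by omega
  refine ⟨p3.symm, p3 ▸ CTWDR.pure_of p2, ?_⟩
  intro hn hD
  obtain ⟨D, hDt⟩ := CTWDR.arc_of (G := G) (t := e.t + 1) hD
  refine CTWDR.part3 c e D p1 hDt H ?_
  intro hle
  apply hn
  refine ⟨_, rfl, _, rfl, ?_⟩
  obtain ⟨x, y, hxy⟩ := hh
  obtain ⟨z, h1, h2⟩ := hle x y hxy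
  rw [CTWDR.Cx.pnum_eq hxy]
  exact Set.ncard_ne_zero_of_mem (a := z) ⟨h1, h2⟩ (Set.toFinite _)
end
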